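/- arXiv:1507.01505 — 2 statements merged into one kernel-verified Lean document; each statement's English description precedes it below -/
import Mathlib

section
/- Let n be a positive integer and let w be a weight function on [-1,1]. Let 0 < η < 1 and let D ⊂ [-1,1] be a Lebesgue measurable set with ∫_D dt/√(1-t²) ≤ (1-η)²·π/(2n+1), and suppose E := essinf_{t ∈ [-1,1]\D} √(1-t²)·w(t) > 0. Then for every integer N ≥ (2/η)·(∫_{-1}^1 w(t)dt / E)·n, there exists a Chebyshev-type quadrature of degree n for w with exactly N nodes. -/
open MeasureTheory Real Set

noncomputable section

/-- A weight function on `[-1,1]`: nonnegative, zero outside `[-1,1]`, integrable,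
with positive integral. -/
def IsWeight (w : ℝ → ℝ) : Prop :=
  Measurable w ∧ (∀ t, 0 ≤ w t) ∧ (∀ t, t ∉ Icc (-1:ℝ) 1 → w t = 0) ∧
  IntervalIntegrable w volume (-1) 1 ∧ 0 < ∫ t in (-1:ℝ)..1, w t

/-- A Chebyshev-type quadrature of degree `n` for `w` with `N` nodes. -/
def IsChebQuad (w : ℝ → ℝ) (n N : ℕ) (t : Fin N → ℝ) : Prop :=
  Monotone t ∧ (∀ i, t i ∈ Icc (-1:ℝ) 1) ∧
  ∀ p : Polynomial ℝ, p.natDegree ≤ n →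
    (∫ x in (-1:ℝ)..1, p.eval x * w x) =
      ((∫ x in (-1:ℝ)..1, w x) / N) * ∑ i, p.eval (t i)

section NoRetraction

variable {E : Type*} [NormedAddCommGroup E] [InnerProductSpace ℝ E]

/-- Extending a Lipschitz map on a ball that vanishes on the boundary sphere by zero preserves the
Lipschitz constant. -/
theorem LipschitzOnWith.indicator_closedBall {v : E → E} {ρ : ℝ} {K : NNReal}
    (hv : LipschitzOnWith K v (Metric.closedBall 0 ρ))
    (h0 : ∀ x, ‖x‖ = ρ → v x = 0) :
    LipschitzWith K ((Metric.closedBall 0 ρ).indicator v) := by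
  have key : ∀ x y : E, ‖x‖ ≤ ρ → ρ < ‖y‖ → ‖v x‖ ≤ K * ‖x - y‖ := by
    intro x y hx hy
    obtain ⟨s, hs, hsρ⟩ := intermediate_value_Icc zero_le_one
      (f := fun s : ℝ => ‖x + s • (y - x)‖) (by fun_prop)
      (show ρ ∈ Icc _ _ from ⟨by simpa using hx, by simpa using hy.le⟩)
    have h1 := hv.norm_sub_le (show x ∈ Metric.closedBall 0 ρ by simpa using hx)
      (show x + s • (y - x) ∈ Metric.closedBall 0 ρ by simpa using hsρ.le)
    rw [h0 _ hsρ, sub_zero] at h1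
    refine h1.trans ?_
    gcongr
    rw [sub_add_cancel_left, norm_neg, norm_smul, Real.norm_of_nonneg hs.1, norm_sub_rev y x]
    exact mul_le_of_le_one_left (norm_nonneg _) hs.2
  refine LipschitzWith.of_dist_le_mul fun x y => ?_
  rw [dist_eq_norm, dist_eq_norm]
  by_cases hx : ‖x‖ ≤ ρ <;> by_cases hy : ‖y‖ ≤ ρ
  · rw [indicator_of_mem (by simpa using hx), indicator_of_mem (by simpa using hy)]
    exact hv.norm_sub_le (by simpa using hx) (by simpa using hy)
  · rw [indicator_of_mem (by simpa using hx), indicator_of_notMem (by simpa using hy), sub_zero]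
    exact key x y hx (not_le.mp hy)
  · rw [indicator_of_notMem (by simpa using hx), indicator_of_mem (by simpa using hy), zero_sub,
      norm_neg, norm_sub_rev]
    exact key y x hy (not_le.mp hx)
  · rw [indicator_of_notMem (by simpa using hx), indicator_of_notMem (by simpa using hy)]
    simp; positivity

variable [FiniteDimensional ℝ E]

/-- Lagrange extrapolation of the polynomial `t ↦ det (1 + t A)` from the nodes `s` to `t = 1`. -/
theorem exists_weights_det_id_add (s : Finset ℝ) (hs : Module.finrank ℝ E < s.card) :
    ∃ c : ℝ → ℝ, ∑ j ∈ s, c j = 1 ∧ ∀ A : E →L[ℝ] E,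
      (ContinuousLinearMap.id ℝ E + A).det =
        ∑ j ∈ s, c j * (ContinuousLinearMap.id ℝ E + j • A).det := by
  classical
  have hne : s.Nonempty := Finset.card_pos.mp (by omega)
  have hinj : Set.InjOn (id : ℝ → ℝ) s := Function.injective_id.injOn
  refine ⟨fun j => (Lagrange.basis s id j).eval 1, ?_, fun A => ?_⟩
  · rw [← Polynomial.eval_finsetSum, Lagrange.sum_basis hinj hne, Polynomial.eval_one]
  · set b := Module.finBasis ℝ E
    set M := LinearMap.toMatrix b b (A : E →ₗ[ℝ] E) with hM
    set q : Polynomial ℝ := ((Polynomial.X : Polynomial ℝ) • M.map Polynomial.C +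
      (1 : Matrix _ _ ℝ).map Polynomial.C).det with hqdef
    have hq : ∀ t : ℝ, (ContinuousLinearMap.id ℝ E + t • A).det = q.eval t := by
      intro t
      rw [ContinuousLinearMap.det, ← LinearMap.det_toMatrix b, hqdef,
        ← Polynomial.coe_evalRingHom, RingHom.map_det]
      congr 1
      have : ((ContinuousLinearMap.id ℝ E + t • A : E →L[ℝ] E) : E →ₗ[ℝ] E) =
        LinearMap.id + t • (A : E →ₗ[ℝ] E) := rfl
      rw [this, map_add, map_smul, LinearMap.toMatrix_id, ← hM]
      ext i j
      simp [Matrix.one_apply, apply_ite, add_comm]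
      exact mul_comm _ _
    have hdeg : q.degree < s.card := by
      refine lt_of_le_of_lt Polynomial.degree_le_natDegree ?_
      have := Polynomial.natDegree_det_X_add_C_le M 1
      rw [Fintype.card_fin] at this
      exact_mod_cast lt_of_le_of_lt this hs
    have h1 := hq 1
    rw [one_smul] at h1
    rw [h1]
    conv_lhs => rw [Lagrange.eq_interpolate hinj hdeg]
    simp only [Lagrange.interpolate_apply, Polynomial.eval_finsetSum, Polynomial.eval_mul,
      Polynomial.eval_C, hq, id, mul_comm]

theorem det_id_add_pos {A : E →L[ℝ] E} (hA : ‖A‖ < 1) :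
    0 < (ContinuousLinearMap.id ℝ E + A).det := by
  have hne : ∀ s ∈ Icc (0:ℝ) 1, (ContinuousLinearMap.id ℝ E + s • A).det ≠ 0 := by
    intro s hs h0
    rw [ContinuousLinearMap.det] at h0
    obtain ⟨x, hx, hx0⟩ := (Submodule.ne_bot_iff _).mp
      (bot_lt_iff_ne_bot.mp (LinearMap.bot_lt_ker_of_det_eq_zero h0))
    have hx' : x = -(s • A x) := eq_neg_of_add_eq_zero_left (by simpa using hx)
    have h1 : ‖x‖ ≤ ‖A‖ * ‖x‖ := by
      calc ‖x‖ = s * ‖A x‖ := by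
            conv_lhs => rw [hx']
            rw [norm_neg, norm_smul, Real.norm_of_nonneg hs.1]
        _ ≤ 1 * ‖A x‖ := by gcongr; exact hs.2
        _ ≤ ‖A‖ * ‖x‖ := by rw [one_mul]; exact A.le_opNorm x
    have := norm_pos_iff.mpr hx0
    nlinarith
  have hcont : Continuous fun s : ℝ => (ContinuousLinearMap.id ℝ E + s • A).det :=
    ContinuousLinearMap.continuous_det.comp (by fun_prop)
  by_contra! hle
  obtain ⟨s, hs, h0⟩ := intermediate_value_Icc' zero_le_one hcont.continuousOn
    (show (0:ℝ) ∈ Icc _ _ from ⟨by simpa using hle, by simp [ContinuousLinearMap.det]⟩)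
  exact hne s hs h0

/-- A map with locally constant nonzero norm has singular derivative. -/
theorem det_fderiv_eq_zero_of_norm_eq {u : E → E} {u' : E →L[ℝ] E} {x : E} {ρ : ℝ} (hρ : 0 < ρ)
    (hu : HasFDerivAt u u' x) (hn : ∀ᶠ y in nhds x, ‖u y‖ = ρ) : u'.det = 0 := by
  by_contra hdet
  have hsurj : Function.Surjective u' := by
    have := (LinearMap.equivOfDetNeZero (u' : E →ₗ[ℝ] E) hdet).surjective
    exact this
  have h1 : HasFDerivAt (fun y => ‖u y‖ ^ 2) (2 • (innerSL ℝ (u x)).comp u') x := hu.norm_sq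
  have h2 : HasFDerivAt (fun y => ‖u y‖ ^ 2) (0 : E →L[ℝ] ℝ) x :=
    (hasFDerivAt_const (ρ ^ 2) x).congr_of_eventuallyEq (hn.mono fun y hy => by simp [hy])
  obtain ⟨y, hy⟩ := hsurj (u x)
  have h3 := congrArg (fun L : E →L[ℝ] ℝ => L y) (h1.unique h2)
  simp [hy] at h3
  have := hn.self_of_nhds
  rw [h3] at this
  simp at this
  exact hρ.ne this

variable [MeasurableSpace E] [BorelSpace E]

/-- For small `t` the map `x ↦ x + t v x` is a bijection of the ball, so it preserves the volume. -/
theorem integral_det_id_add_smul {v : E → E} {v' : E → E →L[ℝ] E} {ρ t : ℝ} {K : NNReal}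
    (ht0 : 0 ≤ t) (ht : t * K < 1)
    (hv : LipschitzOnWith K v (Metric.closedBall 0 ρ)) (h0 : ∀ x, ‖x‖ = ρ → v x = 0)
    (hd : ∀ x ∈ Metric.ball (0:E) ρ, HasFDerivAt v (v' x) x) :
    IntegrableOn (fun x => (ContinuousLinearMap.id ℝ E + t • v' x).det) (Metric.ball 0 ρ) ∧
    ∫ x in Metric.ball (0:E) ρ, (ContinuousLinearMap.id ℝ E + t • v' x).det =
      volume.real (Metric.ball (0:E) ρ) := by
  set k := (Metric.closedBall (0:E) ρ).indicator v with hk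
  have hkL : LipschitzWith K k := hv.indicator_closedBall h0
  set B := Metric.ball (0:E) ρ
  have hk0 : ∀ x ∉ B, k x = 0 := by
    intro x hx
    by_cases hx' : x ∈ Metric.closedBall (0:E) ρ
    · rw [hk, indicator_of_mem hx']
      refine h0 x (le_antisymm (by simpa using hx') (by simpa [B] using hx))
    · rw [hk, indicator_of_notMem hx']
  set F : E → E := fun x => x + t • k x with hF
  have hkd : ∀ x ∈ B, HasFDerivAt k (v' x) x := fun x hx =>
    (hd x hx).congr_of_eventuallyEq (by
      filter_upwards [Metric.isOpen_ball.mem_nhds hx] with y hy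
      rw [hk, indicator_of_mem (Metric.ball_subset_closedBall hy)])
  have hFd : ∀ x ∈ B, HasFDerivAt F (ContinuousLinearMap.id ℝ E + t • v' x) x := fun x hx =>
    (hasFDerivAt_id x).add ((hkd x hx).const_smul t)
  have happ : ApproximatesLinearOn F ((ContinuousLinearEquiv.refl ℝ E : E ≃L[ℝ] E) : E →L[ℝ] E)
      univ (t.toNNReal * K) := by
    intro x _ y _
    have : F x - F y - ((ContinuousLinearEquiv.refl ℝ E : E ≃L[ℝ] E) : E →L[ℝ] E) (x - y) =
        t • (k x - k y) := by
      simp [hF, smul_sub]; abel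
    rw [this, norm_smul, Real.norm_of_nonneg ht0, NNReal.coe_mul, Real.coe_toNNReal _ ht0,
      mul_assoc]
    gcongr
    exact hkL.norm_sub_le x y
  have hbij : Function.Bijective F := by
    have hc : Subsingleton E ∨ t.toNNReal * K <
        ‖(((ContinuousLinearEquiv.refl ℝ E : E ≃L[ℝ] E).symm : E ≃L[ℝ] E) : E →L[ℝ] E)‖₊⁻¹ := by
      rcases subsingleton_or_nontrivial E with h | h
      · exact Or.inl h
      · right
        have : ‖(((ContinuousLinearEquiv.refl ℝ E : E ≃L[ℝ] E).symm : E ≃L[ℝ] E) : E →L[ℝ] E)‖₊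
            = 1 := by
          simp
        rw [this, inv_one, ← NNReal.coe_lt_coe, NNReal.coe_mul, Real.coe_toNNReal _ ht0]
        simpa using ht
    exact ⟨injOn_univ.mp (happ.injOn hc), happ.surjective hc⟩
  have himg : F '' B = B := by
    have h1 : F '' Bᶜ = Bᶜ := by
      rw [show F '' Bᶜ = id '' Bᶜ from image_congr fun x hx => by simp [hF, hk0 x hx], image_id]
    rw [image_compl_eq hbij] at h1
    exact compl_injective h1
  have hpos : ∀ x ∈ B, 0 < (ContinuousLinearMap.id ℝ E + t • v' x).det := by
    intro x hx
    refine det_id_add_pos (lt_of_le_of_lt ?_ ht)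
    rw [norm_smul, Real.norm_of_nonneg ht0]
    gcongr
    exact (hkd x hx).le_of_lipschitz hkL
  have hBm : MeasurableSet B := Metric.isOpen_ball.measurableSet
  have hFw : ∀ x ∈ B, HasFDerivWithinAt F (ContinuousLinearMap.id ℝ E + t • v' x) B x :=
    fun x hx => (hFd x hx).hasFDerivWithinAt
  have hEq : EqOn (fun x => |(ContinuousLinearMap.id ℝ E + t • v' x).det| • (1:ℝ))
      (fun x => (ContinuousLinearMap.id ℝ E + t • v' x).det) B := fun x hx => by
    simp [abs_of_pos (hpos x hx)]
  constructor
  · rw [← integrableOn_congr_fun hEq hBm]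
    refine (integrableOn_image_iff_integrableOn_abs_det_fderiv_smul volume hBm hFw
      hbij.1.injOn (fun _ => (1:ℝ))).mp ?_
    rw [himg]
    exact integrableOn_const (measure_ball_lt_top.ne) 
  · rw [← setIntegral_congr_fun hBm hEq,
      ← integral_image_eq_integral_abs_det_fderiv_smul volume hBm hFw hbij.1.injOn
        (fun _ => (1:ℝ)), himg]
    simp

/-- There is no `C¹` retraction of a ball onto its boundary sphere. -/
theorem no_contDiff_retraction {u : E → E} {ρ : ℝ} (hρ : 0 < ρ) (hu : ContDiff ℝ 1 u)
    (hn : ∀ x ∈ Metric.closedBall (0:E) ρ, ‖u x‖ = ρ) (hid : ∀ x, ‖x‖ = ρ → u x = x) : False := by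
  set v : E → E := fun x => u x - x
  have hvc : ContDiff ℝ 1 v := hu.sub contDiff_id
  obtain ⟨K, hK⟩ := hvc.contDiffOn.exists_lipschitzOnWith (s := Metric.closedBall (0:E) ρ)
    one_ne_zero (convex_closedBall 0 ρ) (isCompact_closedBall 0 ρ)
  have hud : ∀ x, HasFDerivAt u (fderiv ℝ u x) x := fun x =>
    (hu.differentiable one_ne_zero x).hasFDerivAt
  have hvd : ∀ x, HasFDerivAt v (fderiv ℝ u x - ContinuousLinearMap.id ℝ E) x := fun x =>
    (hud x).sub (hasFDerivAt_id x)
  obtain ⟨s, hs, hcard⟩ :=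
    (Ioo_infinite (show (0:ℝ) < 1 / (K + 1) by positivity)).exists_subset_card_eq (Module.finrank ℝ E + 1)
  obtain ⟨c, hc1, hc⟩ := exists_weights_det_id_add (E := E) s (by omega)
  have hint := fun t (ht : t ∈ s) => integral_det_id_add_smul (t := t) (hs ht).1.le
    (by
      have := (hs ht).2
      rw [lt_div_iff₀ (by positivity)] at this
      have := (hs ht).1
      linarith) hK (fun x hx => by simp [v, hid x hx]) (fun x _ => hvd x)
  have hzero : ∀ x ∈ Metric.ball (0:E) ρ, (fderiv ℝ u x).det = 0 := fun x hx =>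
    det_fderiv_eq_zero_of_norm_eq hρ (hud x) (by
      filter_upwards [Metric.isOpen_ball.mem_nhds hx] with y hy
      exact hn y (Metric.ball_subset_closedBall hy))
  have h1 : ∫ x in Metric.ball (0:E) ρ, ∑ j ∈ s, c j * (ContinuousLinearMap.id ℝ E +
      j • (fderiv ℝ u x - ContinuousLinearMap.id ℝ E)).det = 0 := by
    refine setIntegral_eq_zero_of_forall_eq_zero fun x hx => ?_
    rw [← hc, add_sub_cancel, hzero x hx]
  rw [integral_finsetSum _ fun j hj => (hint j hj).1.const_mul _] at h1
  simp_rw [integral_const_mul] at h1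
  rw [Finset.sum_congr rfl fun j hj => by rw [(hint j hj).2], ← Finset.sum_mul, hc1, one_mul] at h1
  exact (ENNReal.toReal_pos (Metric.measure_ball_pos volume (0:E) hρ).ne'
    measure_ball_lt_top.ne).ne' h1

/-- A continuous vector field pointing outwards far from the origin has a zero. -/
theorem exists_eq_zero_of_inner_pos {f : E → E} (hf : Continuous f) {R : ℝ} (hR : 0 < R)
    (hpos : ∀ x, R ≤ ‖x‖ → 0 < inner ℝ x (f x)) : ∃ x, f x = 0 := by
  by_contra! hne
  set χ : E → ℝ := fun x => max 0 (min 1 (‖x‖ / R - 1)) with hχ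
  have hχ0 : ∀ x, 0 ≤ χ x := fun x => le_max_left _ _
  have hχ1 : ∀ x, χ x ≤ 1 := fun x => max_le zero_le_one (min_le_left _ _)
  set F : E → E := fun x => (1 - χ x) • f x + χ x • x with hF
  have hFc : Continuous F := by fun_prop
  have hFid : ∀ x, 2 * R ≤ ‖x‖ → F x = x := by
    intro x hx
    have : χ x = 1 := by
      have : 1 ≤ ‖x‖ / R - 1 := by
        rw [le_sub_iff_add_le, le_div_iff₀ hR]; linarith
      simp [hχ, min_eq_left this]
    simp [hF, this]
  have hFne : ∀ x, F x ≠ 0 := by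
    intro x
    rcases le_or_gt R ‖x‖ with hx | hx
    · intro h
      have h1 : inner ℝ x (F x) = (1 - χ x) * inner ℝ x (f x) + χ x * ‖x‖ ^ 2 := by
        rw [hF, inner_add_right, inner_smul_right, inner_smul_right, real_inner_self_eq_norm_sq]
      rw [h, inner_zero_right] at h1
      have h2 := hpos x hx
      have h3 : 0 < ‖x‖ ^ 2 := by
        have := hR.trans_le hx
        positivity
      have h4 := mul_nonneg (sub_nonneg.mpr (hχ1 x)) h2.le
      have h5 := mul_nonneg (hχ0 x) h3.le
      have h6 : χ x = 0 := by
        have : χ x * ‖x‖ ^ 2 = 0 := by linarith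
        exact (mul_eq_zero.mp this).resolve_right h3.ne'
      rw [h6] at h1
      linarith
    · have : χ x = 0 := by
        refine max_eq_left ((min_le_right _ _).trans ?_)
        rw [sub_nonpos, div_le_one hR]
        exact hx.le
      simpa [hF, this] using hne x
  obtain ⟨g, hg, hgd, hgS, -⟩ := hFc.exists_contDiff_approx_and_eqOn (ε := fun x => ‖F x‖) 1
    hFc.norm (fun x => norm_pos_iff.mpr (hFne x)) (S := {x | 3 * R ≤ ‖x‖}) (U := {x | 2 * R < ‖x‖})
    (isClosed_le continuous_const continuous_norm)
    ((isOpen_lt continuous_const continuous_norm).mem_nhdsSet.mpr fun x (hx : 3 * R ≤ ‖x‖) =>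
      show 2 * R < ‖x‖ by linarith)
    (contDiffOn_id.congr fun x (hx : 2 * R < ‖x‖) => hFid x hx.le)
  have hg0 : ∀ x, g x ≠ 0 := by
    intro x h
    have := hgd x
    rw [h, dist_zero_left] at this
    exact lt_irrefl _ this
  refine no_contDiff_retraction (E := E) (ρ := 3 * R) (u := fun x => (3 * R * ‖g x‖⁻¹) • g x)
    (by positivity) ?_ ?_ ?_
  · exact (contDiff_const.mul ((hg.norm ℝ hg0).inv fun x => norm_ne_zero_iff.mpr (hg0 x))).smul hg
  · intro x _
    have := norm_ne_zero_iff.mpr (hg0 x)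
    rw [norm_smul, Real.norm_of_nonneg (by positivity), mul_assoc, inv_mul_cancel₀ this, mul_one]
  · intro x hx
    have h1 : g x = x := by
      rw [hgS (show 3 * R ≤ ‖x‖ from hx.ge), hFid x (by linarith)]
    simp only [h1, hx]
    rw [mul_inv_cancel₀ (by positivity), one_smul]

end NoRetraction

/-- The nodes `(2 * r + 1) * π / (2 * n)` of the Riesz interpolation formula. -/
def rieszNode (n r : ℕ) : ℝ := (2 * r + 1) * (π / (2 * n))

/-- The points of the unit circle with arguments `rieszNode n r`. -/
def rieszPoint (n r : ℕ) : ℂ := Complex.exp (rieszNode n r * Complex.I)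

theorem sum_rieszPoint_pow {n m : ℕ} (hn : 0 < n) (hm0 : 0 < m) (hm : m < 4 * n) :
    ∑ r ∈ Finset.range (2 * n), rieszPoint n r ^ m = if m = 2 * n then -(2 * n : ℂ) else 0 := by
  have hn' : (n : ℂ) ≠ 0 := by exact_mod_cast hn.ne'
  set ω := Complex.exp (π / (2 * n) * Complex.I) with hωdef
  set ζ := Complex.exp (2 * π * Complex.I / (2 * n : ℕ)) with hζdef
  have hζ : IsPrimitiveRoot ζ (2 * n) := Complex.isPrimitiveRoot_exp _ (by omega)
  have hz : ∀ r, rieszPoint n r ^ m = ω ^ m * (ζ ^ m) ^ r := by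
    intro r
    have h1 : rieszPoint n r = ω * ζ ^ r := by
      rw [rieszPoint, rieszNode, hωdef, hζdef, ← Complex.exp_nat_mul, ← Complex.exp_add]
      congr 1
      push_cast
      field_simp
      ring
    rw [h1, mul_pow, ← pow_mul, mul_comm r m, pow_mul]
  simp_rw [hz]
  rw [← Finset.mul_sum]
  split_ifs with h
  · subst h
    have hω : ω ^ (2 * n) = -1 := by
      rw [← Complex.exp_nat_mul, ← Complex.exp_pi_mul_I]
      congr 1
      push_cast
      field_simp
    rw [hζ.pow_eq_one, hω]
    simp
  · have h1 : ζ ^ m ≠ 1 := by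
      intro h1
      obtain ⟨c, hc⟩ := hζ.dvd_of_pow_eq_one _ h1
      have : c = 1 := by
        have h2 : 0 < c := by
          rcases Nat.eq_zero_or_pos c with rfl | h2
          · simp at hc; omega
          · exact h2
        have h3 : c < 2 := by
          by_contra h3
          have : 2 * n * 2 ≤ 2 * n * c := Nat.mul_le_mul_left _ (by omega)
          omega
        omega
      subst this
      omega
    have h2 := geom_sum_eq h1 (2 * n)
    rw [h2, ← pow_mul, mul_comm m, pow_mul, hζ.pow_eq_one]
    simp

theorem rieszPoint_pow_self {n : ℕ} (hn : 0 < n) (r : ℕ) :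
    rieszPoint n r ^ n = (-1) ^ r * Complex.I := by
  have hn' : (n : ℂ) ≠ 0 := by exact_mod_cast hn.ne'
  have : (n : ℂ) * (rieszNode n r * Complex.I) = r * (π * Complex.I) + π / 2 * Complex.I := by
    rw [rieszNode]
    push_cast
    field_simp
  rw [rieszPoint, ← Complex.exp_nat_mul, this, Complex.exp_add, Complex.exp_nat_mul,
    Complex.exp_pi_mul_I, Complex.exp_pi_div_two_mul_I]

theorem conj_rieszPoint_mul (n r : ℕ) :
    (starRingEnd ℂ) (rieszPoint n r) * rieszPoint n r = 1 := by
  rw [mul_comm, Complex.mul_conj, Complex.normSq_eq_norm_sq, rieszPoint,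
    Complex.norm_exp_ofReal_mul_I]
  simp

theorem conj_rieszPoint_pow_mul_pow {n r l m : ℕ} (h : l ≤ m) :
    (starRingEnd ℂ) (rieszPoint n r) ^ l * rieszPoint n r ^ m = rieszPoint n r ^ (m - l) := by
  obtain ⟨d, rfl⟩ := Nat.exists_eq_add_of_le h
  rw [pow_add, ← mul_assoc, ← mul_pow, conj_rieszPoint_mul, one_pow, one_mul,
    Nat.add_sub_cancel_left]

/-- Values of the (unnormalised) Fejér kernel at the nodes. -/
def fejerWeight (n r : ℕ) : ℝ :=
  Complex.normSq (∑ j ∈ Finset.range n, rieszPoint n r ^ j)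

theorem fejerWeight_mul_pow {n m : ℕ} (h : n ≤ m + 1) (r : ℕ) :
    (fejerWeight n r : ℂ) * rieszPoint n r ^ m =
      ∑ j ∈ Finset.range n, ∑ l ∈ Finset.range n, rieszPoint n r ^ (j + (m - l)) := by
  rw [fejerWeight, ← Complex.mul_conj, map_sum, Finset.sum_mul_sum, Finset.sum_mul]
  refine Finset.sum_congr rfl fun j _ => ?_
  rw [Finset.sum_mul]
  refine Finset.sum_congr rfl fun l hl => ?_
  rw [Finset.mem_range] at hl
  rw [map_pow, mul_assoc, conj_rieszPoint_pow_mul_pow (by omega), pow_add]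

theorem sum_fejerWeight_mul_pow {n k : ℕ} (hn : 0 < n) (hk : k ≤ n) :
    ∑ r ∈ Finset.range (2 * n), (fejerWeight n r : ℂ) * rieszPoint n r ^ (n + k) =
      -(2 * n : ℂ) * k := by
  have h1 : ∀ r, (fejerWeight n r : ℂ) * rieszPoint n r ^ (n + k) = _ :=
    fun r => fejerWeight_mul_pow (by omega) r
  simp_rw [h1]
  rw [Finset.sum_comm]
  have h2 : ∀ j ∈ Finset.range n, ∑ r ∈ Finset.range (2 * n), ∑ l ∈ Finset.range n,
      rieszPoint n r ^ (j + (n + k - l)) = if n ≤ j + k then -(2 * n : ℂ) else 0 := by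
    intro j hj
    rw [Finset.mem_range] at hj
    rw [Finset.sum_comm]
    have h3 : ∀ l ∈ Finset.range n, ∑ r ∈ Finset.range (2 * n),
        rieszPoint n r ^ (j + (n + k - l)) = if j + k = n + l then -(2 * n : ℂ) else 0 := by
      intro l hl
      rw [Finset.mem_range] at hl
      rw [sum_rieszPoint_pow hn (by omega) (by omega)]
      exact if_congr (by omega) rfl rfl
    rw [Finset.sum_congr rfl h3]
    split_ifs with h
    · rw [Finset.sum_eq_single (j + k - n)]
      · rw [if_pos (by omega)]
      · intro l _ hl
        rw [if_neg (by omega)]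
      · intro hl
        rw [Finset.mem_range] at hl
        omega
    · refine Finset.sum_eq_zero fun l _ => if_neg (by omega)
  rw [Finset.sum_congr rfl h2, ← Finset.sum_filter, Finset.sum_const]
  have h4 : (Finset.range n).filter (fun j => n ≤ j + k) = Finset.Ico (n - k) n := by
    ext j; simp; omega
  rw [h4, Nat.card_Ico, Nat.sub_sub_self hk, nsmul_eq_mul, mul_comm]

theorem sum_fejerWeight {n : ℕ} (hn : 0 < n) :
    ∑ r ∈ Finset.range (2 * n), fejerWeight n r = 2 * n * n := by
  have h := sum_fejerWeight_mul_pow hn le_rfl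
  have h1 : ∀ r, rieszPoint n r ^ (n + n) = -1 := by
    intro r
    rw [pow_add, rieszPoint_pow_self hn, mul_mul_mul_comm, ← mul_pow]
    simp
  simp_rw [h1] at h
  rw [← Finset.sum_mul] at h
  have : ((∑ r ∈ Finset.range (2 * n), fejerWeight n r : ℝ) : ℂ) = ((2 * n * n : ℝ) : ℂ) := by
    push_cast
    linear_combination -h
  exact_mod_cast this

theorem riesz_interpolation_cos {n k : ℕ} (hn : 0 < n) (hk : k ≤ n) (θ : ℝ) :
    ∑ r ∈ Finset.range (2 * n), ((-1) ^ r * fejerWeight n r / (2 * n)) *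
      cos (k * (θ + rieszNode n r)) = -(k * sin (k * θ)) := by
  have hn' : (n : ℂ) ≠ 0 := by exact_mod_cast hn.ne'
  have h := sum_fejerWeight_mul_pow hn hk
  have h1 : ∀ r, ((((-1) ^ r * fejerWeight n r / (2 * n)) * cos (k * (θ + rieszNode n r)) : ℝ)) =
      (Complex.exp (k * θ * Complex.I) * (-Complex.I / (2 * n)) *
        ((fejerWeight n r : ℂ) * rieszPoint n r ^ (n + k))).re := by
    intro r
    have : Complex.exp (k * θ * Complex.I) * (-Complex.I / (2 * n)) *
        ((fejerWeight n r : ℂ) * rieszPoint n r ^ (n + k)) =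
        ((((-1) ^ r * fejerWeight n r / (2 * n)) : ℝ) : ℂ) *
        Complex.exp ((k * (θ + rieszNode n r) : ℝ) * Complex.I) := by
      rw [pow_add, rieszPoint_pow_self hn, rieszPoint, ← Complex.exp_nat_mul]
      have : Complex.exp ((k * (θ + rieszNode n r) : ℝ) * Complex.I) =
          Complex.exp (k * θ * Complex.I) * Complex.exp (k * (rieszNode n r * Complex.I)) := by
        rw [← Complex.exp_add]; congr 1; push_cast; ring
      rw [this]
      push_cast
      linear_combination (-(Complex.exp (k * θ * Complex.I) * fejerWeight n r * (-1) ^ r *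
        Complex.exp (k * (rieszNode n r * Complex.I)) / (2 * n))) * Complex.I_mul_I
    rw [this, Complex.re_ofReal_mul, Complex.exp_ofReal_mul_I_re]
  simp_rw [h1]
  rw [← Complex.re_sum, ← Finset.mul_sum, h]
  have : Complex.exp (k * θ * Complex.I) * (-Complex.I / (2 * n)) * (-(2 * n : ℂ) * k) =
      (k : ℝ) * (Complex.exp ((k * θ : ℝ) * Complex.I) * Complex.I) := by
    push_cast
    field_simp
  rw [this, Complex.re_ofReal_mul, Complex.mul_I_re, Complex.exp_ofReal_mul_I_im]
  ring

theorem exists_sum_chebyshev_T {n : ℕ} {p : Polynomial ℝ} (hp : p.natDegree ≤ n) :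
    ∃ a : ℕ → ℝ,
      p = ∑ k ∈ Finset.range (n + 1), Polynomial.C (a k) * Polynomial.Chebyshev.T ℝ k := by
  induction n generalizing p with
  | zero =>
    refine ⟨fun _ => p.coeff 0, ?_⟩
    simpa using Polynomial.eq_C_of_natDegree_le_zero hp
  | succ n ih =>
    set T := Polynomial.Chebyshev.T ℝ ((n + 1 : ℕ) : ℤ) with hT
    have hTd : T.natDegree = n + 1 := by rw [hT, Polynomial.Chebyshev.natDegree_T]; rfl
    have hT0 : T.coeff (n + 1) ≠ 0 := by
      rw [← hTd, Polynomial.coeff_natDegree, Polynomial.leadingCoeff_ne_zero]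
      rintro h
      rw [h] at hTd
      simp at hTd
    have hq : (p - Polynomial.C (p.coeff (n + 1) / T.coeff (n + 1)) * T).natDegree ≤ n := by
      rw [Polynomial.natDegree_le_iff_coeff_eq_zero]
      intro N hN
      rcases Nat.eq_or_lt_of_le (Nat.succ_le_of_lt hN) with h | h
      · subst h
        simp [hT0]
      · rw [Polynomial.coeff_sub, Polynomial.coeff_C_mul,
          Polynomial.coeff_eq_zero_of_natDegree_lt (lt_of_le_of_lt hp h),
          Polynomial.coeff_eq_zero_of_natDegree_lt (hTd.trans_lt h)]
        simp
    obtain ⟨a, ha⟩ := ih hq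
    refine ⟨fun k => if k = n + 1 then p.coeff (n + 1) / T.coeff (n + 1) else a k, ?_⟩
    dsimp only
    rw [Finset.sum_range_succ, Finset.sum_congr rfl fun k hk => by
      rw [if_neg (Finset.mem_range.mp hk).ne], ← ha, if_pos rfl, ← hT]
    ring

/-- Riesz interpolation formula for the derivative of the cosine polynomial `p (cos θ)`. -/
theorem riesz_interpolation {n : ℕ} (hn : 0 < n) {p : Polynomial ℝ} (hp : p.natDegree ≤ n)
    (θ : ℝ) : ∑ r ∈ Finset.range (2 * n), ((-1) ^ r * fejerWeight n r / (2 * n)) *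
      p.eval (cos (θ + rieszNode n r)) = -(p.derivative.eval (cos θ) * sin θ) := by
  obtain ⟨a, ha⟩ := exists_sum_chebyshev_T hp
  have hev : ∀ x, p.eval (cos x) = ∑ k ∈ Finset.range (n + 1), a k * cos (k * x) := by
    intro x
    rw [ha, Polynomial.eval_finsetSum]
    simp [Polynomial.Chebyshev.T_real_cos]
  have hd1 : HasDerivAt (fun x => p.eval (cos x)) (p.derivative.eval (cos θ) * -sin θ) θ :=
    (p.hasDerivAt (cos θ)).comp θ (hasDerivAt_cos θ)
  have hd2 : HasDerivAt (fun x => p.eval (cos x))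
      (∑ k ∈ Finset.range (n + 1), a k * -(k * sin (k * θ))) θ := by
    simp_rw [hev]
    refine HasDerivAt.fun_sum fun k _ => ?_
    have := ((hasDerivAt_id θ).const_mul (k : ℝ)).cos.const_mul (a k)
    refine this.congr_deriv ?_
    simp only [id]; ring
  rw [neg_mul_eq_mul_neg, hd1.unique hd2]
  simp_rw [hev, Finset.mul_sum]
  rw [Finset.sum_comm]
  refine Finset.sum_congr rfl fun k hk => ?_
  rw [← riesz_interpolation_cos hn (Nat.lt_succ_iff.mp (Finset.mem_range.mp hk)) θ, Finset.mul_sum]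
  refine Finset.sum_congr rfl fun r _ => by ring

theorem integral_neg_self_eq_two_mul_of_even {f : ℝ → ℝ} (hf : Continuous f)
    (he : ∀ x, f (-x) = f x) (a : ℝ) :
    ∫ x in -a..a, f x = 2 * ∫ x in 0..a, f x := by
  rw [← intervalIntegral.integral_add_adjacent_intervals (b := 0) (hf.intervalIntegrable _ _)
    (hf.intervalIntegrable _ _)]
  have := intervalIntegral.integral_comp_neg (a := 0) (b := a) f
  simp_rw [he] at this
  rw [neg_zero] at this
  rw [← this]
  ring

/-- Bernstein inequality in the `L¹` norm for cosine polynomials. -/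
theorem integral_abs_derivative_cos_mul_sin_le {n : ℕ} (hn : 0 < n) {p : Polynomial ℝ}
    (hp : p.natDegree ≤ n) :
    ∫ θ in 0..π, |p.derivative.eval (cos θ) * sin θ| ≤ n * ∫ θ in 0..π, |p.eval (cos θ)| := by
  have hcont : Continuous fun θ => |p.eval (cos θ)| := by fun_prop
  have hdcont : Continuous fun θ => |p.derivative.eval (cos θ) * sin θ| := by fun_prop
  have hbound : ∀ θ, |p.derivative.eval (cos θ) * sin θ| ≤
      ∑ r ∈ Finset.range (2 * n),
        fejerWeight n r / (2 * n) * |p.eval (cos (θ + rieszNode n r))| := by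
    intro θ
    rw [← abs_neg, ← riesz_interpolation hn hp]
    refine (Finset.abs_sum_le_sum_abs _ _).trans (Finset.sum_le_sum fun r _ => ?_)
    rw [abs_mul, abs_div, abs_mul, abs_pow, abs_neg, abs_one, one_pow, one_mul,
      abs_of_nonneg (show 0 ≤ fejerWeight n r from Complex.normSq_nonneg _),
      abs_of_nonneg (show (0:ℝ) ≤ 2 * n by positivity)]
  have hper : Function.Periodic (fun θ => |p.eval (cos θ)|) (2 * π) := fun θ => by
    simp only [cos_add_two_pi]
  have hint : ∀ t, ∫ θ in -π..π, |p.eval (cos (θ + t))| = ∫ θ in -π..π, |p.eval (cos θ)| := by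
    intro t
    rw [intervalIntegral.integral_comp_add_right (fun θ => |p.eval (cos θ)|) t]
    have := hper.intervalIntegral_add_eq (-π + t) (-π)
    rw [show -π + t + 2 * π = π + t by ring, show -π + 2 * π = π by ring] at this
    exact this
  have h2 : ∫ θ in -π..π, |p.derivative.eval (cos θ) * sin θ| ≤
      n * ∫ θ in -π..π, |p.eval (cos θ)| := by
    calc _ ≤ ∫ θ in -π..π, ∑ r ∈ Finset.range (2 * n),
          fejerWeight n r / (2 * n) * |p.eval (cos (θ + rieszNode n r))| :=
          intervalIntegral.integral_mono_on (by linarith [pi_pos])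
            (hdcont.intervalIntegrable _ _)
            (Continuous.intervalIntegrable (by fun_prop) _ _) fun θ _ => hbound θ
      _ = ∑ r ∈ Finset.range (2 * n), fejerWeight n r / (2 * n) *
          ∫ θ in -π..π, |p.eval (cos θ)| := by
          rw [intervalIntegral.integral_finsetSum fun r _ =>
            Continuous.intervalIntegrable (by fun_prop) _ _]
          refine Finset.sum_congr rfl fun r _ => ?_
          rw [intervalIntegral.integral_const_mul, hint]
      _ = n * ∫ θ in -π..π, |p.eval (cos θ)| := by
          rw [← Finset.sum_mul, ← Finset.sum_div, sum_fejerWeight hn]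
          congr 1
          have : (n : ℝ) ≠ 0 := by exact_mod_cast hn.ne'
          field_simp
  rw [integral_neg_self_eq_two_mul_of_even hdcont (fun θ => by simp) π,
    integral_neg_self_eq_two_mul_of_even hcont (fun θ => by simp) π] at h2
  linarith

open Polynomial.Chebyshev in
theorem integral_abs_derivative_le {n : ℕ} (hn : 0 < n) {p : Polynomial ℝ}
    (hp : p.natDegree ≤ n) :
    ∫ x in (-1:ℝ)..1, |p.derivative.eval x| ≤ n * ∫ x, |p.eval x| ∂measureT := by
  rw [integral_measureT_eq_integral_cos]
  refine le_of_eq_of_le ?_ (integral_abs_derivative_cos_mul_sin_le hn hp)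
  have h := intervalIntegral.integral_comp_mul_deriv (a := 0) (b := π) (f := cos)
    (f' := fun x => -sin x) (g := fun x => |p.derivative.eval x|)
    (fun x _ => hasDerivAt_cos x) (by fun_prop) (by fun_prop)
  rw [cos_zero, cos_pi, intervalIntegral.integral_symm (-1)] at h
  rw [← neg_eq_iff_eq_neg.mpr h, ← intervalIntegral.integral_neg]
  refine intervalIntegral.integral_congr fun x hx => ?_
  rw [uIcc_of_le pi_pos.le] at hx
  simp [abs_mul, abs_of_nonneg (sin_nonneg_of_mem_Icc hx)]

open Polynomial.Chebyshev in
theorem abs_coeff_chebyshev_le {n : ℕ} (a : ℕ → ℝ) {p : Polynomial ℝ}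
    (hp : p = ∑ k ∈ Finset.range (n + 1), Polynomial.C (a k) * T ℝ k) {k : ℕ} (hk : k ≤ n) :
    |a k| ≤ (if k = 0 then 1 else 2) / π * ∫ x, |p.eval x| ∂measureT := by
  have hint : ∀ q : Polynomial ℝ, Integrable (fun x => q.eval x) measureT := fun q =>
    integrable_measureT q.continuousOn
  have h1 : ∫ x, p.eval x * (T ℝ k).eval x ∂measureT =
      a k * ∫ x, (T ℝ k).eval x * (T ℝ k).eval x ∂measureT := by
    have : ∀ x, p.eval x * (T ℝ k).eval x =
        ∑ j ∈ Finset.range (n + 1), a j * ((T ℝ j).eval x * (T ℝ k).eval x) := by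
      intro x
      rw [hp, Polynomial.eval_finsetSum, Finset.sum_mul]
      simp [mul_assoc]
    simp_rw [this]
    rw [integral_finsetSum _ fun j _ => ?_]
    · rw [Finset.sum_eq_single k]
      · rw [integral_const_mul]
      · intro j _ hj
        rw [integral_const_mul, integral_eval_T_real_mul_eval_T_real_measureT_of_ne hj, mul_zero]
      · intro h
        exact absurd (Finset.mem_range.mpr (by omega)) h
    · simpa using (hint (T ℝ j * T ℝ k)).const_mul (a j)
  have h2 : |∫ x, p.eval x * (T ℝ k).eval x ∂measureT| ≤ ∫ x, |p.eval x| ∂measureT := by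
    rw [integral_measureT_eq_integral_cos, integral_measureT_eq_integral_cos]
    refine (intervalIntegral.abs_integral_le_integral_abs pi_pos.le).trans
      (intervalIntegral.integral_mono_on pi_pos.le
        (Continuous.intervalIntegrable (by fun_prop) _ _)
        (Continuous.intervalIntegrable (by fun_prop) _ _) fun θ _ => ?_)
    rw [abs_mul, T_real_cos]
    exact mul_le_of_le_one_right (abs_nonneg _) (abs_cos_le_one _)
  rw [h1, abs_mul] at h2
  split_ifs with h0
  · subst h0
    rw [Nat.cast_zero, integral_eval_T_real_mul_self_measureT_zero, abs_of_pos pi_pos] at h2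
    rw [div_mul_eq_mul_div, one_mul, le_div_iff₀ pi_pos]
    exact h2
  · rw [integral_T_real_mul_self_measureT_of_ne_zero h0,
      abs_of_pos (a := π / 2) (by positivity)] at h2
    rw [div_mul_eq_mul_div, le_div_iff₀ pi_pos]
    linarith

open Polynomial.Chebyshev in
theorem abs_eval_le_integral_measureT {n : ℕ} {p : Polynomial ℝ} (hp : p.natDegree ≤ n) {x : ℝ}
    (hx : x ∈ Icc (-1:ℝ) 1) :
    |p.eval x| ≤ (2 * n + 1) / π * ∫ x, |p.eval x| ∂measureT := by
  obtain ⟨a, ha⟩ := exists_sum_chebyshev_T hp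
  set J := ∫ x, |p.eval x| ∂measureT
  have h1 : |p.eval x| ≤ ∑ k ∈ Finset.range (n + 1), (if k = 0 then 1 else 2) / π * J := by
    rw [ha, Polynomial.eval_finsetSum]
    refine (Finset.abs_sum_le_sum_abs _ _).trans (Finset.sum_le_sum fun k hk => ?_)
    rw [Polynomial.eval_mul, Polynomial.eval_C, abs_mul]
    refine le_trans ?_ (abs_coeff_chebyshev_le a ha (Nat.lt_succ_iff.mp (Finset.mem_range.mp hk)))
    refine mul_le_of_le_one_right (abs_nonneg _) ?_
    rw [← cos_arccos hx.1 hx.2, T_real_cos]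
    exact abs_cos_le_one _
  refine h1.trans_eq ?_
  rw [Finset.sum_range_succ', ← Finset.sum_mul, ← Finset.sum_div]
  simp
  ring

theorem sub_le_integral_of_one_le {g : ℝ → ℝ} (hg : IntervalIntegrable g volume (-1) 1)
    (h1 : ∀ x, 1 ≤ g x) {x y : ℝ} (hx : -1 ≤ x) (hxy : x ≤ y) (hy : y ≤ 1) :
    y - x ≤ (∫ t in (-1:ℝ)..y, g t) - ∫ t in (-1:ℝ)..x, g t := by
  have hsub : ∀ a b : ℝ, -1 ≤ a → a ≤ b → b ≤ 1 → IntervalIntegrable g volume a b := by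
    intro a b ha hab hb
    refine hg.mono_set ?_
    rw [uIcc_of_le hab, uIcc_of_le (by norm_num)]
    exact Icc_subset_Icc ha hb
  rw [intervalIntegral.integral_interval_sub_left (hsub _ _ le_rfl (hx.trans hxy) hy)
    (hsub _ _ le_rfl hx (hxy.trans hy))]
  have := intervalIntegral.integral_mono_on hxy intervalIntegrable_const (hsub x y hx hxy hy)
    fun t _ => h1 t
  simpa using this

/-- Existence of quantiles for a density that is at least one. -/
theorem exists_quantile {g : ℝ → ℝ} (hg : IntervalIntegrable g volume (-1) 1)
    (h1 : ∀ x, 1 ≤ g x) {s : ℝ} (hs : s ∈ Icc (0:ℝ) 1) :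
    ∃ z ∈ Icc (-1:ℝ) 1, ∫ t in (-1:ℝ)..z, g t = s * ∫ t in (-1:ℝ)..1, g t := by
  have hcont : ContinuousOn (fun z => ∫ t in (-1:ℝ)..z, g t) (Icc (-1) 1) := by
    have := intervalIntegral.continuousOn_primitive_interval (a := -1) (b := 1) (μ := volume)
      (f := g) (by
        rw [uIcc_of_le (by norm_num), integrableOn_Icc_iff_integrableOn_Ioc,
          ← intervalIntegrable_iff_integrableOn_Ioc_of_le (by norm_num)]
        exact hg)
    rwa [uIcc_of_le (by norm_num)] at this
  have hG : 0 ≤ ∫ t in (-1:ℝ)..1, g t :=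
    intervalIntegral.integral_nonneg (by norm_num) fun x _ => zero_le_one.trans (h1 x)
  have := intermediate_value_Icc (by norm_num) hcont
    (show s * (∫ t in (-1:ℝ)..1, g t) ∈ Icc _ _ from
      ⟨by simpa using mul_nonneg hs.1 hG, mul_le_of_le_one_left hG hs.2⟩)
  exact this

/-- Quantiles depend on the density in a Lipschitz way with respect to the `L¹` distance. -/
theorem quantile_sub_le {g₁ g₂ : ℝ → ℝ} (hg₁ : IntervalIntegrable g₁ volume (-1) 1)
    (hg₂ : IntervalIntegrable g₂ volume (-1) 1) (h1 : ∀ x, 1 ≤ g₁ x)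
    {s z₁ z₂ : ℝ} (hs : s ∈ Icc (0:ℝ) 1) (hz₁ : z₁ ∈ Icc (-1:ℝ) 1) (hz₂ : z₂ ∈ Icc (-1:ℝ) 1)
    (h₁ : ∫ t in (-1:ℝ)..z₁, g₁ t = s * ∫ t in (-1:ℝ)..1, g₁ t)
    (h₂ : ∫ t in (-1:ℝ)..z₂, g₂ t = s * ∫ t in (-1:ℝ)..1, g₂ t) :
    |z₁ - z₂| ≤ 2 * ∫ t in (-1:ℝ)..1, |g₁ t - g₂ t| := by
  have hsub : ∀ g : ℝ → ℝ, IntervalIntegrable g volume (-1) 1 → ∀ b : ℝ, b ∈ Icc (-1:ℝ) 1 →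
      IntervalIntegrable g volume (-1) b := by
    intro g hg b hb
    refine hg.mono_set ?_
    rw [uIcc_of_le hb.1, uIcc_of_le (by norm_num)]
    exact Icc_subset_Icc le_rfl hb.2
  set δ := ∫ t in (-1:ℝ)..1, |g₁ t - g₂ t|
  have hdiff : ∀ b : ℝ, b ∈ Icc (-1:ℝ) 1 →
      |(∫ t in (-1:ℝ)..b, g₁ t) - ∫ t in (-1:ℝ)..b, g₂ t| ≤ δ := by
    intro b hb
    rw [← intervalIntegral.integral_sub (hsub _ hg₁ b hb) (hsub _ hg₂ b hb)]
    refine (intervalIntegral.abs_integral_le_integral_abs hb.1).trans ?_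
    exact intervalIntegral.integral_mono_interval le_rfl hb.1 hb.2
      (Filter.Eventually.of_forall fun _ => abs_nonneg _) (hg₁.sub hg₂).abs
  have hlow : |z₁ - z₂| ≤ |(∫ t in (-1:ℝ)..z₁, g₁ t) - ∫ t in (-1:ℝ)..z₂, g₁ t| := by
    rcases le_total z₂ z₁ with h | h
    · rw [abs_of_nonneg (sub_nonneg.mpr h)]
      exact (sub_le_integral_of_one_le hg₁ h1 hz₂.1 h hz₁.2).trans (le_abs_self _)
    · rw [abs_sub_comm, abs_of_nonneg (sub_nonneg.mpr h), abs_sub_comm]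
      exact (sub_le_integral_of_one_le hg₁ h1 hz₁.1 h hz₂.2).trans (le_abs_self _)
  refine hlow.trans ?_
  have e : (∫ t in (-1:ℝ)..z₁, g₁ t) - ∫ t in (-1:ℝ)..z₂, g₁ t =
      s * ((∫ t in (-1:ℝ)..1, g₁ t) - ∫ t in (-1:ℝ)..1, g₂ t) -
        ((∫ t in (-1:ℝ)..z₂, g₁ t) - ∫ t in (-1:ℝ)..z₂, g₂ t) := by
    rw [h₁, h₂]; ring
  rw [e]
  refine (abs_sub _ _).trans ?_
  rw [abs_mul, abs_of_nonneg hs.1]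
  have h3 := hdiff 1 (by norm_num)
  have h4 := hdiff z₂ hz₂
  have h5 := mul_le_of_le_one_left
    (abs_nonneg ((∫ t in (-1:ℝ)..1, g₁ t) - ∫ t in (-1:ℝ)..1, g₂ t)) hs.2
  linarith

theorem quantile_mono {g : ℝ → ℝ} (hg : IntervalIntegrable g volume (-1) 1)
    (h1 : ∀ x, 1 ≤ g x) {s s' z z' : ℝ} (hss : s ≤ s') (hz : z ∈ Icc (-1:ℝ) 1)
    (hz' : z' ∈ Icc (-1:ℝ) 1) (h : ∫ t in (-1:ℝ)..z, g t = s * ∫ t in (-1:ℝ)..1, g t)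
    (h' : ∫ t in (-1:ℝ)..z', g t = s' * ∫ t in (-1:ℝ)..1, g t) : z ≤ z' := by
  by_contra! hlt
  have h2 := sub_le_integral_of_one_le hg h1 hz'.1 hlt.le hz.2
  have hG : 0 ≤ ∫ t in (-1:ℝ)..1, g t :=
    intervalIntegral.integral_nonneg (by norm_num) fun x _ => zero_le_one.trans (h1 x)
  rw [h, h'] at h2
  have := mul_le_mul_of_nonneg_right hss hG
  linarith

/-- Error of the equal-weight quadrature at the quantiles, in terms of the variation of `p`. -/
theorem abs_integral_sub_sum_quantile_le {g : ℝ → ℝ} (hg : IntervalIntegrable g volume (-1) 1)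
    (h1 : ∀ x, 1 ≤ g x) {N : ℕ} (hN : 0 < N) {z : ℕ → ℝ} (hz : ∀ i ≤ N, z i ∈ Icc (-1:ℝ) 1)
    (hzq : ∀ i ≤ N, ∫ t in (-1:ℝ)..(z i), g t = (i / N : ℝ) * ∫ t in (-1:ℝ)..1, g t)
    (p : Polynomial ℝ) :
    |(∫ t in (-1:ℝ)..1, p.eval t * g t) -
      (∫ t in (-1:ℝ)..1, g t) / N * ∑ i ∈ Finset.range N, p.eval (z (i + 1))| ≤
      (∫ t in (-1:ℝ)..1, g t) / N * ∫ t in (-1:ℝ)..1, |p.derivative.eval t| := by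
  have hN' : (0:ℝ) < N := by exact_mod_cast hN
  set G := ∫ t in (-1:ℝ)..1, g t with hGdef
  have hmono : ∀ i < N, z i ≤ z (i + 1) := fun i hi =>
    quantile_mono hg h1 (s := i / N) (s' := (i + 1 : ℕ) / N) (by gcongr; simp)
      (hz i hi.le) (hz (i + 1) hi) (hzq i hi.le) (hzq (i + 1) hi)
  have hz0 : z 0 = -1 := by
    have h2 := sub_le_integral_of_one_le hg h1 le_rfl (hz 0 hN.le).1 (hz 0 hN.le).2
    rw [hzq 0 hN.le] at h2
    simp at h2
    linarith [(hz 0 hN.le).1]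
  have hzN : z N = 1 := by
    have h2 := sub_le_integral_of_one_le hg h1 (hz N le_rfl).1 (hz N le_rfl).2 le_rfl
    rw [hzq N le_rfl, div_self hN'.ne', one_mul, sub_self] at h2
    linarith [(hz N le_rfl).2]
  have hsub : ∀ f : ℝ → ℝ, IntervalIntegrable f volume (-1) 1 → ∀ i < N,
      IntervalIntegrable f volume (z i) (z (i + 1)) := by
    intro f hf i hi
    refine hf.mono_set ?_
    rw [uIcc_of_le (hmono i hi), uIcc_of_le (by norm_num)]
    exact Icc_subset_Icc (hz i hi.le).1 (hz (i + 1) hi).2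
  have hpg : IntervalIntegrable (fun t => p.eval t * g t) volume (-1) 1 :=
    hg.continuousOn_mul p.continuousOn
  have hd : IntervalIntegrable (fun t => |p.derivative.eval t|) volume (-1) 1 :=
    Continuous.intervalIntegrable (by fun_prop) _ _
  have hsplit : ∀ f : ℝ → ℝ, IntervalIntegrable f volume (-1) 1 →
      ∫ t in (-1:ℝ)..1, f t = ∑ i ∈ Finset.range N, ∫ t in (z i)..(z (i + 1)), f t := by
    intro f hf
    rw [intervalIntegral.sum_integral_adjacent_intervals (hsub f hf), hz0, hzN]
  have hGi : ∀ i < N, ∫ t in (z i)..(z (i + 1)), g t = G / N := by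
    intro i hi
    have hi1 : ∀ j ≤ N, IntervalIntegrable g volume (-1) (z j) := fun j hj => hg.mono_set (by
      rw [uIcc_of_le (hz j hj).1, uIcc_of_le (by norm_num)]
      exact Icc_subset_Icc le_rfl (hz j hj).2)
    rw [← intervalIntegral.integral_interval_sub_left (hi1 _ hi) (hi1 _ hi.le), hzq _ hi,
      hzq _ hi.le]
    push_cast
    ring
  rw [hsplit _ hpg, hsplit _ hd, Finset.mul_sum, Finset.mul_sum, ← Finset.sum_sub_distrib]
  refine (Finset.abs_sum_le_sum_abs _ _).trans (Finset.sum_le_sum fun i hi => ?_)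
  rw [Finset.mem_range] at hi
  have e : (∫ t in (z i)..(z (i + 1)), p.eval t * g t) - G / N * p.eval (z (i + 1)) =
      ∫ t in (z i)..(z (i + 1)), (p.eval t - p.eval (z (i + 1))) * g t := by
    rw [← hGi i hi, ← intervalIntegral.integral_mul_const,
      ← intervalIntegral.integral_sub (hsub _ hpg i hi) ((hsub _ hg i hi).mul_const _)]
    congr 1
    ext t
    ring
  rw [e, ← hGi i hi, mul_comm, ← intervalIntegral.integral_const_mul]
  refine (intervalIntegral.abs_integral_le_integral_abs (hmono i hi)).trans ?_
  refine intervalIntegral.integral_mono_on (hmono i hi) ?_ ((hsub _ hg i hi).const_mul _) ?_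
  · exact ((hsub _ hg i hi).continuousOn_mul (by fun_prop)).abs
  · intro t ht
    rw [abs_mul, abs_of_nonneg (zero_le_one.trans (h1 t))]
    refine mul_le_mul_of_nonneg_right ?_ (zero_le_one.trans (h1 t))
    rw [abs_sub_comm, ← intervalIntegral.integral_eq_sub_of_hasDerivAt
      (fun x _ => p.hasDerivAt x) (Continuous.intervalIntegrable (by fun_prop) _ _)]
    refine (intervalIntegral.abs_integral_le_integral_abs ht.2).trans ?_
    exact intervalIntegral.integral_mono_interval ht.1 ht.2 le_rfl
      (Filter.Eventually.of_forall fun _ => abs_nonneg _) (hsub _ hd i hi)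

open Polynomial.Chebyshev in
/-- The weighted `L¹` norm dominates the arcsine-weighted one if `w` is bounded below by a multiple
of the arcsine density outside a set of small arcsine measure. -/
theorem essInf_mul_integral_measureT_le {n : ℕ} {w : ℝ → ℝ} (hw0 : ∀ t, 0 ≤ w t)
    (hwi : IntervalIntegrable w volume (-1) 1) {δ : ℝ} {D : Set ℝ} (hD : D ⊆ Icc (-1:ℝ) 1)
    (hDmeas : MeasurableSet D)
    (hDint : (∫ t in D, 1 / √(1 - t ^ 2)) ≤ δ * π / (2 * n + 1))
    (hE : 0 < essInf (fun t => √(1 - t ^ 2) * w t) (volume.restrict (Icc (-1:ℝ) 1 \ D)))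
    {p : Polynomial ℝ} (hp : p.natDegree ≤ n) :
    essInf (fun t => √(1 - t ^ 2) * w t) (volume.restrict (Icc (-1:ℝ) 1 \ D)) *
      ((1 - δ) * ∫ x, |p.eval x| ∂measureT) ≤ ∫ x in (-1:ℝ)..1, |p.eval x| * w x := by
  set E := essInf (fun t => √(1 - t ^ 2) * w t) (volume.restrict (Icc (-1:ℝ) 1 \ D))
  have hlow : ∀ᵐ t ∂volume.restrict (Icc (-1:ℝ) 1 \ D), E ≤ √(1 - t ^ 2) * w t :=
    ae_essInf_le ⟨0, Filter.eventually_map.mpr <| Filter.Eventually.of_forall fun t =>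
      mul_nonneg (sqrt_nonneg _) (hw0 t)⟩
  have hφ : IntervalIntegrable (fun t : ℝ => |p.eval t| * (√(1 - t ^ 2))⁻¹) volume (-1) 1 := by
    have := intervalIntegrable_sqrt_one_sub_sq_inv.continuousOn_mul (g := fun t => |p.eval t|)
      (by fun_prop)
    simpa [sqrt_inv] using this
  have hφ1 : IntervalIntegrable (fun t : ℝ => (√(1 - t ^ 2))⁻¹) volume (-1) 1 := by
    simpa [sqrt_inv] using intervalIntegrable_sqrt_one_sub_sq_inv
  have hpw : IntervalIntegrable (fun t : ℝ => |p.eval t| * w t) volume (-1) 1 :=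
    hwi.continuousOn_mul (by fun_prop)
  rw [intervalIntegrable_iff_integrableOn_Icc_of_le (by norm_num)] at hφ hφ1 hpw
  have hJ : ∫ x, |p.eval x| ∂measureT = ∫ t in Icc (-1:ℝ) 1, |p.eval t| * (√(1 - t ^ 2))⁻¹ := by
    rw [integral_measureT, intervalIntegral.integral_of_le (by norm_num),
      integral_Icc_eq_integral_Ioc]
    simp [sqrt_inv]
  set J := ∫ x, |p.eval x| ∂measureT
  have hdiff := setIntegral_sdiff hDmeas hφ hD
  have hDle : ∫ t in D, |p.eval t| * (√(1 - t ^ 2))⁻¹ ≤ δ * J := by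
    have hK : 0 ≤ (2 * n + 1) / π * J :=
      mul_nonneg (by positivity) (integral_nonneg fun _ => abs_nonneg _)
    calc ∫ t in D, |p.eval t| * (√(1 - t ^ 2))⁻¹
        ≤ ∫ t in D, (2 * n + 1) / π * J * (√(1 - t ^ 2))⁻¹ := by
          refine setIntegral_mono_on (hφ.mono_set hD) ((hφ1.mono_set hD).const_mul _) hDmeas ?_
          intro t ht
          exact mul_le_mul_of_nonneg_right (abs_eval_le_integral_measureT hp (hD ht))
            (inv_nonneg.mpr (sqrt_nonneg _))
      _ = (2 * n + 1) / π * J * ∫ t in D, 1 / √(1 - t ^ 2) := by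
          simp_rw [integral_const_mul, one_div]
      _ ≤ (2 * n + 1) / π * J * (δ * π / (2 * n + 1)) := mul_le_mul_of_nonneg_left hDint hK
      _ = δ * J := by field_simp
  have hS : Icc (-1:ℝ) 1 \ D ⊆ Icc (-1) 1 := sdiff_subset
  calc E * ((1 - δ) * J) ≤ E * ∫ t in Icc (-1:ℝ) 1 \ D, |p.eval t| * (√(1 - t ^ 2))⁻¹ := by
        refine mul_le_mul_of_nonneg_left ?_ hE.le
        rw [hdiff, ← hJ]
        linarith
    _ = ∫ t in Icc (-1:ℝ) 1 \ D, E * (|p.eval t| * (√(1 - t ^ 2))⁻¹) := by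
        rw [integral_const_mul]
    _ ≤ ∫ t in Icc (-1:ℝ) 1 \ D, |p.eval t| * w t := by
        refine integral_mono_ae ((hφ.mono_set hS).const_mul _) (hpw.mono_set hS) ?_
        filter_upwards [hlow] with t ht
        have hpos : 0 < √(1 - t ^ 2) := by
          refine (sqrt_nonneg _).lt_of_ne fun h => ?_
          rw [← h, zero_mul] at ht
          exact absurd ht hE.not_ge
        rw [mul_left_comm]
        refine mul_le_mul_of_nonneg_left ?_ (abs_nonneg _)
        rwa [← div_eq_mul_inv, div_le_iff₀ hpos, mul_comm]
    _ ≤ ∫ t in Icc (-1:ℝ) 1, |p.eval t| * w t :=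
        setIntegral_mono_set hpw (Filter.Eventually.of_forall fun t =>
          mul_nonneg (abs_nonneg _) (hw0 t)) (Filter.Eventually.of_forall hS)
    _ = ∫ x in (-1:ℝ)..1, |p.eval x| * w x := by
        rw [intervalIntegral.integral_of_le (by norm_num), integral_Icc_eq_integral_Ioc]

theorem integral_max_zero_mul {w : ℝ → ℝ} (hwi : IntervalIntegrable w volume (-1) 1)
    {p : Polynomial ℝ} (h0 : ∫ x in (-1:ℝ)..1, p.eval x * w x = 0) :
    ∫ x in (-1:ℝ)..1, max (p.eval x) 0 * w x = (∫ x in (-1:ℝ)..1, |p.eval x| * w x) / 2 := by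
  have h1 : IntervalIntegrable (fun x => p.eval x * w x) volume (-1) 1 :=
    hwi.continuousOn_mul (by fun_prop)
  have h2 : IntervalIntegrable (fun x => |p.eval x| * w x) volume (-1) 1 :=
    hwi.continuousOn_mul (by fun_prop)
  have e : ∀ x, max (p.eval x) 0 * w x = (p.eval x * w x + |p.eval x| * w x) / 2 := fun x => by
    rcases le_total (p.eval x) 0 with h | h
    · rw [max_eq_right h, abs_of_nonpos h]; ring
    · rw [max_eq_left h, abs_of_nonneg h]; ring
  simp_rw [e, intervalIntegral.integral_div]
  rw [intervalIntegral.integral_add h1 h2, h0, zero_add]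

/-- The density `p⁺ w + 1` whose quantiles serve as quadrature nodes. -/
def quantileDensity (w : ℝ → ℝ) (p : Polynomial ℝ) (x : ℝ) : ℝ := max (p.eval x) 0 * w x + 1

theorem one_le_quantileDensity {w : ℝ → ℝ} (hw0 : ∀ t, 0 ≤ w t) (p : Polynomial ℝ) (x : ℝ) :
    1 ≤ quantileDensity w p x :=
  le_add_of_nonneg_left (mul_nonneg (le_max_right _ _) (hw0 x))

theorem intervalIntegrable_quantileDensity {w : ℝ → ℝ}
    (hwi : IntervalIntegrable w volume (-1) 1) (p : Polynomial ℝ) :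
    IntervalIntegrable (quantileDensity w p) volume (-1) 1 :=
  (hwi.continuousOn_mul (by fun_prop)).add intervalIntegrable_const

/-- If the positive part of `p` has large weighted integral, the sum of `p` over the quantiles
of its own density is positive. -/
theorem sum_eval_quantile_pos {w : ℝ → ℝ} (hw0 : ∀ t, 0 ≤ w t)
    (hwi : IntervalIntegrable w volume (-1) 1) (hW : 0 < ∫ x in (-1:ℝ)..1, w x)
    {p : Polynomial ℝ} {κ C b : ℝ} (hbdef : ∫ x in (-1:ℝ)..1, max (p.eval x) 0 * w x = b)
    (hM : ∀ x ∈ Icc (-1:ℝ) 1, |p.eval x| ≤ C * b) {N : ℕ} (hN : 0 < N)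
    (hV : (∫ x in (-1:ℝ)..1, w x) * (∫ x in (-1:ℝ)..1, |p.derivative.eval x|) ≤ κ * N * b)
    (hb0 : 0 < b) (hb : 2 * κ + 2 * C * (∫ x in (-1:ℝ)..1, w x) < (1 - κ) * b)
    {z : ℕ → ℝ} (hz : ∀ i ≤ N, z i ∈ Icc (-1:ℝ) 1)
    (hzq : ∀ i ≤ N, ∫ t in (-1:ℝ)..(z i), quantileDensity w p t =
      (i / N : ℝ) * ∫ t in (-1:ℝ)..1, quantileDensity w p t) :
    0 < ∑ i ∈ Finset.range N, p.eval (z (i + 1)) := by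
  set W := ∫ x in (-1:ℝ)..1, w x
  set V := ∫ x in (-1:ℝ)..1, |p.derivative.eval x|
  have hN' : (0:ℝ) < N := by exact_mod_cast hN
  have hbi : IntervalIntegrable (fun x => max (p.eval x) 0 * w x) volume (-1) 1 :=
    hwi.continuousOn_mul (by fun_prop)
  have hG : ∫ t in (-1:ℝ)..1, quantileDensity w p t = b + 2 := by
    unfold quantileDensity
    rw [intervalIntegral.integral_add hbi intervalIntegrable_const, hbdef]
    norm_num
  have hsq : IntervalIntegrable (fun x => max (p.eval x) 0 ^ 2 * w x) volume (-1) 1 :=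
    hwi.continuousOn_mul (by fun_prop)
  have hpi : IntervalIntegrable (fun x => p.eval x) volume (-1) 1 :=
    p.continuous.intervalIntegrable _ _
  have hpg : ∫ x in (-1:ℝ)..1, p.eval x * quantileDensity w p x =
      (∫ x in (-1:ℝ)..1, max (p.eval x) 0 ^ 2 * w x) + ∫ x in (-1:ℝ)..1, p.eval x := by
    rw [← intervalIntegral.integral_add hsq hpi]
    congr 1
    ext x
    unfold quantileDensity
    rcases le_total (p.eval x) 0 with h | h
    · rw [max_eq_right h]; ring
    · rw [max_eq_left h]; ring
  have hcs : b ^ 2 / W ≤ ∫ x in (-1:ℝ)..1, max (p.eval x) 0 ^ 2 * w x := by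
    have h : 0 ≤ ∫ x in (-1:ℝ)..1, (max (p.eval x) 0 - b / W) ^ 2 * w x :=
      intervalIntegral.integral_nonneg (by norm_num) fun x _ => mul_nonneg (sq_nonneg _) (hw0 x)
    have e : (fun x => (max (p.eval x) 0 - b / W) ^ 2 * w x) = fun x =>
        max (p.eval x) 0 ^ 2 * w x - 2 * (b / W) * (max (p.eval x) 0 * w x) +
          (b / W) ^ 2 * w x := by
      ext x; ring
    rw [e, intervalIntegral.integral_add (hsq.sub (hbi.const_mul _)) (hwi.const_mul _),
      intervalIntegral.integral_sub hsq (hbi.const_mul _), intervalIntegral.integral_const_mul,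
      intervalIntegral.integral_const_mul, hbdef] at h
    have : (b / W) ^ 2 * W = b ^ 2 / W := by field_simp
    have : 2 * (b / W) * b = 2 * (b ^ 2 / W) := by ring
    linarith
  have hlow : -(2 * (C * b)) ≤ ∫ x in (-1:ℝ)..1, p.eval x := by
    have := intervalIntegral.integral_mono_on (by norm_num) intervalIntegrable_const hpi
      fun x hx => (abs_le.mp (hM x hx)).1
    rw [intervalIntegral.integral_const, smul_eq_mul] at this
    linarith
  have hmain := abs_integral_sub_sum_quantile_le (intervalIntegrable_quantileDensity hwi p)
    (one_le_quantileDensity hw0 p) hN hz hzq p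
  rw [hG, hpg] at hmain
  have h1 := (abs_le.mp hmain).2
  have h2 : (b + 2) / N * V ≤ (b + 2) * (κ * b / W) := by
    rw [div_mul_eq_mul_div, div_le_iff₀ hN', mul_assoc]
    refine mul_le_mul_of_nonneg_left ?_ (by linarith)
    rw [div_mul_eq_mul_div, le_div_iff₀ hW]
    linarith
  have h3 : (b + 2) * (κ * b / W) < b ^ 2 / W - 2 * (C * b) := by
    have : b ^ 2 / W - 2 * (C * b) - (b + 2) * (κ * b / W) =
        b / W * ((1 - κ) * b - (2 * κ + 2 * C * W)) := by
      field_simp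
      ring
    have : 0 < b / W * ((1 - κ) * b - (2 * κ + 2 * C * W)) :=
      mul_pos (div_pos hb0 hW) (by linarith)
    linarith
  have h4 : 0 < (b + 2) / N * ∑ i ∈ Finset.range N, p.eval (z (i + 1)) := by linarith
  exact (mul_pos_iff_of_pos_left (by positivity)).mp h4

open Polynomial.Chebyshev in
/-- The Chebyshev polynomial `T (k + 1)`, recentred to have mean zero with respect to `w`. -/
def centeredT (w : ℝ → ℝ) (k : ℕ) : Polynomial ℝ :=
  T ℝ ((k + 1 : ℕ) : ℤ) - Polynomial.C
    ((∫ x in (-1:ℝ)..1, (T ℝ ((k + 1 : ℕ) : ℤ)).eval x * w x) / ∫ x in (-1:ℝ)..1, w x)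

/-- The linear combination of recentred Chebyshev polynomials with coefficients `c`. -/
def centeredSum (w : ℝ → ℝ) {n : ℕ} (c : EuclideanSpace ℝ (Fin n)) : Polynomial ℝ :=
  ∑ k, Polynomial.C (c k) * centeredT w k

theorem eval_centeredSum (w : ℝ → ℝ) {n : ℕ} (c : EuclideanSpace ℝ (Fin n)) (x : ℝ) :
    (centeredSum w c).eval x = ∑ k, c k * (centeredT w k).eval x := by
  simp [centeredSum, Polynomial.eval_finsetSum]

theorem natDegree_centeredSum_le (w : ℝ → ℝ) {n : ℕ} (c : EuclideanSpace ℝ (Fin n)) :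
    (centeredSum w c).natDegree ≤ n := by
  refine Polynomial.natDegree_sum_le_of_forall_le _ _ fun k _ => ?_
  refine (Polynomial.natDegree_C_mul_le _ _).trans ?_
  refine (Polynomial.natDegree_sub_C).le.trans ?_
  rw [Polynomial.Chebyshev.natDegree_T]
  exact k.2

theorem integral_centeredT_mul {w : ℝ → ℝ} (hwi : IntervalIntegrable w volume (-1) 1)
    (hW : 0 < ∫ x in (-1:ℝ)..1, w x) (k : ℕ) :
    ∫ x in (-1:ℝ)..1, (centeredT w k).eval x * w x = 0 := by
  unfold centeredT
  simp only [Polynomial.eval_sub, Polynomial.eval_C, sub_mul]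
  rw [intervalIntegral.integral_sub (hwi.continuousOn_mul (by fun_prop)) (hwi.const_mul _),
    intervalIntegral.integral_const_mul, div_mul_cancel₀ _ hW.ne', sub_self]

theorem integral_centeredSum_mul {w : ℝ → ℝ} (hwi : IntervalIntegrable w volume (-1) 1)
    (hW : 0 < ∫ x in (-1:ℝ)..1, w x) {n : ℕ} (c : EuclideanSpace ℝ (Fin n)) :
    ∫ x in (-1:ℝ)..1, (centeredSum w c).eval x * w x = 0 := by
  simp_rw [eval_centeredSum, Finset.sum_mul, mul_assoc]
  rw [intervalIntegral.integral_finsetSum fun k _ =>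
    (hwi.continuousOn_mul (by fun_prop)).const_mul _]
  simp_rw [intervalIntegral.integral_const_mul, integral_centeredT_mul hwi hW, mul_zero,
    Finset.sum_const_zero]

open Polynomial.Chebyshev in
theorem norm_le_integral_centeredSum (w : ℝ → ℝ) {n : ℕ} (c : EuclideanSpace ℝ (Fin n)) :
    ‖c‖ ≤ n * (2 / π) * ∫ x, |(centeredSum w c).eval x| ∂measureT := by
  let m : ℕ → ℝ := fun k =>
    (∫ x in (-1:ℝ)..1, (T ℝ ((k + 1 : ℕ) : ℤ)).eval x * w x) / ∫ x in (-1:ℝ)..1, w x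
  let a : ℕ → ℝ := fun j => Nat.casesOn j (-∑ k : Fin n, c k * m k)
    fun j => if h : j < n then c ⟨j, h⟩ else 0
  have ha : centeredSum w c = ∑ k ∈ Finset.range (n + 1), Polynomial.C (a k) * T ℝ k := by
    rw [Finset.sum_range_succ', Finset.sum_range]
    simp only [a, Fin.is_lt, dite_true, centeredSum, centeredT, mul_sub, Finset.sum_sub_distrib]
    simp [sub_eq_add_neg, m]
  have hc : ∀ k : Fin n, |c k| ≤ 2 / π * ∫ x, |(centeredSum w c).eval x| ∂measureT := fun k => by
    simpa [a] using abs_coeff_chebyshev_le a ha (Nat.succ_le_of_lt k.2)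
  have h1 : ‖c‖ ≤ ∑ k, |c k| := by
    rw [EuclideanSpace.norm_eq]
    refine sqrt_le_iff.mpr ⟨Finset.sum_nonneg fun _ _ => abs_nonneg _, ?_⟩
    exact Finset.sum_sq_le_sq_sum_of_nonneg fun _ _ => abs_nonneg _
  refine h1.trans ((Finset.sum_le_sum fun k _ => hc k).trans_eq ?_)
  simp [mul_assoc]

theorem integral_abs_quantileDensity_sub_le {w : ℝ → ℝ} (hw0 : ∀ t, 0 ≤ w t)
    (hwi : IntervalIntegrable w volume (-1) 1) {n : ℕ} (c c' : EuclideanSpace ℝ (Fin n)) :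
    ∫ x in (-1:ℝ)..1,
      |quantileDensity w (centeredSum w c) x - quantileDensity w (centeredSum w c') x| ≤
      ∑ k, |c k - c' k| * ∫ x in (-1:ℝ)..1, |(centeredT w k).eval x| * w x := by
  have hi : ∀ k : ℕ, IntervalIntegrable (fun x => |(centeredT w k).eval x| * w x) volume (-1) 1 :=
    fun k => hwi.continuousOn_mul (by fun_prop)
  simp_rw [← intervalIntegral.integral_const_mul]
  rw [← intervalIntegral.integral_finsetSum fun (k : Fin n) _ => (hi k).const_mul _]
  refine intervalIntegral.integral_mono_on (by norm_num)
    ((intervalIntegrable_quantileDensity hwi _).sub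
      (intervalIntegrable_quantileDensity hwi _)).abs
    (by simpa only [Finset.sum_fn] using IntervalIntegrable.sum Finset.univ fun (k : Fin n) _ =>
      (hi k).const_mul |c k - c' k|) fun x _ => ?_
  have e : quantileDensity w (centeredSum w c) x - quantileDensity w (centeredSum w c') x =
      (max ((centeredSum w c).eval x) 0 - max ((centeredSum w c').eval x) 0) * w x := by
    unfold quantileDensity; ring
  rw [e, abs_mul, abs_of_nonneg (hw0 x)]
  simp_rw [← mul_assoc]
  rw [← Finset.sum_mul]
  refine mul_le_mul_of_nonneg_right ?_ (hw0 x)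
  refine (abs_max_sub_max_le_abs _ _ _).trans ?_
  rw [eval_centeredSum, eval_centeredSum, ← Finset.sum_sub_distrib]
  refine (Finset.abs_sum_le_sum_abs _ _).trans (Finset.sum_le_sum fun k _ => ?_)
  rw [← sub_mul, abs_mul]

theorem continuous_quantile {w : ℝ → ℝ} (hw0 : ∀ t, 0 ≤ w t)
    (hwi : IntervalIntegrable w volume (-1) 1) {n : ℕ} {s : ℝ} (hs : s ∈ Icc (0:ℝ) 1)
    {z : EuclideanSpace ℝ (Fin n) → ℝ} (hz : ∀ c, z c ∈ Icc (-1:ℝ) 1)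
    (hzq : ∀ c, ∫ t in (-1:ℝ)..(z c), quantileDensity w (centeredSum w c) t =
      s * ∫ t in (-1:ℝ)..1, quantileDensity w (centeredSum w c) t) : Continuous z := by
  rw [continuous_iff_continuousAt]
  intro c
  have hlim : Filter.Tendsto (fun c' : EuclideanSpace ℝ (Fin n) =>
      2 * ∑ k, |c' k - c k| * ∫ x in (-1:ℝ)..1, |(centeredT w k).eval x| * w x)
      (nhds c) (nhds 0) := by
    have : Continuous (fun c' : EuclideanSpace ℝ (Fin n) =>
        2 * ∑ k, |c' k - c k| * ∫ x in (-1:ℝ)..1, |(centeredT w k).eval x| * w x) := by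
      fun_prop
    simpa using this.tendsto c
  refine tendsto_iff_dist_tendsto_zero.mpr (squeeze_zero (fun _ => dist_nonneg) (fun c' => ?_) hlim)
  rw [Real.dist_eq]
  refine (quantile_sub_le (intervalIntegrable_quantileDensity hwi _)
    (intervalIntegrable_quantileDensity hwi _) (one_le_quantileDensity hw0 _) hs (hz c') (hz c)
    (hzq c') (hzq c)).trans ?_
  exact mul_le_mul_of_nonneg_left (integral_abs_quantileDensity_sub_le hw0 hwi c' c) zero_le_two

open Polynomial.Chebyshev in
/-- Mean-zero polynomials whose weighted positive part controls both their arcsine-weighted `L¹`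
norm and, with a constant less than one, their variation give rise to quadratures. -/
theorem exists_isChebQuad {w : ℝ → ℝ} (hw : IsWeight w) {n N : ℕ} (hN : 0 < N) {κ L : ℝ}
    (hκ0 : 0 ≤ κ) (hκ1 : κ < 1) (hL : 0 ≤ L)
    (h1 : ∀ p : Polynomial ℝ, p.natDegree ≤ n → ∫ x in (-1:ℝ)..1, p.eval x * w x = 0 →
      ∫ x, |p.eval x| ∂measureT ≤ L * ∫ x in (-1:ℝ)..1, max (p.eval x) 0 * w x)
    (h2 : ∀ p : Polynomial ℝ, p.natDegree ≤ n → ∫ x in (-1:ℝ)..1, p.eval x * w x = 0 →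
      (∫ x in (-1:ℝ)..1, w x) * ∫ x in (-1:ℝ)..1, |p.derivative.eval x| ≤
        κ * N * ∫ x in (-1:ℝ)..1, max (p.eval x) 0 * w x) :
    ∃ t : Fin N → ℝ, IsChebQuad w n N t := by
  obtain ⟨-, hw0, -, hwi, hW⟩ := hw
  have hN' : (0:ℝ) < N := by exact_mod_cast hN
  have hfrac : ∀ i ≤ N, (i / N : ℝ) ∈ Icc (0:ℝ) 1 := fun i hi =>
    ⟨by positivity, div_le_one_of_le₀ (by exact_mod_cast hi) hN'.le⟩
  have hgi := fun c : EuclideanSpace ℝ (Fin n) =>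
    intervalIntegrable_quantileDensity hwi (centeredSum w c)
  have hg1 := fun c : EuclideanSpace ℝ (Fin n) => one_le_quantileDensity hw0 (centeredSum w c)
  have hex : ∀ (c : EuclideanSpace ℝ (Fin n)) (i : ℕ), ∃ z ∈ Icc (-1:ℝ) 1, i ≤ N →
      ∫ t in (-1:ℝ)..z, quantileDensity w (centeredSum w c) t =
        (i / N : ℝ) * ∫ t in (-1:ℝ)..1, quantileDensity w (centeredSum w c) t := by
    intro c i
    by_cases hi : i ≤ N
    · obtain ⟨z, hz, h⟩ := exists_quantile (hgi c) (hg1 c) (hfrac i hi)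
      exact ⟨z, hz, fun _ => h⟩
    · exact ⟨1, by norm_num, fun h => absurd h hi⟩
  choose z hz hzq using hex
  have hzc : ∀ i ≤ N, Continuous fun c => z c i := fun i hi =>
    continuous_quantile hw0 hwi (hfrac i hi) (fun c => hz c i) fun c => hzq c i hi
  let f : EuclideanSpace ℝ (Fin n) → EuclideanSpace ℝ (Fin n) := fun c =>
    WithLp.toLp 2 fun k => ∑ i ∈ Finset.range N, (centeredT w k).eval (z c (i + 1))
  have hf : Continuous f := by
    refine (PiLp.continuous_toLp 2 _).comp (continuous_pi fun k => ?_)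
    refine continuous_finsetSum _ fun i hi => (centeredT w k).continuous.comp (hzc _ ?_)
    exact Finset.mem_range.mp hi
  have hinner : ∀ c, inner ℝ c (f c) =
      ∑ i ∈ Finset.range N, (centeredSum w c).eval (z c (i + 1)) := by
    intro c
    simp_rw [PiLp.inner_apply, eval_centeredSum, f]
    rw [Finset.sum_comm]
    simp [Finset.mul_sum, mul_comm]
  set W := ∫ x in (-1:ℝ)..1, w x
  set C := (2 * n + 1) / π * L with hC
  have hC0 : 0 ≤ C := by positivity
  set B := (2 * κ + 2 * C * W) / (1 - κ) with hB
  have hB0 : 0 ≤ B := div_nonneg (by positivity) (by linarith)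
  set A := n * (2 / π) * L with hA
  have hA0 : 0 ≤ A := by positivity
  obtain ⟨c, hc⟩ := exists_eq_zero_of_inner_pos hf (R := A * B + 1) (by positivity) (by
    intro c hRc
    rw [hinner]
    have hdeg := natDegree_centeredSum_le w c
    have h0 := integral_centeredSum_mul hwi hW c
    have hJ := h1 _ hdeg h0
    set b := ∫ x in (-1:ℝ)..1, max ((centeredSum w c).eval x) 0 * w x with hb
    have hAb : ‖c‖ ≤ A * b := by
      refine (norm_le_integral_centeredSum w c).trans ?_
      rw [hA, mul_assoc _ L]
      exact mul_le_mul_of_nonneg_left hJ (by positivity)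
    have hBb : B < b := lt_of_mul_lt_mul_left (by linarith) hA0
    refine sum_eval_quantile_pos hw0 hwi hW (κ := κ) (C := C) hb.symm (fun x hx => ?_) hN
      (h2 _ hdeg h0) (hB0.trans_lt hBb) ?_ (fun i _ => hz c i) (hzq c)
    · refine (abs_eval_le_integral_measureT hdeg hx).trans ?_
      rw [hC, mul_assoc _ L]
      exact mul_le_mul_of_nonneg_left hJ (by positivity)
    · rw [hB, div_lt_iff₀ (by linarith)] at hBb
      linarith)
  have hsum : ∀ k < n, ∑ i ∈ Finset.range N, (centeredT w k).eval (z c (i + 1)) = 0 := by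
    intro k hk
    have := congrArg (fun v : EuclideanSpace ℝ (Fin n) => v ⟨k, hk⟩) hc
    simpa [f] using this
  have hT : ∀ k ≤ n, ∫ x in (-1:ℝ)..1, (T ℝ k).eval x * w x =
      W / N * ∑ i ∈ Finset.range N, (T ℝ k).eval (z c (i + 1)) := by
    rintro (_ | k) hk
    · simp [W, hN'.ne']
    · have := hsum k hk
      unfold centeredT at this
      simp only [Polynomial.eval_sub, Polynomial.eval_C, Finset.sum_sub_distrib, Finset.sum_const,
        Finset.card_range, nsmul_eq_mul, sub_eq_zero] at this
      rw [this, ← mul_assoc, div_mul_cancel₀ _ hN'.ne', mul_div_cancel₀ _ hW.ne']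
  refine ⟨fun i => z c (i + 1), fun i j hij => ?_, fun i => hz c _, fun p hp => ?_⟩
  · exact quantile_mono (hgi c) (hg1 c) (s := (i + 1 : ℕ) / N) (s' := (j + 1 : ℕ) / N)
      (by gcongr; exact hij) (hz c _) (hz c _) (hzq c _ i.2) (hzq c _ j.2)
  · obtain ⟨a, rfl⟩ := exists_sum_chebyshev_T hp
    rw [← Finset.sum_range fun i => Polynomial.eval (z c (i + 1)) _]
    simp_rw [Polynomial.eval_finsetSum, Polynomial.eval_mul, Polynomial.eval_C]
    rw [Finset.sum_comm]
    simp_rw [Finset.sum_mul, mul_assoc, ← Finset.mul_sum]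
    rw [Finset.mul_sum]
    rw [intervalIntegral.integral_finsetSum fun k _ =>
      (hwi.continuousOn_mul (by fun_prop)).const_mul _]
    refine Finset.sum_congr rfl fun k hk => ?_
    rw [intervalIntegral.integral_const_mul, hT k (Nat.lt_succ_iff.mp (Finset.mem_range.mp hk))]
    ring

theorem general_upper_bound_interval (n : ℕ) (hn : 1 ≤ n)
    (w : ℝ → ℝ) (hw : IsWeight w)
    (η : ℝ) (hη0 : 0 < η) (hη1 : η < 1)
    (D : Set ℝ) (hD : D ⊆ Icc (-1:ℝ) 1) (hDmeas : MeasurableSet D)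
    (hDint : (∫ t in D, 1 / Real.sqrt (1 - t ^ 2)) ≤ (1 - η) ^ 2 * π / (2 * n + 1))
    (hE : 0 < essInf (fun t => Real.sqrt (1 - t ^ 2) * w t)
      (volume.restrict (Icc (-1:ℝ) 1 \ D)))
    (N : ℕ)
    (hN : (2 / η) * ((∫ t in (-1:ℝ)..1, w t) /
        essInf (fun t => Real.sqrt (1 - t ^ 2) * w t) (volume.restrict (Icc (-1:ℝ) 1 \ D))) * n
      ≤ N) :
    ∃ t : Fin N → ℝ, IsChebQuad w n N t := by
  have hlow := fun (p : Polynomial ℝ) (hp : p.natDegree ≤ n) =>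
    essInf_mul_integral_measureT_le hw.2.1 hw.2.2.2.1 hD hDmeas hDint hE hp
  have hmax := fun p : Polynomial ℝ => integral_max_zero_mul (p := p) hw.2.2.2.1
  have hW := hw.2.2.2.2
  set E := essInf (fun t => Real.sqrt (1 - t ^ 2) * w t) (volume.restrict (Icc (-1:ℝ) 1 \ D))
  have hn' : (0:ℝ) < n := by exact_mod_cast hn
  have hN' : (0:ℝ) < N := lt_of_lt_of_le (by positivity) hN
  have h2η : 0 < 2 - η := by linarith
  have hL : ∀ p : Polynomial ℝ, p.natDegree ≤ n → ∫ x in (-1:ℝ)..1, p.eval x * w x = 0 →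
      ∫ x, |p.eval x| ∂Polynomial.Chebyshev.measureT ≤
        2 / (E * (η * (2 - η))) * ∫ x in (-1:ℝ)..1, max (p.eval x) 0 * w x := by
    intro p hp h0
    have h := hlow p hp
    rw [hmax p h0, div_mul_eq_mul_div, le_div_iff₀ (by positivity)]
    linarith
  refine exists_isChebQuad hw (by exact_mod_cast hN') (κ := 1 / (2 - η))
    (L := 2 / (E * (η * (2 - η)))) (by positivity) ((div_lt_one h2η).mpr (by linarith))
    (by positivity) hL fun p hp h0 => ?_
  have hJ := hL p hp h0
  set b := ∫ x in (-1:ℝ)..1, max (p.eval x) 0 * w x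
  set W := ∫ x in (-1:ℝ)..1, w x
  have hb0 : 0 ≤ b := intervalIntegral.integral_nonneg (by norm_num) fun x _ =>
    mul_nonneg (le_max_right _ _) (hw.2.1 x)
  calc W * ∫ x in (-1:ℝ)..1, |p.derivative.eval x|
      ≤ W * (n * (2 / (E * (η * (2 - η))) * b)) :=
        mul_le_mul_of_nonneg_left ((integral_abs_derivative_le hn hp).trans
          (mul_le_mul_of_nonneg_left hJ hn'.le)) hW.le
    _ = 2 / η * (W / E) * n * (b / (2 - η)) := by field_simp
    _ ≤ N * (b / (2 - η)) := mul_le_mul_of_nonneg_right hN (by positivity)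
    _ = 1 / (2 - η) * N * b := by ring
end
end

section
/- For every α > 0 there exist positive constants c(α) and C(α), depending only on α, such that for every integer n ≥ 1: every Chebyshev-type trigonometric quadrature of degree n for W_α has at least exp(c(α)·n^{α/(α+1)}) nodes, and for every integer N ≥ exp(C(α)·n^{α/(α+1)}) there exists a Chebyshev-type trigonometric quadrature of degree n for W_α with exactly N nodes. Here W_α is the 2π-periodic function defined on [-π, π) by W_α(θ) := exp(-|θ|^{-α}) for θ ≠ 0 and W_α(0) := 0, extended 2π-periodically to ℝ. -/
open MeasureTheory Real Set

noncomputable section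

/-- A trigonometric polynomial of degree at most `n`. -/
def IsTrigPoly (n : ℕ) (p : ℝ → ℝ) : Prop :=
  ∃ a b : ℕ → ℝ, ∀ θ : ℝ,
    p θ = a 0 + ∑ k ∈ Finset.Icc 1 n, (a k * Real.cos (k * θ) + b k * Real.sin (k * θ))

/-- A Chebyshev-type trigonometric quadrature of degree `n` for `W` with `N` nodes. -/
def IsTrigChebQuad (W : ℝ → ℝ) (n N : ℕ) (θs : Fin N → ℝ) : Prop :=
  Monotone θs ∧
  ∀ p : ℝ → ℝ, IsTrigPoly n p →
    (∫ θ in (-π)..π, p θ * W θ) =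
      ((∫ θ in (-π)..π, W θ) / N) * ∑ i, p (θs i)

theorem IsTrigPoly.mono {m n : ℕ} (hmn : m ≤ n) {p : ℝ → ℝ} (hp : IsTrigPoly m p) :
    IsTrigPoly n p := by
  obtain ⟨a, b, h⟩ := hp
  refine ⟨fun k => if k ≤ m then a k else 0, fun k => if k ≤ m then b k else 0, fun θ => ?_⟩
  rw [h θ, ← Finset.sum_subset (Finset.Icc_subset_Icc_right hmn)]
  · simp only [Nat.zero_le, if_true]
    congr 1
    refine Finset.sum_congr rfl fun k hk => ?_
    simp [(Finset.mem_Icc.1 hk).2]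
  · intro k hk hk'
    have : ¬ k ≤ m := fun h => hk' (Finset.mem_Icc.2 ⟨(Finset.mem_Icc.1 hk).1, h⟩)
    simp [this]

theorem IsTrigPoly.add {n : ℕ} {p q : ℝ → ℝ} (hp : IsTrigPoly n p) (hq : IsTrigPoly n q) :
    IsTrigPoly n (fun θ => p θ + q θ) := by
  obtain ⟨a, b, h⟩ := hp
  obtain ⟨a', b', h'⟩ := hq
  refine ⟨fun k => a k + a' k, fun k => b k + b' k, fun θ => ?_⟩
  have : ∀ A B C D : ℝ, A + B + (C + D) = A + C + (B + D) := by intros; ring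
  simp only [h θ, h' θ]
  rw [this, ← Finset.sum_add_distrib]
  congr 1
  exact Finset.sum_congr rfl fun k _ => by ring

theorem IsTrigPoly.const_mul {n : ℕ} {p : ℝ → ℝ} (c : ℝ) (hp : IsTrigPoly n p) :
    IsTrigPoly n (fun θ => c * p θ) := by
  obtain ⟨a, b, h⟩ := hp
  refine ⟨fun k => c * a k, fun k => c * b k, fun θ => ?_⟩
  simp only [h θ]
  rw [mul_add, Finset.mul_sum]
  congr 1
  exact Finset.sum_congr rfl fun k _ => by ring

theorem isTrigPoly_const (n : ℕ) (c : ℝ) : IsTrigPoly n (fun _ => c) :=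
  ⟨fun k => if k = 0 then c else 0, 0, fun θ => by
    rw [Finset.sum_eq_zero]
    · simp
    · intro k hk
      have : k ≠ 0 := by have := (Finset.mem_Icc.1 hk).1; omega
      simp [this]⟩

theorem IsTrigPoly.sum {ι : Type*} {n : ℕ} (s : Finset ι) {p : ι → ℝ → ℝ}
    (hp : ∀ i ∈ s, IsTrigPoly n (p i)) : IsTrigPoly n (fun θ => ∑ i ∈ s, p i θ) := by
  classical
  induction s using Finset.induction_on with
  | empty => simpa using isTrigPoly_const n 0
  | insert i s hi ih =>
    simp only [Finset.sum_insert hi]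
    exact (hp i (Finset.mem_insert_self i s)).add
      (ih fun j hj => hp j (Finset.mem_insert_of_mem hj))

theorem isTrigPoly_cos {k n : ℕ} (hk : k ≤ n) : IsTrigPoly n (fun θ => Real.cos (k * θ)) := by
  rcases Nat.eq_zero_or_pos k with rfl | h0
  · simpa using isTrigPoly_const n 1
  refine ⟨fun j => if j = k then 1 else 0, 0, fun θ => ?_⟩
  simp [h0.ne, hk, Nat.one_le_iff_ne_zero.2 h0.ne']

theorem isTrigPoly_sin {k n : ℕ} (hk : k ≤ n) : IsTrigPoly n (fun θ => Real.sin (k * θ)) := by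
  rcases Nat.eq_zero_or_pos k with rfl | h0
  · simpa using isTrigPoly_const n 0
  refine ⟨0, fun j => if j = k then 1 else 0, fun θ => ?_⟩
  simp [hk, Nat.one_le_iff_ne_zero.2 h0.ne']

theorem IsTrigPoly.cos_mul {n : ℕ} {p : ℝ → ℝ} (hp : IsTrigPoly n p) :
    IsTrigPoly (n + 1) (fun θ => Real.cos θ * p θ) := by
  obtain ⟨a, b, h⟩ := hp
  have key : ∀ k ∈ Finset.Icc 1 n, IsTrigPoly (n + 1)
      (fun θ => Real.cos θ * (a k * Real.cos (k * θ) + b k * Real.sin (k * θ))) := by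
    intro k hk
    obtain ⟨h1, h2⟩ := Finset.mem_Icc.1 hk
    obtain ⟨j, rfl⟩ : ∃ j, k = j + 1 := ⟨k - 1, by omega⟩
    have e := ((((isTrigPoly_cos (show j + 2 ≤ n + 1 by omega)).const_mul (a (j + 1) / 2)).add
      ((isTrigPoly_cos (show j ≤ n + 1 by omega)).const_mul (a (j + 1) / 2))).add
      ((isTrigPoly_sin (show j + 2 ≤ n + 1 by omega)).const_mul (b (j + 1) / 2))).add
      ((isTrigPoly_sin (show j ≤ n + 1 by omega)).const_mul (b (j + 1) / 2))
    refine (congrArg (IsTrigPoly (n + 1)) (funext fun θ => ?_)).mp e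
    have e1 : ((j + 2 : ℕ) : ℝ) * θ = ((j + 1 : ℕ) : ℝ) * θ + θ := by push_cast; ring
    have e2 : ((j : ℕ) : ℝ) * θ = ((j + 1 : ℕ) : ℝ) * θ - θ := by push_cast; ring
    rw [e1, e2, Real.cos_add, Real.cos_sub, Real.sin_add, Real.sin_sub]
    ring
  have e := ((isTrigPoly_cos (show 1 ≤ n + 1 by omega)).const_mul (a 0)).add
    (IsTrigPoly.sum _ key)
  refine (congrArg (IsTrigPoly (n + 1)) (funext fun θ => ?_)).mp e
  rw [h θ, mul_add, Finset.mul_sum]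
  simp [mul_comm]

theorem isTrigPoly_eval_cos {n : ℕ} {P : Polynomial ℝ} (hP : P.natDegree ≤ n) :
    IsTrigPoly n (fun θ => P.eval (Real.cos θ)) := by
  have hpow : ∀ j : ℕ, IsTrigPoly j (fun θ => Real.cos θ ^ j) := by
    intro j
    induction j with
    | zero => simpa using isTrigPoly_const 0 1
    | succ j ih => simpa [pow_succ'] using ih.cos_mul
  simp only [Polynomial.eval_eq_sum_range]
  exact IsTrigPoly.sum _ fun j hj => ((hpow j).mono
    (by have := Finset.mem_range.1 hj; omega)).const_mul _

/-- The polynomial `T_n` precomposed with the affine map sending `[-1, cos (2 * η)]` to `[-1, 1]`. -/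
def windowPoly (n : ℕ) (η : ℝ) : Polynomial ℝ :=
  (Polynomial.Chebyshev.T ℝ n).comp
    (Polynomial.C (1 / Real.cos η ^ 2) * (Polynomial.X + 1) - 1)

theorem windowPoly_eval (n : ℕ) (η x : ℝ) : (windowPoly n η).eval x =
    (Polynomial.Chebyshev.T ℝ n).eval ((x + 1) / Real.cos η ^ 2 - 1) := by
  simp [windowPoly, div_eq_inv_mul]

theorem windowPoly_natDegree_le (n : ℕ) (η : ℝ) : (windowPoly n η).natDegree ≤ n := by
  refine Polynomial.natDegree_comp_le.trans ?_
  have h1 : (Polynomial.C (1 / Real.cos η ^ 2) * (Polynomial.X + 1) - 1 :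
      Polynomial ℝ).natDegree ≤ 1 := by compute_degree
  have h2 : (Polynomial.Chebyshev.T ℝ n).natDegree = n := by simp
  rw [h2]
  nlinarith

theorem half_le_cos {η : ℝ} (h0 : 0 ≤ η) (h1 : η ≤ 1) : 1 / 2 ≤ Real.cos η := by
  have := Real.one_sub_sq_div_two_le_cos (x := η)
  nlinarith

theorem chebyshev_T_eval_le_exp (n : ℕ) {y v : ℝ} (hy : 1 ≤ y) (hv : 0 ≤ v)
    (hyv : y ≤ Real.cosh v) : (Polynomial.Chebyshev.T ℝ n).eval y ≤ Real.exp (n * v) := by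
  have h := Real.cosh_arcosh hy
  have h0 := Real.arcosh_nonneg hy
  rw [← h] at hyv
  rw [← h, Polynomial.Chebyshev.T_real_cosh]
  have h1 : Real.arcosh y ≤ v := by
    have := Real.cosh_le_cosh.1 hyv
    rwa [abs_of_nonneg h0, abs_of_nonneg hv] at this
  calc Real.cosh (((n : ℕ) : ℤ) * Real.arcosh y) ≤ Real.cosh (n * v) := by
        rw [Real.cosh_le_cosh, abs_of_nonneg (by positivity), abs_of_nonneg (by positivity)]
        push_cast
        gcongr
    _ ≤ Real.exp (n * v) := by
        rw [Real.cosh_eq]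
        have : Real.exp (-(n * v)) ≤ Real.exp (n * v) :=
          Real.exp_le_exp.2 (by have : 0 ≤ n * v := by positivity
                                linarith)
        linarith

theorem exp_le_chebyshev_T_eval (n : ℕ) {y v : ℝ} (hv : 0 ≤ v) (hyv : Real.cosh v ≤ y) :
    Real.exp (n * v) / 2 ≤ (Polynomial.Chebyshev.T ℝ n).eval y := by
  have hy : 1 ≤ y := (Real.one_le_cosh v).trans hyv
  have h := Real.cosh_arcosh hy
  have h0 := Real.arcosh_nonneg hy
  rw [← h] at hyv
  rw [← h, Polynomial.Chebyshev.T_real_cosh]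
  have h1 : v ≤ Real.arcosh y := by
    have := Real.cosh_le_cosh.1 hyv
    rwa [abs_of_nonneg h0, abs_of_nonneg hv] at this
  calc Real.exp (n * v) / 2 ≤ Real.cosh (n * v) := by
        rw [Real.cosh_eq]
        have := Real.exp_pos (-(n * v))
        linarith
    _ ≤ Real.cosh (((n : ℕ) : ℤ) * Real.arcosh y) := by
        rw [Real.cosh_le_cosh, abs_of_nonneg (by positivity), abs_of_nonneg (by positivity)]
        push_cast
        gcongr

theorem one_add_cos_eq (η : ℝ) : Real.cos (2 * η) + 1 = 2 * Real.cos η ^ 2 := by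
  rw [Real.cos_two_mul]; ring

theorem two_div_cos_sq_le_cosh {η : ℝ} (h0 : 0 ≤ η) (h1 : η ≤ 1) :
    (1 + 1) / Real.cos η ^ 2 - 1 ≤ Real.cosh (4 * η) := by
  have hc := half_le_cos h0 h1
  have h2 := Real.one_sub_sq_div_two_le_cos (x := η)
  have h3 : 1 + (4 * η) ^ 2 / 2 ≤ Real.cosh (4 * η) := by
    have e : 4 * η = 2 * (2 * η) := by ring
    have h4 : 2 * η ≤ Real.sinh (2 * η) := Real.self_le_sinh_iff.2 (by positivity)
    rw [e, Real.cosh_two_mul, Real.cosh_sq]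
    nlinarith
  refine le_trans ?_ h3
  rw [sub_le_iff_le_add, div_le_iff₀ (by positivity)]
  have h4 : 1 - η ^ 2 ≤ Real.cos η ^ 2 := by
    rw [← Real.sin_sq_add_cos_sq η]
    have := Real.sin_le h0
    have := Real.sin_nonneg_of_nonneg_of_le_pi h0 (by linarith [Real.pi_gt_three])
    nlinarith
  have h5 : 1 / 4 ≤ Real.cos η ^ 2 := by nlinarith
  nlinarith [sq_nonneg η]

theorem abs_windowPoly_le_one (n : ℕ) {η θ : ℝ} (h0 : 0 ≤ η) (h1 : η ≤ 1)
    (hθ : 2 * η ≤ |θ|) (hθ' : |θ| ≤ π) : |(windowPoly n η).eval (Real.cos θ)| ≤ 1 := by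
  have hc := half_le_cos h0 h1
  rw [windowPoly_eval]
  apply Polynomial.Chebyshev.abs_eval_T_real_le_one
  rw [abs_le]
  have h2 : Real.cos θ + 1 ≤ 2 * Real.cos η ^ 2 := by
    rw [← one_add_cos_eq, ← Real.cos_abs θ]
    gcongr
    exact Real.cos_le_cos_of_nonneg_of_le_pi (by linarith) hθ' hθ
  constructor
  · have : 0 ≤ (Real.cos θ + 1) / Real.cos η ^ 2 :=
      div_nonneg (by linarith [Real.neg_one_le_cos θ]) (by positivity)
    linarith
  · rw [sub_le_iff_le_add, div_le_iff₀ (by positivity)]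
    linarith

theorem one_le_window_arg {η θ : ℝ} (h0 : 0 ≤ η) (h1 : η ≤ 1) (hθ : |θ| ≤ 2 * η) :
    1 ≤ (Real.cos θ + 1) / Real.cos η ^ 2 - 1 := by
  have hc := half_le_cos h0 h1
  have h2 : 2 * Real.cos η ^ 2 ≤ Real.cos θ + 1 := by
    rw [← one_add_cos_eq, ← Real.cos_abs θ]
    gcongr
    exact Real.cos_le_cos_of_nonneg_of_le_pi (abs_nonneg _) (by linarith [Real.pi_gt_three]) hθ
  rw [le_sub_iff_add_le, le_div_iff₀ (by positivity)]
  linarith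

theorem one_le_windowPoly (n : ℕ) {η θ : ℝ} (h0 : 0 ≤ η) (h1 : η ≤ 1) (hθ : |θ| ≤ 2 * η) :
    1 ≤ (windowPoly n η).eval (Real.cos θ) := by
  rw [windowPoly_eval]
  exact Polynomial.Chebyshev.one_le_eval_T_real n (one_le_window_arg h0 h1 hθ)

theorem windowPoly_le_exp (n : ℕ) {η θ : ℝ} (h0 : 0 ≤ η) (h1 : η ≤ 1) (hθ : |θ| ≤ 2 * η) :
    (windowPoly n η).eval (Real.cos θ) ≤ Real.exp (n * (4 * η)) := by
  rw [windowPoly_eval]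
  refine chebyshev_T_eval_le_exp n (one_le_window_arg h0 h1 hθ) (by positivity) ?_
  refine le_trans ?_ (two_div_cos_sq_le_cosh h0 h1)
  gcongr
  exact Real.cos_le_one θ

theorem exp_le_windowPoly (n : ℕ) {η θ : ℝ} (h0 : 0 ≤ η) (h1 : η ≤ 1) (hθ : |θ| ≤ η) :
    Real.exp (n * (η / 2)) / 2 ≤ (windowPoly n η).eval (Real.cos θ) := by
  rw [windowPoly_eval]
  refine exp_le_chebyshev_T_eval n (by positivity) ?_
  have hc := half_le_cos h0 h1
  have hpi : η ≤ π := by linarith [Real.pi_gt_three]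
  have h2 : Real.cos η ≤ Real.cos θ := by
    rw [← Real.cos_abs θ]
    exact Real.cos_le_cos_of_nonneg_of_le_pi (abs_nonneg _) hpi hθ
  have h3 : Real.cos η ≤ 1 - η ^ 2 / 5 := by
    have h := Real.cos_le_one_sub_mul_cos_sq (x := η) (by rwa [abs_of_nonneg h0])
    have : 1 / 5 ≤ 2 / π ^ 2 := by
      rw [div_le_div_iff₀ (by norm_num) (by positivity)]
      nlinarith [Real.pi_lt_d2, Real.pi_pos]
    nlinarith [sq_nonneg η]
  have h4 : Real.cosh (η / 2) ≤ 1 + η ^ 2 / 4 := by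
    refine (Real.cosh_le_exp_half_sq _).trans ?_
    have h := Real.abs_exp_sub_one_le (x := (η / 2) ^ 2 / 2)
      (by rw [abs_of_nonneg (by positivity)]; nlinarith)
    rw [abs_of_nonneg (a := (η / 2) ^ 2 / 2) (by positivity)] at h
    have := (abs_le.1 h).2
    linarith
  refine h4.trans ?_
  rw [le_sub_iff_add_le, le_div_iff₀ (by positivity)]
  set c := Real.cos η
  have : (1 + η ^ 2 / 4 + 1) * c ^ 2 ≤ c + 1 := by
    have : η ^ 2 ≤ 5 * (1 - c) := by linarith
    have hc1 : c ≤ 1 := Real.cos_le_one η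
    have : (1 + η ^ 2 / 4 + 1) * c ^ 2 ≤ (2 + 5 / 4 * (1 - c)) * c ^ 2 := by
      refine mul_le_mul_of_nonneg_right (by linarith) (sq_nonneg c)
    nlinarith [mul_nonneg (sub_nonneg.2 hc1) (sq_nonneg c), mul_nonneg (sub_nonneg.2 hc1) (by linarith : 0 ≤ c)]
  linarith

/-- A Remez-type inequality for polynomials in `cos θ`. -/
theorem abs_eval_one_le_of_abs_eval_cos_le {n : ℕ} {P : Polynomial ℝ} (hP : P.natDegree ≤ n)
    {η B : ℝ} (h0 : 0 ≤ η) (h1 : η ≤ 1) (hB : 0 < B)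
    (h : ∀ θ, 2 * η ≤ θ → θ ≤ π → |P.eval (Real.cos θ)| ≤ B) :
    |P.eval 1| ≤ B * Real.exp (n * (4 * η)) := by
  have hc := half_le_cos h0 h1
  have hc2 : 0 < Real.cos η ^ 2 := by positivity
  have key : ∀ Q : Polynomial ℝ, Q.natDegree ≤ n →
      (∀ θ, 2 * η ≤ θ → θ ≤ π → |Q.eval (Real.cos θ)| ≤ B) →
      Q.eval 1 ≤ B * Real.exp (n * (4 * η)) := by
    intro Q hQ hQB
    set R : Polynomial ℝ := Polynomial.C B⁻¹ *
      Q.comp (Polynomial.C (Real.cos η ^ 2) * (Polynomial.X + 1) - 1) with hR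
    have hev : ∀ y, R.eval y = B⁻¹ * Q.eval (Real.cos η ^ 2 * (y + 1) - 1) := by
      intro y; simp [hR]
    have hdeg : R.degree ≤ n := by
      refine Polynomial.degree_le_of_natDegree_le ?_
      refine (Polynomial.natDegree_C_mul_le _ _).trans (Polynomial.natDegree_comp_le.trans ?_)
      have h1 : (Polynomial.C (Real.cos η ^ 2) * (Polynomial.X + 1) - 1 :
        Polynomial ℝ).natDegree ≤ 1 := by compute_degree
      nlinarith
    have hbd : ∀ y ∈ Set.Icc (-1 : ℝ) 1, |R.eval y| ≤ 1 := by
      rintro y ⟨hy1, hy2⟩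
      set z := Real.cos η ^ 2 * (y + 1) - 1
      have hz1 : -1 ≤ z := by
        have : 0 ≤ Real.cos η ^ 2 * (y + 1) := mul_nonneg hc2.le (by linarith)
        simp only [z]; linarith
      have hz2 : z ≤ Real.cos (2 * η) := by
        have := one_add_cos_eq η
        simp only [z]; nlinarith
      have hz3 : z ≤ 1 := hz2.trans (Real.cos_le_one _)
      have hq := hQB (Real.arccos z) (by
        rw [← Real.arccos_cos (x := 2 * η) (by linarith) (by linarith [Real.pi_gt_three])]
        exact Real.arccos_le_arccos hz2) (Real.arccos_le_pi z)
      rw [Real.cos_arccos hz1 hz3] at hq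
      rw [hev, abs_mul, abs_of_pos (inv_pos.2 hB), inv_mul_le_iff₀ hB]
      linarith
    set y := (1 + 1) / Real.cos η ^ 2 - 1
    have hy : 1 ≤ y := by
      simpa using one_le_window_arg (θ := 0) h0 h1 (by simpa using h0)
    have h2 := Polynomial.Chebyshev.eval_iterate_derivative_le_of_forall_abs_le_one
      (k := 0) hy hdeg hbd
    rw [Function.iterate_zero, id, id] at h2
    have h3 := h2.trans (chebyshev_T_eval_le_exp n hy (by positivity : 0 ≤ 4 * η)
      (two_div_cos_sq_le_cosh h0 h1))
    rw [hev, inv_mul_le_iff₀ hB] at h3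
    have hy1 : Real.cos η ^ 2 * (y + 1) - 1 = 1 := by
      simp only [y]
      field_simp
      ring
    rwa [hy1] at h3
  rw [abs_le']
  refine ⟨key P hP h, ?_⟩
  have := key (-P) (by simpa using hP) (by simpa using h)
  simpa using this

/-- If the average of `φ` over the points `θ i` is close to `m`, and the directions `φ' (θ i)` span
the space quantitatively, then the points can be moved so that the average becomes exactly `m`. -/
theorem exists_average_eq {E : Type*} [NormedAddCommGroup E] [InnerProductSpace ℝ E]
    [FiniteDimensional ℝ E] {φ φ' : ℝ → E} {M l : ℝ} (hM : 0 < M) (hl : 0 < l)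
    (hφ : ∀ t, HasDerivAt φ (φ' t) t) (hφM : ∀ t, ‖φ' t‖ ≤ M)
    (hφL : ∀ s t, ‖φ' s - φ' t‖ ≤ M * |s - t|) {N : ℕ} (hN : 0 < N) (θ : Fin N → ℝ) (m : E)
    (hcoer : ∀ x : E, l * ‖x‖ ^ 2 ≤ (1 / N : ℝ) * ∑ i, (inner ℝ (φ' (θ i)) x) ^ 2)
    (herr : ‖m - (1 / N : ℝ) • ∑ i, φ (θ i)‖ ≤ l ^ 2 / (4 * M ^ 3)) :
    ∃ y : Fin N → ℝ, (1 / N : ℝ) • ∑ i, φ (y i) = m := by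
  have hN' : (0 : ℝ) < N := by exact_mod_cast hN
  set A : E →L[ℝ] E := (1 / N : ℝ) • ∑ i, (innerSL ℝ (φ' (θ i))).smulRight (φ' (θ i)) with hA
  have hAx : ∀ x, A x = (1 / N : ℝ) • ∑ i, inner ℝ (φ' (θ i)) x • φ' (θ i) := by
    intro x; simp [hA]
  have hlow : ∀ x, l * ‖x‖ ≤ ‖A x‖ := by
    intro x
    have h1 : l * ‖x‖ ^ 2 ≤ inner ℝ (A x) x := by
      refine (hcoer x).trans (le_of_eq ?_)
      rw [hAx, inner_smul_left, sum_inner]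
      simp [inner_smul_left, sq]
    have h2 := h1.trans (real_inner_le_norm _ _)
    rcases eq_or_ne x 0 with rfl | hx
    · simp
    have h3 : 0 < ‖x‖ := norm_pos_iff.2 hx
    exact le_of_mul_le_mul_right (by linarith) h3
  have hinj : Function.Injective A := by
    rw [injective_iff_map_eq_zero]
    intro x hx
    have := hlow x
    rw [hx, norm_zero] at this
    exact norm_eq_zero.1 (le_antisymm (nonpos_of_mul_nonpos_right this hl) (norm_nonneg x))
  have hsurj : Function.Surjective A :=
    (LinearMap.injective_iff_surjective (f := (A : E →ₗ[ℝ] E))).1 hinj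
  choose g hg using hsurj
  let Ainv : A.NonlinearRightInverse :=
    { toFun := g
      nnnorm := Real.toNNReal l⁻¹
      bound' := fun y => by
        have := hlow (g y)
        rw [hg] at this
        rw [Real.coe_toNNReal _ (by positivity), inv_mul_eq_div, le_div_iff₀ hl]
        linarith
      right_inv' := hg }
  set r : ℝ := l / (2 * M ^ 3)
  have hr : 0 < r := by positivity
  let F : E → E := fun x => (1 / N : ℝ) • ∑ i, φ (θ i + inner ℝ (φ' (θ i)) x)
  have hstep : ∀ (i : Fin N) (a b : ℝ), |a| ≤ M * r → |b| ≤ M * r →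
      ‖φ (θ i + a) - φ (θ i + b) - (a - b) • φ' (θ i)‖ ≤ M * (M * r) * |a - b| := by
    intro i a b ha hb
    have hd : ∀ t ∈ Set.Icc (-(M * r)) (M * r), HasDerivWithinAt
        (fun t => φ (θ i + t) - t • φ' (θ i)) (φ' (θ i + t) - φ' (θ i))
        (Set.Icc (-(M * r)) (M * r)) t := by
      intro t _
      have h1 : HasDerivAt (fun t => φ (θ i + t)) (φ' (θ i + t)) t :=
        (hφ (θ i + t)).comp_const_add (θ i) t
      have h2 : HasDerivAt (fun t : ℝ => t • φ' (θ i)) ((1 : ℝ) • φ' (θ i)) t :=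
        (hasDerivAt_id t).smul_const _
      rw [one_smul] at h2
      exact (h1.sub h2).hasDerivWithinAt
    have hbd : ∀ t ∈ Set.Icc (-(M * r)) (M * r), ‖φ' (θ i + t) - φ' (θ i)‖ ≤ M * (M * r) := by
      intro t ht
      refine (hφL _ _).trans ?_
      rw [add_sub_cancel_left]
      exact mul_le_mul_of_nonneg_left (abs_le.2 ht) hM.le
    have := (convex_Icc _ _).norm_image_sub_le_of_norm_hasDerivWithin_le hd hbd
      (abs_le.1 hb) (abs_le.1 ha)
    rw [Real.norm_eq_abs] at this
    refine le_trans (le_of_eq ?_) this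
    congr 1
    rw [sub_smul]
    abel
  have hball : ∀ x ∈ Metric.closedBall (0 : E) r, ∀ i, |inner ℝ (φ' (θ i)) x| ≤ M * r := by
    intro x hx i
    rw [mem_closedBall_zero_iff] at hx
    exact (abs_real_inner_le_norm _ _).trans
      (mul_le_mul (hφM _) hx (norm_nonneg _) hM.le)
  have happ : ApproximatesLinearOn F A (Metric.closedBall 0 r) (l / 2).toNNReal := by
    intro x hx y hy
    have e : F x - F y - A (x - y) = (1 / N : ℝ) • ∑ i, (φ (θ i + inner ℝ (φ' (θ i)) x) -
        φ (θ i + inner ℝ (φ' (θ i)) y) -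
        (inner ℝ (φ' (θ i)) x - inner ℝ (φ' (θ i)) y) • φ' (θ i)) := by
      rw [hAx]
      simp only [F, inner_sub_right, Finset.sum_sub_distrib, smul_sub]
    rw [e, norm_smul, Real.coe_toNNReal _ (by positivity), Real.norm_of_nonneg (by positivity)]
    have hi : ∀ i ∈ Finset.univ, ‖φ (θ i + inner ℝ (φ' (θ i)) x) -
        φ (θ i + inner ℝ (φ' (θ i)) y) -
        (inner ℝ (φ' (θ i)) x - inner ℝ (φ' (θ i)) y) • φ' (θ i)‖ ≤ l / 2 * ‖x - y‖ := by
      intro i _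
      refine (hstep i _ _ (hball x hx i) (hball y hy i)).trans ?_
      have h1 : |inner ℝ (φ' (θ i)) x - inner ℝ (φ' (θ i)) y| ≤ M * ‖x - y‖ := by
        rw [← inner_sub_right]
        exact (abs_real_inner_le_norm _ _).trans
          (mul_le_mul_of_nonneg_right (hφM _) (norm_nonneg _))
      calc M * (M * r) * |inner ℝ (φ' (θ i)) x - inner ℝ (φ' (θ i)) y|
          ≤ M * (M * r) * (M * ‖x - y‖) := by gcongr
        _ = l / 2 * ‖x - y‖ := by
          simp only [r]
          field_simp
    have := norm_sum_le_of_le _ hi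
    rw [Finset.sum_const, Finset.card_univ, Fintype.card_fin, nsmul_eq_mul] at this
    calc (1 / N : ℝ) * _ ≤ (1 / N : ℝ) * (N * (l / 2 * ‖x - y‖)) := by gcongr
      _ = l / 2 * ‖x - y‖ := by field_simp
  have hF0 : F 0 = (1 / N : ℝ) • ∑ i, φ (θ i) := by simp [F]
  have hmem : m ∈ Metric.closedBall (F 0)
      (((Ainv.nnnorm : ℝ)⁻¹ - ((l / 2).toNNReal : ℝ)) * r) := by
    rw [mem_closedBall_iff_norm, hF0]
    refine herr.trans (le_of_eq ?_)
    simp only [Ainv, r]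
    rw [Real.coe_toNNReal _ (by positivity), Real.coe_toNNReal _ (by positivity)]
    field_simp
    ring
  obtain ⟨x, -, hx⟩ := happ.surjOn_closedBall_of_nonlinearRightInverse Ainv hr.le subset_rfl hmem
  exact ⟨_, hx⟩

/-- Points dividing the mass of `w` on `[a, b]` into `N` equal parts. -/
theorem exists_equal_mass_partition {w : ℝ → ℝ} {a b : ℝ} (hab : a ≤ b) (hw : ∀ t, 0 ≤ w t)
    (hint : ∀ s t, IntervalIntegrable w volume s t) (hI : 0 < ∫ t in a..b, w t)
    {N : ℕ} (hN : 0 < N) :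
    ∃ τ : ℕ → ℝ, τ 0 = a ∧ τ N = b ∧ (∀ i < N, τ i ≤ τ (i + 1)) ∧
      ∀ i < N, (∫ t in (τ i)..(τ (i + 1)), w t) = (∫ t in a..b, w t) / N := by
  have hN' : (0 : ℝ) < N := by exact_mod_cast hN
  set I := ∫ t in a..b, w t with hIdef
  set G : ℝ → ℝ := fun s => ∫ t in a..s, w t with hG
  have hcont : Continuous G := intervalIntegral.continuous_primitive hint a
  have hGsub : ∀ s t, G t - G s = ∫ u in s..t, w u := fun s t =>
    intervalIntegral.integral_interval_sub_left (hint a t) (hint a s)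
  have hGmono : Monotone G := by
    intro s t hst
    have : 0 ≤ ∫ u in s..t, w u := intervalIntegral.integral_nonneg hst fun u _ => hw u
    rw [← hGsub] at this
    linarith
  have hex : ∀ i : ℕ, ∃ s, (i ≤ N → G s = i * (I / N)) ∧ (i = 0 → s = a) ∧ (i = N → s = b) := by
    intro i
    rcases eq_or_ne i 0 with rfl | h0
    · exact ⟨a, by simp [hG], by simp, fun h => absurd h (by omega)⟩
    rcases eq_or_ne i N with rfl | h1
    · refine ⟨b, fun _ => ?_, fun h => absurd h h0, fun _ => rfl⟩
      field_simp
      rfl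
    by_cases hi : i ≤ N
    · have : (i : ℝ) * (I / N) ∈ Set.Icc (G a) (G b) := by
        have e : (i : ℝ) * (I / N) = I * (i / N) := by ring
        constructor
        · simp only [hG, intervalIntegral.integral_same]
          positivity
        · rw [e]
          exact mul_le_of_le_one_right hI.le (div_le_one_of_le₀ (by exact_mod_cast hi) hN'.le)
      obtain ⟨s, -, hs⟩ := intermediate_value_Icc hab hcont.continuousOn this
      exact ⟨s, fun _ => hs, fun h => absurd h h0, fun h => absurd h h1⟩
    · exact ⟨0, fun h => absurd h hi, fun h => absurd h h0, fun h => absurd h h1⟩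
  choose τ hτ h0 h1 using hex
  have hdiff : ∀ i < N, G (τ (i + 1)) - G (τ i) = I / N := by
    intro i hi
    rw [hτ i hi.le, hτ (i + 1) hi]
    push_cast
    ring
  refine ⟨τ, h0 0 rfl, h1 N rfl, fun i hi => ?_, fun i hi => ?_⟩
  · by_contra! hlt
    have := hGmono hlt.le
    have h2 := hdiff i hi
    have : 0 < I / N := by positivity
    linarith
  · rw [← hGsub, hdiff i hi]

theorem norm_integral_sub_average_le {E : Type*} [NormedAddCommGroup E] [NormedSpace ℝ E]
    [CompleteSpace E] {w : ℝ → ℝ} (hw : ∀ t, 0 ≤ w t)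
    (hint : ∀ s t, IntervalIntegrable w volume s t) {f : ℝ → E} {L μ : ℝ} (hL : 0 ≤ L)
    (hf : ∀ s t, ‖f s - f t‖ ≤ L * |s - t|) {N : ℕ} {τ : ℕ → ℝ}
    (hmono : ∀ i < N, τ i ≤ τ (i + 1))
    (hmass : ∀ i < N, (∫ t in (τ i)..(τ (i + 1)), w t) = μ) :
    ‖(∫ t in (τ 0)..(τ N), w t • f t) - μ • ∑ i : Fin N, f (τ (i + 1))‖ ≤
      L * (τ N - τ 0) * μ := by
  have hfc : Continuous f := by
    have : LipschitzWith ⟨L, hL⟩ f := LipschitzWith.of_dist_le_mul fun s t => by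
      rw [dist_eq_norm, Real.dist_eq]; exact hf s t
    exact this.continuous
  have hwf : ∀ s t, IntervalIntegrable (fun t => w t • f t) volume s t := fun s t =>
    (hint s t).smul_continuousOn hfc.continuousOn
  rw [← intervalIntegral.sum_integral_adjacent_intervals fun i _ => hwf _ _,
    Fin.sum_univ_eq_sum_range (fun i => f (τ (i + 1))) N, Finset.smul_sum,
    ← Finset.sum_sub_distrib]
  have hi : ∀ i ∈ Finset.range N,
      ‖(∫ t in (τ i)..(τ (i + 1)), w t • f t) - μ • f (τ (i + 1))‖ ≤
        L * μ * (τ (i + 1) - τ i) := by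
    intro i hi
    have hiN := Finset.mem_range.1 hi
    have hle := hmono i hiN
    rw [← hmass i hiN, ← intervalIntegral.integral_smul_const,
      ← intervalIntegral.integral_sub (hwf _ _) ((hint _ _).smul_continuousOn continuousOn_const)]
    have hb : ∀ t ∈ Set.Ioc (τ i) (τ (i + 1)),
        ‖w t • f t - w t • f (τ (i + 1))‖ ≤ L * (τ (i + 1) - τ i) * w t := by
      intro t ht
      rw [← smul_sub, norm_smul, Real.norm_of_nonneg (hw t), mul_comm]
      refine mul_le_mul_of_nonneg_right ((hf _ _).trans ?_) (hw t)
      gcongr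
      rw [abs_sub_comm, abs_of_nonneg (by linarith [ht.2])]
      linarith [ht.1]
    refine (intervalIntegral.norm_integral_le_of_norm_le hle
      (Filter.Eventually.of_forall hb) ((hint _ _).const_mul _)).trans (le_of_eq ?_)
    rw [intervalIntegral.integral_const_mul]
    ring
  refine (norm_sum_le_of_le _ hi).trans (le_of_eq ?_)
  rw [← Finset.mul_sum, Finset.sum_range_sub]
  ring

/-- The curve `θ ↦ (cos kθ, sin kθ)`, `1 ≤ k ≤ n`, in `ℝ ^ (2n)`. -/
def trigCurve (n : ℕ) (θ : ℝ) : EuclideanSpace ℝ (Fin n ⊕ Fin n) :=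
  WithLp.toLp 2 (Sum.elim (fun k => Real.cos (((k : ℕ) + 1 : ℝ) * θ))
    (fun k => Real.sin (((k : ℕ) + 1 : ℝ) * θ)))

/-- The derivative of `trigCurve`. -/
def trigCurveDeriv (n : ℕ) (θ : ℝ) : EuclideanSpace ℝ (Fin n ⊕ Fin n) :=
  WithLp.toLp 2 (Sum.elim (fun k => -(((k : ℕ) + 1 : ℝ) * Real.sin (((k : ℕ) + 1 : ℝ) * θ)))
    (fun k => ((k : ℕ) + 1 : ℝ) * Real.cos (((k : ℕ) + 1 : ℝ) * θ)))

theorem hasDerivAt_trigCurve (n : ℕ) (θ : ℝ) :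
    HasDerivAt (trigCurve n) (trigCurveDeriv n θ) θ := by
  have h : HasDerivAt (fun θ : ℝ => (Sum.elim (fun k => Real.cos (((k : ℕ) + 1 : ℝ) * θ))
      (fun k => Real.sin (((k : ℕ) + 1 : ℝ) * θ)) : Fin n ⊕ Fin n → ℝ))
      (WithLp.ofLp (trigCurveDeriv n θ)) θ := by
    rw [hasDerivAt_pi]
    have hm : ∀ c : ℝ, HasDerivAt (fun θ : ℝ => c * θ) c θ := fun c => by
      simpa using (hasDerivAt_id θ).const_mul c
    rintro (k | k)
    · have := (Real.hasDerivAt_cos _).comp θ (hm ((k : ℕ) + 1))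
      convert! this using 1
      simp [trigCurveDeriv]
      ring
    · have := (Real.hasDerivAt_sin _).comp θ (hm ((k : ℕ) + 1))
      convert! this using 1
      simp [trigCurveDeriv]
      ring
  exact (PiLp.hasFDerivAt_toLp 2 _).comp_hasDerivAt θ h

theorem norm_le_of_forall_abs_le {n : ℕ} (x : EuclideanSpace ℝ (Fin n ⊕ Fin n)) {c : ℝ}
    (hc : 0 ≤ c) (hx : ∀ i, |x i| ≤ c) : ‖x‖ ≤ 2 * n * c := by
  have h1 : ‖x‖ ^ 2 ≤ (2 * n) * c ^ 2 := by
    rw [EuclideanSpace.real_norm_sq_eq]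
    calc ∑ i, x i ^ 2 ≤ ∑ _i : Fin n ⊕ Fin n, c ^ 2 :=
          Finset.sum_le_sum fun i _ => sq_le_sq' (abs_le.1 (hx i)).1 (abs_le.1 (hx i)).2
      _ = (2 * n) * c ^ 2 := by
        rw [Finset.sum_const, Finset.card_univ, Fintype.card_sum, Fintype.card_fin, nsmul_eq_mul]
        push_cast
        ring
  rcases Nat.eq_zero_or_pos n with rfl | hn
  · simp at h1
    simp [h1]
  have hn' : (1 : ℝ) ≤ n := by exact_mod_cast hn
  refine abs_le_of_sq_le_sq' (h1.trans ?_) (by positivity) |>.2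
  rw [mul_pow]
  have : (2 * n : ℝ) ≤ (2 * n) ^ 2 := by nlinarith
  exact mul_le_mul_of_nonneg_right this (sq_nonneg c)

theorem fin_cast_add_one_le {n : ℕ} (k : Fin n) : ((k : ℕ) + 1 : ℝ) ≤ n := by
  exact_mod_cast k.2

theorem norm_trigCurveDeriv_le {n : ℕ} (hn : 1 ≤ n) (θ : ℝ) :
    ‖trigCurveDeriv n θ‖ ≤ 2 * (n : ℝ) ^ 3 := by
  have hn' : (1 : ℝ) ≤ n := by exact_mod_cast hn
  refine (norm_le_of_forall_abs_le _ (c := n) (by positivity) ?_).trans ?_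
  · rintro (k | k)
    · simp only [trigCurveDeriv, Sum.elim_inl, abs_neg, abs_mul]
      rw [abs_of_nonneg (by positivity : (0 : ℝ) ≤ (k : ℕ) + 1)]
      exact (mul_le_of_le_one_right (by positivity) (Real.abs_sin_le_one _)).trans
        (fin_cast_add_one_le k)
    · simp only [trigCurveDeriv, Sum.elim_inr, abs_mul]
      rw [abs_of_nonneg (by positivity : (0 : ℝ) ≤ (k : ℕ) + 1)]
      exact (mul_le_of_le_one_right (by positivity) (Real.abs_cos_le_one _)).trans
        (fin_cast_add_one_le k)
  · nlinarith [pow_nonneg (by linarith : (0 : ℝ) ≤ n) 2]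

theorem norm_trigCurveDeriv_sub_le {n : ℕ} (s t : ℝ) :
    ‖trigCurveDeriv n s - trigCurveDeriv n t‖ ≤ 2 * (n : ℝ) ^ 3 * |s - t| := by
  refine (norm_le_of_forall_abs_le _ (c := (n : ℝ) ^ 2 * |s - t|) (by positivity) ?_).trans
    (le_of_eq (by ring))
  have key : ∀ (k : Fin n) (f : ℝ → ℝ), (∀ x y, |f x - f y| ≤ |x - y|) →
      |((k : ℕ) + 1 : ℝ) * f (((k : ℕ) + 1 : ℝ) * s) -
        ((k : ℕ) + 1 : ℝ) * f (((k : ℕ) + 1 : ℝ) * t)| ≤ (n : ℝ) ^ 2 * |s - t| := by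
    intro k f hf
    have hk := fin_cast_add_one_le k
    have hk0 : (0 : ℝ) ≤ (k : ℕ) + 1 := by positivity
    rw [← mul_sub, abs_mul, abs_of_nonneg hk0]
    calc ((k : ℕ) + 1 : ℝ) * |f (((k : ℕ) + 1 : ℝ) * s) - f (((k : ℕ) + 1 : ℝ) * t)|
        ≤ ((k : ℕ) + 1 : ℝ) * |((k : ℕ) + 1 : ℝ) * s - ((k : ℕ) + 1 : ℝ) * t| := by
          exact mul_le_mul_of_nonneg_left (hf _ _) hk0
      _ = ((k : ℕ) + 1 : ℝ) ^ 2 * |s - t| := by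
          rw [← mul_sub, abs_mul, abs_of_nonneg hk0]; ring
      _ ≤ (n : ℝ) ^ 2 * |s - t| := by gcongr
  rintro (k | k)
  · have := key k Real.sin fun x y => Real.abs_sin_sub_sin_le x y
    rw [abs_sub_comm] at this
    convert this using 2
    simp [trigCurveDeriv]
    ring
  · have := key k Real.cos fun x y => Real.abs_cos_sub_cos_le x y
    convert this using 2
    simp [trigCurveDeriv]

/-- The trigonometric polynomial without constant term whose primitive has coefficients `x`. -/
theorem inner_trigCurveDeriv {n : ℕ} (x : EuclideanSpace ℝ (Fin n ⊕ Fin n)) (θ : ℝ) :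
    inner ℝ (trigCurveDeriv n θ) x =
      ∑ k : Fin n, (((k : ℕ) + 1 : ℝ) * Real.cos (((k : ℕ) + 1 : ℝ) * θ) * x (Sum.inr k) -
        ((k : ℕ) + 1 : ℝ) * Real.sin (((k : ℕ) + 1 : ℝ) * θ) * x (Sum.inl k)) := by
  rw [PiLp.inner_apply, Fintype.sum_sum_type, ← Finset.sum_add_distrib]
  refine Finset.sum_congr rfl fun k _ => ?_
  simp [trigCurveDeriv]
  ring

theorem periodic_inner_trigCurveDeriv {n : ℕ} (x : EuclideanSpace ℝ (Fin n ⊕ Fin n)) :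
    Function.Periodic (fun θ => inner ℝ (trigCurveDeriv n θ) x) (2 * π) := by
  intro θ
  simp only [inner_trigCurveDeriv]
  refine Finset.sum_congr rfl fun k _ => ?_
  have : ((k : ℕ) + 1 : ℝ) * (θ + 2 * π) =
      ((k : ℕ) + 1 : ℝ) * θ + ((k + 1 : ℕ) : ℝ) * (2 * π) := by push_cast; ring
  rw [this, Real.cos_add_nat_mul_two_pi, Real.sin_add_nat_mul_two_pi]

theorem abs_inner_trigCurveDeriv_le {n : ℕ} (x : EuclideanSpace ℝ (Fin n ⊕ Fin n)) {D B : ℝ}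
    (h0 : 0 ≤ D) (h1 : D ≤ 1) (hB : 0 < B)
    (h : ∀ θ, D ≤ θ → θ ≤ 2 * π - D → |inner ℝ (trigCurveDeriv n θ) x| ≤ B) (θ : ℝ) :
    |inner ℝ (trigCurveDeriv n θ) x| ≤ B * Real.exp (n * (4 * D)) := by
  have hper := periodic_inner_trigCurveDeriv x
  obtain ⟨y, ⟨hy1, hy2⟩, hy⟩ := hper.exists_mem_Ico Real.two_pi_pos θ (-D)
  rw [hy]
  rcases le_or_gt D y with hDy | hDy
  · refine (h y hDy (by linarith)).trans (le_mul_of_one_le_right hB.le ?_)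
    exact Real.one_le_exp (by positivity)
  set P : Polynomial ℝ := ∑ k : Fin n, Polynomial.C
    (((k : ℕ) + 1 : ℝ) * Real.cos (((k : ℕ) + 1 : ℝ) * y) * x (Sum.inr k) -
      ((k : ℕ) + 1 : ℝ) * Real.sin (((k : ℕ) + 1 : ℝ) * y) * x (Sum.inl k)) *
    Polynomial.Chebyshev.T ℝ ((k : ℕ) + 1 : ℕ) with hP
  have hdeg : P.natDegree ≤ n := by
    refine Polynomial.natDegree_sum_le_of_forall_le _ _ fun k _ => ?_
    refine (Polynomial.natDegree_C_mul_le _ _).trans ?_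
    have : (Polynomial.Chebyshev.T ℝ ((k : ℕ) + 1 : ℕ)).natDegree = (k : ℕ) + 1 := by
      simp
      omega
    rw [this]
    exact k.2
  have heval : ∀ u, P.eval (Real.cos u) = (inner ℝ (trigCurveDeriv n (y + u)) x +
      inner ℝ (trigCurveDeriv n (y - u)) x) / 2 := by
    intro u
    rw [inner_trigCurveDeriv, inner_trigCurveDeriv, ← Finset.sum_add_distrib, Finset.sum_div, hP,
      Polynomial.eval_finsetSum]
    refine Finset.sum_congr rfl fun k _ => ?_
    rw [Polynomial.eval_mul, Polynomial.eval_C, Polynomial.Chebyshev.T_real_cos]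
    push_cast
    rw [mul_add, mul_sub, Real.cos_add, Real.cos_sub, Real.sin_add, Real.sin_sub]
    ring
  have hbound : ∀ u, 2 * D ≤ u → u ≤ π → |P.eval (Real.cos u)| ≤ B := by
    intro u hu hu'
    have hpi := Real.pi_gt_three
    have e1 := h (y + u) (by linarith) (by linarith)
    have e2 := h (y - u + 2 * π) (by linarith) (by linarith)
    have e3 := hper (y - u)
    beta_reduce at e3
    rw [e3] at e2
    rw [heval, abs_div, abs_two, div_le_iff₀ two_pos]
    exact (abs_add_le _ _).trans (by linarith)
  have := abs_eval_one_le_of_abs_eval_cos_le hdeg h0 h1 hB hbound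
  have e := heval 0
  rw [Real.cos_zero, add_zero, sub_zero, add_self_div_two] at e
  rwa [e] at this

theorem integral_cos_int_mul {m : ℤ} (hm : m ≠ 0) : ∫ θ in (-π)..π, Real.cos (m * θ) = 0 := by
  have hm' : (m : ℝ) ≠ 0 := by exact_mod_cast hm
  rw [intervalIntegral.integral_comp_mul_left (fun t => Real.cos t) hm', integral_cos, mul_neg,
    Real.sin_neg, Real.sin_int_mul_pi]
  simp

theorem integral_sin_int_mul (m : ℤ) : ∫ θ in (-π)..π, Real.sin (m * θ) = 0 := by
  rcases eq_or_ne m 0 with rfl | hm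
  · simp
  have hm' : (m : ℝ) ≠ 0 := by exact_mod_cast hm
  rw [intervalIntegral.integral_comp_mul_left (fun t => Real.sin t) hm', integral_sin, mul_neg,
    Real.cos_neg]
  simp

theorem integral_cos_mul_cos (j k : ℕ) :
    ∫ θ in (-π)..π, Real.cos ((j + 1 : ℝ) * θ) * Real.cos ((k + 1 : ℝ) * θ) =
      if j = k then π else 0 := by
  have h : ∀ θ : ℝ, Real.cos ((j + 1 : ℝ) * θ) * Real.cos ((k + 1 : ℝ) * θ) =
      (1 / 2) * (Real.cos (((j - k : ℤ) : ℝ) * θ) + Real.cos (((j + k + 2 : ℤ) : ℝ) * θ)) := by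
    intro θ
    have e1 : ((j - k : ℤ) : ℝ) * θ = (j + 1 : ℝ) * θ - (k + 1 : ℝ) * θ := by push_cast; ring
    have e2 : ((j + k + 2 : ℤ) : ℝ) * θ = (j + 1 : ℝ) * θ + (k + 1 : ℝ) * θ := by
      push_cast; ring
    rw [e1, e2, Real.cos_sub, Real.cos_add]
    ring
  simp only [h]
  rw [intervalIntegral.integral_const_mul, intervalIntegral.integral_add
    (Continuous.intervalIntegrable (by fun_prop) _ _)
    (Continuous.intervalIntegrable (by fun_prop) _ _),
    integral_cos_int_mul (m := j + k + 2) (by omega)]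
  split_ifs with hjk
  · subst hjk
    simp
    ring
  · rw [integral_cos_int_mul (by omega)]
    simp

theorem integral_sin_mul_sin (j k : ℕ) :
    ∫ θ in (-π)..π, Real.sin ((j + 1 : ℝ) * θ) * Real.sin ((k + 1 : ℝ) * θ) =
      if j = k then π else 0 := by
  have h : ∀ θ : ℝ, Real.sin ((j + 1 : ℝ) * θ) * Real.sin ((k + 1 : ℝ) * θ) =
      (1 / 2) * (Real.cos (((j - k : ℤ) : ℝ) * θ) - Real.cos (((j + k + 2 : ℤ) : ℝ) * θ)) := by
    intro θ
    have e1 : ((j - k : ℤ) : ℝ) * θ = (j + 1 : ℝ) * θ - (k + 1 : ℝ) * θ := by push_cast; ring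
    have e2 : ((j + k + 2 : ℤ) : ℝ) * θ = (j + 1 : ℝ) * θ + (k + 1 : ℝ) * θ := by
      push_cast; ring
    rw [e1, e2, Real.cos_sub, Real.cos_add]
    ring
  simp only [h]
  rw [intervalIntegral.integral_const_mul, intervalIntegral.integral_sub
    (Continuous.intervalIntegrable (by fun_prop) _ _)
    (Continuous.intervalIntegrable (by fun_prop) _ _),
    integral_cos_int_mul (m := j + k + 2) (by omega)]
  split_ifs with hjk
  · subst hjk
    simp
    ring
  · rw [integral_cos_int_mul (by omega)]
    simp

theorem integral_sin_mul_cos (j k : ℕ) :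
    ∫ θ in (-π)..π, Real.sin ((j + 1 : ℝ) * θ) * Real.cos ((k + 1 : ℝ) * θ) = 0 := by
  have h : ∀ θ : ℝ, Real.sin ((j + 1 : ℝ) * θ) * Real.cos ((k + 1 : ℝ) * θ) =
      (1 / 2) * (Real.sin (((j - k : ℤ) : ℝ) * θ) + Real.sin (((j + k + 2 : ℤ) : ℝ) * θ)) := by
    intro θ
    have e1 : ((j - k : ℤ) : ℝ) * θ = (j + 1 : ℝ) * θ - (k + 1 : ℝ) * θ := by push_cast; ring
    have e2 : ((j + k + 2 : ℤ) : ℝ) * θ = (j + 1 : ℝ) * θ + (k + 1 : ℝ) * θ := by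
      push_cast; ring
    rw [e1, e2, Real.sin_sub, Real.sin_add]
    ring
  simp only [h]
  rw [intervalIntegral.integral_const_mul, intervalIntegral.integral_add
    (Continuous.intervalIntegrable (by fun_prop) _ _)
    (Continuous.intervalIntegrable (by fun_prop) _ _),
    integral_sin_int_mul, integral_sin_int_mul]
  simp

theorem continuous_trigCurveDeriv (n : ℕ) : Continuous (trigCurveDeriv n) := by
  refine (PiLp.continuous_toLp 2 _).comp (continuous_pi ?_)
  rintro (k | k)
  · simp only [Sum.elim_inl]; fun_prop
  · simp only [Sum.elim_inr]; fun_prop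

theorem continuous_trigCurveDeriv_apply (n : ℕ) (i : Fin n ⊕ Fin n) :
    Continuous fun θ => trigCurveDeriv n θ i :=
  (PiLp.continuous_apply 2 _ i).comp (continuous_trigCurveDeriv n)

theorem integral_trigCurveDeriv_mul {n : ℕ} (i j : Fin n ⊕ Fin n) :
    ∫ θ in (-π)..π, trigCurveDeriv n θ i * trigCurveDeriv n θ j =
      if i = j then π * (Sum.elim (fun k : Fin n => (k : ℕ) + 1 : Fin n → ℝ)
        (fun k : Fin n => (k : ℕ) + 1) i) ^ 2 else 0 := by
  rcases i with i | i <;> rcases j with j | j <;>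
    simp only [trigCurveDeriv, Sum.elim_inl, Sum.elim_inr, Sum.inl.injEq, Sum.inr.injEq, reduceCtorEq, if_false]
  · have e : ∀ θ : ℝ, -(((i : ℕ) + 1 : ℝ) * Real.sin (((i : ℕ) + 1 : ℝ) * θ)) *
        -(((j : ℕ) + 1 : ℝ) * Real.sin (((j : ℕ) + 1 : ℝ) * θ)) =
        (((i : ℕ) + 1 : ℝ) * ((j : ℕ) + 1 : ℝ)) * (Real.sin (((i : ℕ) + 1 : ℝ) * θ) *
          Real.sin (((j : ℕ) + 1 : ℝ) * θ)) := fun θ => by ring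
    simp only [e]
    rw [intervalIntegral.integral_const_mul, integral_sin_mul_sin]
    by_cases h : i = j
    · subst h; simp; ring
    · simp [h, Fin.val_inj]
  · have e : ∀ θ : ℝ, -(((i : ℕ) + 1 : ℝ) * Real.sin (((i : ℕ) + 1 : ℝ) * θ)) *
        (((j : ℕ) + 1 : ℝ) * Real.cos (((j : ℕ) + 1 : ℝ) * θ)) =
        (-(((i : ℕ) + 1 : ℝ) * ((j : ℕ) + 1 : ℝ))) * (Real.sin (((i : ℕ) + 1 : ℝ) * θ) *
          Real.cos (((j : ℕ) + 1 : ℝ) * θ)) := fun θ => by ring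
    simp only [e]
    rw [intervalIntegral.integral_const_mul, integral_sin_mul_cos, mul_zero]
  · have e : ∀ θ : ℝ, (((i : ℕ) + 1 : ℝ) * Real.cos (((i : ℕ) + 1 : ℝ) * θ)) *
        -(((j : ℕ) + 1 : ℝ) * Real.sin (((j : ℕ) + 1 : ℝ) * θ)) =
        (-(((i : ℕ) + 1 : ℝ) * ((j : ℕ) + 1 : ℝ))) * (Real.sin (((j : ℕ) + 1 : ℝ) * θ) *
          Real.cos (((i : ℕ) + 1 : ℝ) * θ)) := fun θ => by ring
    simp only [e]
    rw [intervalIntegral.integral_const_mul, integral_sin_mul_cos, mul_zero]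
  · have e : ∀ θ : ℝ, (((i : ℕ) + 1 : ℝ) * Real.cos (((i : ℕ) + 1 : ℝ) * θ)) *
        (((j : ℕ) + 1 : ℝ) * Real.cos (((j : ℕ) + 1 : ℝ) * θ)) =
        (((i : ℕ) + 1 : ℝ) * ((j : ℕ) + 1 : ℝ)) * (Real.cos (((i : ℕ) + 1 : ℝ) * θ) *
          Real.cos (((j : ℕ) + 1 : ℝ) * θ)) := fun θ => by ring
    simp only [e]
    rw [intervalIntegral.integral_const_mul, integral_cos_mul_cos]
    by_cases h : i = j
    · subst h; simp; ring
    · simp [h, Fin.val_inj]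

theorem pi_mul_norm_sq_le_integral {n : ℕ} (x : EuclideanSpace ℝ (Fin n ⊕ Fin n)) :
    π * ‖x‖ ^ 2 ≤ ∫ θ in (-π)..π, (inner ℝ (trigCurveDeriv n θ) x) ^ 2 := by
  have e : ∀ θ, (inner ℝ (trigCurveDeriv n θ) x) ^ 2 =
      ∑ i, ∑ j, (x i * x j) * (trigCurveDeriv n θ i * trigCurveDeriv n θ j) := by
    intro θ
    rw [PiLp.inner_apply, sq, Finset.sum_mul_sum]
    refine Finset.sum_congr rfl fun i _ => Finset.sum_congr rfl fun j _ => ?_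
    simp
    ring
  have hc := continuous_trigCurveDeriv_apply n
  simp only [e]
  rw [intervalIntegral.integral_finsetSum
    fun i _ => Continuous.intervalIntegrable (by fun_prop) _ _]
  have e2 : ∀ i, ∫ θ in (-π)..π, ∑ j, (x i * x j) *
      (trigCurveDeriv n θ i * trigCurveDeriv n θ j) =
      (x i * x i) * (π * (Sum.elim (fun k : Fin n => (k : ℕ) + 1 : Fin n → ℝ)
        (fun k : Fin n => (k : ℕ) + 1) i) ^ 2) := by
    intro i
    rw [intervalIntegral.integral_finsetSum
      fun j _ => Continuous.intervalIntegrable (by fun_prop) _ _]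
    simp only [intervalIntegral.integral_const_mul, integral_trigCurveDeriv_mul]
    simp
  rw [Finset.sum_congr rfl fun i _ => e2 i, EuclideanSpace.real_norm_sq_eq, Finset.mul_sum]
  refine Finset.sum_le_sum fun i _ => ?_
  have h1 : (1 : ℝ) ≤ (Sum.elim (fun k : Fin n => (k : ℕ) + 1 : Fin n → ℝ)
        (fun k : Fin n => (k : ℕ) + 1) i) ^ 2 := by
    apply one_le_pow₀
    rcases i with i | i <;> simp
  have h2 : 0 ≤ π * (x i) ^ 2 := by positivity
  nlinarith [mul_le_mul_of_nonneg_left h1 h2]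

theorem exists_le_abs_inner_trigCurveDeriv {n : ℕ} {x : EuclideanSpace ℝ (Fin n ⊕ Fin n)}
    (hx : x ≠ 0) {D : ℝ} (h0 : 0 ≤ D) (h1 : D ≤ 1) :
    ∃ θ, D ≤ |θ| ∧ |θ| ≤ π ∧
      ‖x‖ * Real.exp (-(n * (4 * D))) / 2 ≤ |inner ℝ (trigCurveDeriv n θ) x| := by
  have hx' : 0 < ‖x‖ := norm_pos_iff.2 hx
  have hpi := Real.pi_gt_three
  set B := ‖x‖ * Real.exp (-(n * (4 * D))) / 2 with hB
  have hB0 : 0 < B := by positivity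
  obtain ⟨θ, hθ1, hθ2, hθ⟩ : ∃ θ, D ≤ θ ∧ θ ≤ 2 * π - D ∧
      B ≤ |inner ℝ (trigCurveDeriv n θ) x| := by
    by_contra! hcon
    have hall := abs_inner_trigCurveDeriv_le x h0 h1 hB0
      fun θ ha hb => (hcon θ ha hb).le
    have hBe : B * Real.exp (n * (4 * D)) = ‖x‖ / 2 := by
      rw [hB, div_mul_eq_mul_div, mul_assoc, ← Real.exp_add, neg_add_cancel, Real.exp_zero,
        mul_one]
    rw [hBe] at hall
    have h2 := pi_mul_norm_sq_le_integral x
    have h3 : ∫ θ in (-π)..π, (inner ℝ (trigCurveDeriv n θ) x) ^ 2 ≤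
        ∫ _θ in (-π)..π, (‖x‖ / 2) ^ 2 := by
      refine intervalIntegral.integral_mono_on (by linarith) ?_
        (continuous_const.intervalIntegrable _ _) fun θ _ =>
          sq_le_sq' (abs_le.1 (hall θ)).1 (abs_le.1 (hall θ)).2
      have := continuous_trigCurveDeriv n
      exact Continuous.intervalIntegrable (by fun_prop) _ _
    rw [intervalIntegral.integral_const, smul_eq_mul] at h3
    have : 0 < π * ‖x‖ ^ 2 := by positivity
    nlinarith
  rcases le_or_gt θ π with h | h
  · exact ⟨θ, by rwa [abs_of_nonneg (h0.trans hθ1)], by rwa [abs_of_nonneg (h0.trans hθ1)], hθ⟩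
  · have hneg : θ - 2 * π ≤ 0 := by linarith
    refine ⟨θ - 2 * π, by rw [abs_of_nonpos hneg]; linarith,
      by rw [abs_of_nonpos hneg]; linarith, ?_⟩
    have := (periodic_inner_trigCurveDeriv x).sub_eq θ
    beta_reduce at this
    rwa [this]

theorem le_integral_mul_inner_sq {n : ℕ} (hn : 1 ≤ n) {w : ℝ → ℝ} (hw : ∀ t, 0 ≤ w t)
    (hint : ∀ s t, IntervalIntegrable w volume s t) {D v : ℝ} (h0 : 0 ≤ D) (h1 : D ≤ 1)
    (hwv : ∀ t, D ≤ |t| → v ≤ w t) (x : EuclideanSpace ℝ (Fin n ⊕ Fin n)) :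
    v * Real.exp (-(12 * (n * D))) / (128 * (n : ℝ) ^ 3) * ‖x‖ ^ 2 ≤
      ∫ θ in (-π)..π, w θ * (inner ℝ (trigCurveDeriv n θ) x) ^ 2 := by
  rcases eq_or_ne x 0 with rfl | hx
  · simp
  have hx' : 0 < ‖x‖ := norm_pos_iff.2 hx
  have hpi := Real.pi_gt_three
  have hn' : (1 : ℝ) ≤ n := by exact_mod_cast hn
  obtain ⟨θ, hθ1, hθ2, hθ⟩ := exists_le_abs_inner_trigCurveDeriv hx h0 h1
  set ε := Real.exp (-(n * (4 * D))) with hε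
  have hε0 : 0 < ε := Real.exp_pos _
  have hε1 : ε ≤ 1 := Real.exp_le_one_iff.2 (neg_nonpos.2 (by positivity))
  set h := ε / (8 * (n : ℝ) ^ 3) with hh
  have hhpos : 0 < h := by positivity
  have hh1 : h ≤ 1 := by
    rw [hh, div_le_one (by positivity)]
    have : 1 ≤ (n : ℝ) ^ 3 := one_le_pow₀ hn'
    linarith
  obtain ⟨a, ha1, ha2, ha3, ha4⟩ : ∃ a, -π ≤ a ∧ a + h ≤ π ∧
      (∀ t ∈ Set.Icc a (a + h), D ≤ |t|) ∧ (∀ t ∈ Set.Icc a (a + h), |t - θ| ≤ h) := by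
    rcases le_or_gt 0 θ with hs | hs
    · rw [abs_of_nonneg hs] at hθ1 hθ2
      rcases le_or_gt (θ + h) π with hr | hr
      · exact ⟨θ, by linarith, hr, fun t ht => (hθ1.trans ht.1).trans (le_abs_self t),
          fun t ht => abs_le.2 ⟨by linarith [ht.1], by linarith [ht.2]⟩⟩
      · exact ⟨θ - h, by linarith, by linarith,
          fun t ht => le_trans (by linarith [ht.1]) (le_abs_self t),
          fun t ht => abs_le.2 ⟨by linarith [ht.1], by linarith [ht.2]⟩⟩
    · rw [abs_of_neg hs] at hθ1 hθ2
      rcases le_or_gt (-π) (θ - h) with hr | hr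
      · exact ⟨θ - h, by linarith, by linarith,
          fun t ht => le_trans (by linarith [ht.2]) (neg_le_abs t),
          fun t ht => abs_le.2 ⟨by linarith [ht.1], by linarith [ht.2]⟩⟩
      · exact ⟨θ, by linarith, by linarith,
          fun t ht => le_trans (by linarith [ht.2]) (neg_le_abs t),
          fun t ht => abs_le.2 ⟨by linarith [ht.1], by linarith [ht.2]⟩⟩
  have hcont := continuous_trigCurveDeriv n
  have hlow : ∀ t ∈ Set.Icc a (a + h), v * (‖x‖ * ε / 4) ^ 2 ≤
      w t * (inner ℝ (trigCurveDeriv n t) x) ^ 2 := by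
    intro t ht
    have h2 : |inner ℝ (trigCurveDeriv n t) x - inner ℝ (trigCurveDeriv n θ) x| ≤
        ‖x‖ * ε / 4 := by
      rw [← inner_sub_left]
      refine (abs_real_inner_le_norm _ _).trans ?_
      calc ‖trigCurveDeriv n t - trigCurveDeriv n θ‖ * ‖x‖
          ≤ (2 * (n : ℝ) ^ 3 * h) * ‖x‖ := by
            gcongr
            exact (norm_trigCurveDeriv_sub_le t θ).trans (by gcongr; exact ha4 t ht)
        _ = ‖x‖ * ε / 4 := by rw [hh]; field_simp; ring
    have h3 : ‖x‖ * ε / 4 ≤ |inner ℝ (trigCurveDeriv n t) x| := by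
      have := abs_sub_abs_le_abs_sub (inner ℝ (trigCurveDeriv n θ) x)
        (inner ℝ (trigCurveDeriv n t) x)
      rw [abs_sub_comm] at this
      linarith
    rw [← sq_abs (inner ℝ (trigCurveDeriv n t) x)]
    exact mul_le_mul (hwv t (ha3 t ht)) (pow_le_pow_left₀ (by positivity) h3 2)
      (by positivity) (hw t)
  have hI : ∀ s t, IntervalIntegrable
      (fun θ => w θ * (inner ℝ (trigCurveDeriv n θ) x) ^ 2) volume s t := fun s t =>
    (hint s t).mul_continuousOn (Continuous.continuousOn (by fun_prop))
  calc v * Real.exp (-(12 * (n * D))) / (128 * (n : ℝ) ^ 3) * ‖x‖ ^ 2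
      = ∫ _t in a..(a + h), v * (‖x‖ * ε / 4) ^ 2 := by
        rw [intervalIntegral.integral_const, smul_eq_mul]
        have : Real.exp (-(12 * (n * D))) = ε ^ 3 := by
          rw [hε, ← Real.exp_nat_mul]
          congr 1
          push_cast
          ring
        rw [this, hh]
        field_simp
        ring
    _ ≤ ∫ t in a..(a + h), w t * (inner ℝ (trigCurveDeriv n t) x) ^ 2 :=
        intervalIntegral.integral_mono_on (by linarith)
          (continuous_const.intervalIntegrable _ _) (hI _ _) hlow
    _ ≤ ∫ θ in (-π)..π, w θ * (inner ℝ (trigCurveDeriv n θ) x) ^ 2 :=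
        intervalIntegral.integral_mono_interval ha1 (by linarith) ha2
          (Filter.Eventually.of_forall fun t => mul_nonneg (hw t) (sq_nonneg _)) (hI _ _)

/-- The weight `exp (-|θ| ^ (-α))`, with value `0` at `θ = 0`. -/
def stretchedExp (α θ : ℝ) : ℝ :=
  if θ = 0 then 0 else Real.exp (-(|θ| ^ (-α)))

theorem stretchedExp_nonneg (α θ : ℝ) : 0 ≤ stretchedExp α θ := by
  unfold stretchedExp
  split_ifs
  · exact le_rfl
  · positivity

theorem stretchedExp_le_one (α θ : ℝ) : stretchedExp α θ ≤ 1 := by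
  unfold stretchedExp
  split_ifs
  · exact zero_le_one
  · rw [Real.exp_le_one_iff, neg_nonpos]
    positivity

theorem measurable_stretchedExp (α : ℝ) : Measurable (stretchedExp α) := by
  refine Measurable.ite (measurableSet_singleton 0) measurable_const ?_
  exact Real.measurable_exp.comp ((measurable_norm.pow_const (-α)).neg)

theorem intervalIntegrable_stretchedExp (α a b : ℝ) :
    IntervalIntegrable (stretchedExp α) volume a b := by
  refine (intervalIntegrable_const (c := (1 : ℝ))).mono_fun
    (measurable_stretchedExp α).aestronglyMeasurable (ae_of_all _ fun t => ?_)
  simpa [abs_of_nonneg (stretchedExp_nonneg α t)] using stretchedExp_le_one α t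

theorem le_stretchedExp {α δ θ : ℝ} (hα : 0 ≤ α) (hδ : 0 < δ) (hθ : δ ≤ |θ|) :
    Real.exp (-(δ ^ (-α))) ≤ stretchedExp α θ := by
  have hθ0 : θ ≠ 0 := abs_pos.1 (hδ.trans_le hθ)
  rw [stretchedExp, if_neg hθ0, Real.exp_le_exp, neg_le_neg_iff]
  exact Real.rpow_le_rpow_of_nonpos hδ hθ (by linarith)

theorem stretchedExp_le {α δ θ : ℝ} (hα : 0 ≤ α) (hθ : |θ| ≤ δ) :
    stretchedExp α θ ≤ Real.exp (-(δ ^ (-α))) := by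
  rcases eq_or_ne θ 0 with rfl | hθ0
  · simp only [stretchedExp, if_true]
    positivity
  rw [stretchedExp, if_neg hθ0, Real.exp_le_exp, neg_le_neg_iff]
  exact Real.rpow_le_rpow_of_nonpos (abs_pos.2 hθ0) hθ (by linarith)

theorem integral_stretchedExp_le (α : ℝ) : ∫ θ in (-π)..π, stretchedExp α θ ≤ 2 * π := by
  have := intervalIntegral.integral_mono_on (by linarith [Real.pi_pos])
    (intervalIntegrable_stretchedExp α (-π) π) (intervalIntegrable_const (c := (1 : ℝ)))
    fun t _ => stretchedExp_le_one α t
  simpa [two_mul] using this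

theorem stretchedExp_pos {α θ : ℝ} (hθ : θ ≠ 0) : 0 < stretchedExp α θ := by
  rw [stretchedExp, if_neg hθ]
  positivity

theorem integral_mul_stretchedExp_pos {α : ℝ} {f : ℝ → ℝ} (hf : Continuous f)
    (h0 : ∀ θ, 0 ≤ f θ) (hne : ∀ᵐ θ ∂volume, f θ ≠ 0) :
    0 < ∫ θ in (-π)..π, f θ * stretchedExp α θ := by
  have hpi := Real.pi_pos
  have hlt : -π < π := by linarith
  refine intervalIntegral.integral_pos_iff_support_of_nonneg_ae
    (ae_of_all _ fun t => mul_nonneg (h0 t) (stretchedExp_nonneg α t))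
    ((intervalIntegrable_stretchedExp α _ _).continuousOn_mul hf.continuousOn) |>.2 ⟨hlt, ?_⟩
  have hae : volume (Function.support fun θ => f θ * stretchedExp α θ)ᶜ = 0 := by
    rw [← mem_ae_iff]
    filter_upwards [hne, Measure.ae_ne volume (0 : ℝ)] with θ h1 h2
    exact mul_ne_zero h1 (stretchedExp_pos h2).ne'
  rw [inter_comm, measure_inter_conull' (measure_mono_null (fun _ ht => ht.2) hae)]
  simpa using hlt

theorem integral_stretchedExp_pos (α : ℝ) : 0 < ∫ θ in (-π)..π, stretchedExp α θ := by
  simpa using integral_mul_stretchedExp_pos (α := α) (f := fun _ => 1) continuous_const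
    (fun _ => zero_le_one) (by simp)

theorem isTrigChebQuad_congr {W w : ℝ → ℝ} (h : ∀ θ ∈ Icc (-π) π, W θ = w θ) (n N : ℕ)
    (θs : Fin N → ℝ) : IsTrigChebQuad W n N θs ↔ IsTrigChebQuad w n N θs := by
  have hpi := Real.pi_pos
  have hu : uIcc (-π) π = Icc (-π) π := uIcc_of_le (by linarith)
  have h1 : ∀ p : ℝ → ℝ, ∫ θ in (-π)..π, p θ * W θ = ∫ θ in (-π)..π, p θ * w θ := fun p =>
    intervalIntegral.integral_congr fun t ht => by simp only [h t (hu ▸ ht)]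
  have h2 : ∫ θ in (-π)..π, W θ = ∫ θ in (-π)..π, w θ :=
    intervalIntegral.integral_congr fun t ht => h t (hu ▸ ht)
  simp only [IsTrigChebQuad, h1, h2]

theorem eq_stretchedExp_of_periodic {α : ℝ} {W : ℝ → ℝ} (hper : Function.Periodic W (2 * π))
    (hW : ∀ θ ∈ Ico (-π) π, W θ = if θ = 0 then 0 else Real.exp (-(|θ| ^ (-α)))) :
    ∀ θ ∈ Icc (-π) π, W θ = stretchedExp α θ := by
  have hpi := Real.pi_pos
  intro θ hθ
  rcases hθ.2.lt_or_eq with h | rfl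
  · exact hW θ ⟨hθ.1, h⟩
  · have h1 : W π = W (-π) := by
      rw [← hper (-π)]
      ring_nf
    rw [h1, hW (-π) ⟨le_rfl, by linarith⟩]
    simp [stretchedExp]

theorem isTrigChebQuad_comp_sort {w : ℝ → ℝ} {n N : ℕ} {y : Fin N → ℝ}
    (h : ∀ p : ℝ → ℝ, IsTrigPoly n p →
      (∫ θ in (-π)..π, p θ * w θ) = ((∫ θ in (-π)..π, w θ) / N) * ∑ i, p (y i)) :
    IsTrigChebQuad w n N (y ∘ Tuple.sort y) := by
  refine ⟨Tuple.monotone_sort y, fun p hp => ?_⟩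
  rw [h p hp]
  congr 1
  exact (Equiv.sum_comp (Tuple.sort y) fun i => p (y i)).symm

theorem integral_mul_eq_of_average_trigCurve {w : ℝ → ℝ}
    (hint : ∀ s t, IntervalIntegrable w volume s t) (hI : (∫ θ in (-π)..π, w θ) ≠ 0)
    {n N : ℕ} (hN : 0 < N) {y : Fin N → ℝ}
    (h : (1 / N : ℝ) • ∑ i, trigCurve n (y i) =
      (∫ θ in (-π)..π, w θ)⁻¹ • ∫ θ in (-π)..π, w θ • trigCurve n θ)
    {p : ℝ → ℝ} (hp : IsTrigPoly n p) :
    (∫ θ in (-π)..π, p θ * w θ) = ((∫ θ in (-π)..π, w θ) / N) * ∑ i, p (y i) := by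
  have hN' : (N : ℝ) ≠ 0 := by exact_mod_cast hN.ne'
  set I := ∫ θ in (-π)..π, w θ with hIdef
  have hcont : Continuous (trigCurve n) :=
    continuous_iff_continuousAt.2 fun t => (hasDerivAt_trigCurve n t).continuousAt
  have hcoord : ∀ j, (∫ θ in (-π)..π, w θ * trigCurve n θ j) =
      I / N * ∑ i, trigCurve n (y i) j := by
    intro j
    have h1 := congrArg (EuclideanSpace.proj (𝕜 := ℝ) j) h
    rw [map_smul, map_smul, map_sum, ← ContinuousLinearMap.intervalIntegral_comp_comm _
      ((hint _ _).smul_continuousOn hcont.continuousOn)] at h1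
    simp only [map_smul, PiLp.proj_apply, smul_eq_mul] at h1
    rw [div_eq_mul_one_div, mul_assoc, h1, mul_inv_cancel_left₀ hI]
  have hcos : ∀ k ∈ Finset.Icc 1 n, (∫ θ in (-π)..π, Real.cos (k * θ) * w θ) =
      I / N * ∑ i, Real.cos (k * y i) := by
    intro k hk
    obtain ⟨hk1, hk2⟩ := Finset.mem_Icc.1 hk
    have h1 := hcoord (Sum.inl ⟨k - 1, by omega⟩)
    have h2 : ((k - 1 : ℕ) : ℝ) + 1 = k := by rw [Nat.cast_sub hk1]; simp
    simp only [trigCurve, Sum.elim_inl, h2] at h1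
    simpa only [mul_comm (w _)] using h1
  have hsin : ∀ k ∈ Finset.Icc 1 n, (∫ θ in (-π)..π, Real.sin (k * θ) * w θ) =
      I / N * ∑ i, Real.sin (k * y i) := by
    intro k hk
    obtain ⟨hk1, hk2⟩ := Finset.mem_Icc.1 hk
    have h1 := hcoord (Sum.inr ⟨k - 1, by omega⟩)
    have h2 : ((k - 1 : ℕ) : ℝ) + 1 = k := by rw [Nat.cast_sub hk1]; simp
    simp only [trigCurve, Sum.elim_inr, h2] at h1
    simpa only [mul_comm (w _)] using h1
  obtain ⟨a, b, hab⟩ := hp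
  have hic : ∀ f : ℝ → ℝ, Continuous f →
      IntervalIntegrable (fun θ => f θ * w θ) volume (-π) π := fun f hf =>
    (hint _ _).continuousOn_mul hf.continuousOn
  have hterm : ∀ k ∈ Finset.Icc 1 n, (∫ θ in (-π)..π,
      (a k * Real.cos (k * θ) + b k * Real.sin (k * θ)) * w θ) =
      I / N * ∑ i, (a k * Real.cos (k * y i) + b k * Real.sin (k * y i)) := by
    intro k hk
    simp only [add_mul, mul_assoc]
    rw [intervalIntegral.integral_add ((hic _ (by fun_prop)).const_mul _)
      ((hic _ (by fun_prop)).const_mul _), intervalIntegral.integral_const_mul,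
      intervalIntegral.integral_const_mul, hcos k hk, hsin k hk, Finset.sum_add_distrib,
      ← Finset.mul_sum, ← Finset.mul_sum]
    ring
  simp only [hab, add_mul (a 0), Finset.sum_mul]
  have hsum : IntervalIntegrable (fun θ => ∑ k ∈ Finset.Icc 1 n,
      (a k * Real.cos (k * θ) + b k * Real.sin (k * θ)) * w θ) volume (-π) π := by
    simpa only [Finset.sum_mul] using hic (fun θ => ∑ k ∈ Finset.Icc 1 n,
      (a k * Real.cos (k * θ) + b k * Real.sin (k * θ))) (by fun_prop)
  rw [intervalIntegral.integral_add ((hint _ _).const_mul _) hsum,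
    intervalIntegral.integral_finsetSum fun k _ => hic
      (fun θ => a k * Real.cos (k * θ) + b k * Real.sin (k * θ)) (by fun_prop),
    intervalIntegral.integral_const_mul, Finset.sum_congr rfl hterm, Finset.sum_add_distrib,
    Finset.sum_comm, ← Finset.mul_sum, ← hIdef]
  simp
  field_simp

theorem norm_trigCurve_sub_le {n : ℕ} (hn : 1 ≤ n) (s t : ℝ) :
    ‖trigCurve n s - trigCurve n t‖ ≤ 2 * (n : ℝ) ^ 3 * |s - t| :=
  convex_univ.norm_image_sub_le_of_norm_hasDerivWithin_le
    (fun x _ => (hasDerivAt_trigCurve n x).hasDerivWithinAt)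
    (fun x _ => norm_trigCurveDeriv_le hn x) (mem_univ t) (mem_univ s)

theorem abs_inner_sq_sub_inner_sq_le {E : Type*} [NormedAddCommGroup E] [InnerProductSpace ℝ E]
    {u v x : E} {M d : ℝ} (hu : ‖u‖ ≤ M) (hv : ‖v‖ ≤ M) (huv : ‖u - v‖ ≤ d) :
    |inner ℝ u x ^ 2 - inner ℝ v x ^ 2| ≤ 2 * M * d * ‖x‖ ^ 2 := by
  have hM : 0 ≤ M := (norm_nonneg _).trans hu
  have h1 : inner ℝ u x ^ 2 - inner ℝ v x ^ 2 = inner ℝ (u + v) x * inner ℝ (u - v) x := by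
    rw [inner_add_left, inner_sub_left]
    ring
  rw [h1, abs_mul]
  calc |inner ℝ (u + v) x| * |inner ℝ (u - v) x|
      ≤ (‖u + v‖ * ‖x‖) * (‖u - v‖ * ‖x‖) :=
        mul_le_mul (abs_real_inner_le_norm _ _) (abs_real_inner_le_norm _ _) (abs_nonneg _)
          (by positivity)
    _ ≤ (2 * M * ‖x‖) * (d * ‖x‖) := by
        gcongr
        exact (norm_add_le _ _).trans (by linarith)
    _ = 2 * M * d * ‖x‖ ^ 2 := by ring

/-- A weight whose derivative energy dominates `r` admits Chebyshev-type quadratures with any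
sufficiently large number of nodes. -/
theorem exists_isTrigChebQuad {w : ℝ → ℝ} (hw : ∀ t, 0 ≤ w t)
    (hint : ∀ s t, IntervalIntegrable w volume s t) (hI : 0 < ∫ θ in (-π)..π, w θ)
    (hI' : ∫ θ in (-π)..π, w θ ≤ 2 * π) {n N : ℕ} (hn : 1 ≤ n) {r : ℝ} (hr : 0 < r)
    (hr1 : r ≤ 1)
    (hcoer : ∀ x, r * ‖x‖ ^ 2 ≤ ∫ θ in (-π)..π, w θ * (inner ℝ (trigCurveDeriv n θ) x) ^ 2)
    (hN : 128 * π ^ 3 * (2 * (n : ℝ) ^ 3) ^ 4 / r ^ 2 ≤ N) :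
    ∃ θs : Fin N → ℝ, IsTrigChebQuad w n N θs := by
  have hpi := Real.pi_pos
  have hn' : (1 : ℝ) ≤ n := by exact_mod_cast hn
  set M : ℝ := 2 * (n : ℝ) ^ 3 with hMdef
  have hM1 : 1 ≤ M := by nlinarith [one_le_pow₀ hn' (n := 3)]
  have hM : 0 < M := by linarith
  have hNr : (0 : ℝ) < N := lt_of_lt_of_le (by positivity) hN
  have hN0 : 0 < N := by exact_mod_cast hNr
  have hN1 : 128 * π ^ 3 * M ^ 4 ≤ N * r ^ 2 := by rwa [div_le_iff₀ (by positivity)] at hN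
  set I := ∫ θ in (-π)..π, w θ with hIdef
  obtain ⟨τ, hτ0, hτN, hτmono, hτmass⟩ :=
    exists_equal_mass_partition (by linarith : -π ≤ π) hw hint hI hN0
  have hlen : τ N - τ 0 = 2 * π := by rw [hτ0, hτN]; ring
  have hcoer' : ∀ x, r / (4 * π) * ‖x‖ ^ 2 ≤
      (1 / N : ℝ) * ∑ i : Fin N, (inner ℝ (trigCurveDeriv n (τ (i + 1))) x) ^ 2 := by
    intro x
    have h1 := norm_integral_sub_average_le hw hint (L := 2 * M * M * ‖x‖ ^ 2) (by positivity)
      (f := fun θ => (inner ℝ (trigCurveDeriv n θ) x) ^ 2) (fun s t => by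
        rw [Real.norm_eq_abs]
        refine (abs_inner_sq_sub_inner_sq_le (norm_trigCurveDeriv_le hn s)
          (norm_trigCurveDeriv_le hn t) (norm_trigCurveDeriv_sub_le s t)).trans (le_of_eq ?_)
        ring) hτmono hτmass
    rw [hlen, hτ0, hτN, Real.norm_eq_abs] at h1
    simp only [smul_eq_mul] at h1
    have h2 := (abs_le.1 h1).2
    have h3 := hcoer x
    set S := ∑ i : Fin N, (inner ℝ (trigCurveDeriv n (τ (i + 1))) x) ^ 2
    have h4 : 16 * π ^ 2 * M ^ 2 ≤ N * r := by
      by_contra! hlt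
      have h5 : N * r ^ 2 ≤ 16 * π ^ 2 * M ^ 2 :=
        (mul_le_mul_of_nonneg_left (pow_le_of_le_one hr.le hr1 two_ne_zero) hNr.le).trans hlt.le
      have h6 : 16 * π ^ 2 * M ^ 2 < 128 * π ^ 3 * M ^ 4 := by
        have h7 : M ^ 2 ≤ M ^ 4 := pow_le_pow_right₀ hM1 (by norm_num)
        have h8 : π ^ 2 ≤ π ^ 3 := pow_le_pow_right₀ (by linarith [Real.pi_gt_three]) (by norm_num)
        have h9 : π ^ 2 * M ^ 2 ≤ π ^ 3 * M ^ 4 := by gcongr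
        have : 0 < π ^ 2 * M ^ 2 := by positivity
        nlinarith
      linarith
    have h5 : r * ‖x‖ ^ 2 ≤ I / N * S + 4 * π * M ^ 2 * ‖x‖ ^ 2 * (I / N) := by linarith
    have h6 : r / I * ‖x‖ ^ 2 ≤ 1 / N * S + 4 * π * M ^ 2 / N * ‖x‖ ^ 2 := by
      have h7 : r / I * ‖x‖ ^ 2 = r * ‖x‖ ^ 2 / I := by ring
      rw [h7, div_le_iff₀ hI]
      refine h5.trans (le_of_eq ?_)
      ring
    have h7 : r / (2 * π) ≤ r / I := by gcongr
    have h8 : 4 * π * M ^ 2 / N ≤ r / (4 * π) := by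
      rw [div_le_div_iff₀ hNr (by positivity)]
      linarith
    have h9 : r / (2 * π) = r / (4 * π) + r / (4 * π) := by ring
    have hx := sq_nonneg ‖x‖
    nlinarith [mul_le_mul_of_nonneg_right h7 hx, mul_le_mul_of_nonneg_right h8 hx]
  have herr : ‖I⁻¹ • (∫ θ in (-π)..π, w θ • trigCurve n θ) -
      (1 / N : ℝ) • ∑ i : Fin N, trigCurve n (τ (i + 1))‖ ≤
      (r / (4 * π)) ^ 2 / (4 * M ^ 3) := by
    have h1 := norm_integral_sub_average_le hw hint hM.le (norm_trigCurve_sub_le hn) hτmono hτmass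
    rw [hlen, hτ0, hτN] at h1
    have h2 : I⁻¹ • (∫ θ in (-π)..π, w θ • trigCurve n θ) -
        (1 / N : ℝ) • ∑ i : Fin N, trigCurve n (τ (i + 1)) =
        I⁻¹ • ((∫ θ in (-π)..π, w θ • trigCurve n θ) -
        (I / N) • ∑ i : Fin N, trigCurve n (τ (i + 1))) := by
      rw [smul_sub, smul_smul]
      congr 2
      field_simp
    rw [h2, norm_smul, Real.norm_of_nonneg (by positivity)]
    calc I⁻¹ * _ ≤ I⁻¹ * (M * (2 * π) * (I / N)) := by gcongr
      _ = M * (2 * π) / N := by field_simp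
      _ ≤ _ := by
        rw [div_le_iff₀ hNr, div_pow, div_div, div_mul_eq_mul_div, le_div_iff₀ (by positivity)]
        linarith
  obtain ⟨y, hy⟩ := exists_average_eq hM (by positivity) (hasDerivAt_trigCurve n)
    (norm_trigCurveDeriv_le hn) (fun s t => norm_trigCurveDeriv_sub_le s t) hN0 _ _ hcoer' herr
  exact ⟨_, isTrigChebQuad_comp_sort fun p hp =>
    integral_mul_eq_of_average_trigCurve hint hI.ne' hN0 hy hp⟩

theorem exists_critical_scale {α : ℝ} (hα : 0 < α) {n : ℕ} (hn : 1 ≤ n) :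
    ∃ D : ℝ, 0 < D ∧ D ≤ 1 ∧ n * D = (n : ℝ) ^ (α / (α + 1)) ∧
      D ^ (-α) = (n : ℝ) ^ (α / (α + 1)) := by
  have hn' : (1 : ℝ) ≤ n := by exact_mod_cast hn
  have hn0 : (0 : ℝ) < n := by linarith
  have hα1 : 0 < α + 1 := by linarith
  refine ⟨(n : ℝ) ^ (-(1 / (α + 1))), by positivity,
    Real.rpow_le_one_of_one_le_of_nonpos hn' (by rw [neg_nonpos]; positivity), ?_, ?_⟩
  · nth_rewrite 1 [← Real.rpow_one (n : ℝ)]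
    rw [← Real.rpow_add hn0]
    congr 1
    field_simp
    ring
  · rw [← Real.rpow_mul hn0.le]
    congr 1
    field_simp

theorem natCast_le_exp_rpow {β : ℝ} (hβ : 0 < β) {n : ℕ} (hn : 1 ≤ n) :
    (n : ℝ) ≤ Real.exp ((n : ℝ) ^ β / β) := by
  have hn' : (0 : ℝ) < n := by exact_mod_cast hn
  rw [← Real.log_le_iff_le_exp hn']
  exact Real.log_le_rpow_div hn'.le hβ

theorem exists_isTrigChebQuad_stretchedExp {α : ℝ} (hα : 0 < α) {n N : ℕ} (hn : 1 ≤ n)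
    (hN : Real.exp ((50 + 18 / (α / (α + 1))) * (n : ℝ) ^ (α / (α + 1))) ≤ N) :
    ∃ θs : Fin N → ℝ, IsTrigChebQuad (stretchedExp α) n N θs := by
  obtain ⟨D, hD0, hD1, hnD, hDα⟩ := exists_critical_scale hα hn
  have hn' : (1 : ℝ) ≤ n := by exact_mod_cast hn
  have hβ : 0 < α / (α + 1) := by positivity
  have hlog := natCast_le_exp_rpow hβ hn
  have hs1 : 1 ≤ (n : ℝ) ^ (α / (α + 1)) := Real.one_le_rpow hn' hβ.le
  generalize α / (α + 1) = β at *
  set s := (n : ℝ) ^ β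
  set r : ℝ := Real.exp (-s) * Real.exp (-(12 * s)) / (128 * (n : ℝ) ^ 3) with hr
  have hr13 : r = Real.exp (-(13 * s)) / (128 * (n : ℝ) ^ 3) := by
    rw [hr, ← Real.exp_add]
    ring_nf
  refine exists_isTrigChebQuad (stretchedExp_nonneg α) (intervalIntegrable_stretchedExp α)
    (integral_stretchedExp_pos α) (integral_stretchedExp_le α) hn (r := r) (by positivity) ?_ ?_ ?_
  · have h3 : 1 ≤ (n : ℝ) ^ 3 := one_le_pow₀ hn'
    rw [hr13, div_le_one (by positivity)]
    exact (Real.exp_le_one_iff.2 (by linarith)).trans (by linarith)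
  · intro x
    rw [hr, ← hnD]
    refine le_integral_mul_inner_sq hn (stretchedExp_nonneg α)
      (intervalIntegrable_stretchedExp α) hD0.le hD1 (fun t ht => ?_) x
    rw [hnD, ← hDα]
    exact le_stretchedExp hα.le hD0 ht
  · refine le_trans (le_of_eq ?_) ((?_ : (128 * 16 * 128 ^ 2 * π ^ 3) *
      (n : ℝ) ^ 18 * Real.exp (26 * s) ≤ _).trans hN)
    · rw [hr13, div_pow, ← Real.exp_nat_mul]
      have : Real.exp (26 * s) * Real.exp ((2 : ℕ) * -(13 * s)) = 1 := by
        rw [← Real.exp_add, Real.exp_eq_one_iff]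
        push_cast
        ring
      rw [eq_comm, div_div_eq_mul_div, eq_div_iff (Real.exp_pos _).ne', mul_assoc, this]
      ring
    · have h1 : 128 * 16 * 128 ^ 2 * π ^ 3 ≤ Real.exp (24 * s) := by
        have h2 : π ^ 3 ≤ 4 ^ 3 := pow_le_pow_left₀ Real.pi_pos.le Real.pi_le_four 3
        have h3 : (2.7 : ℝ) ^ 24 ≤ Real.exp 1 ^ 24 :=
          pow_le_pow_left₀ (by norm_num) (by linarith [Real.exp_one_gt_d9]) 24
        rw [← Real.exp_nat_mul] at h3
        have h4 : Real.exp 24 ≤ Real.exp (24 * s) := Real.exp_le_exp.2 (by linarith)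
        norm_num at h2 h3
        linarith
      have h2 : (n : ℝ) ^ 18 ≤ Real.exp (18 / β * s) := by
        refine (pow_le_pow_left₀ (by linarith) hlog 18).trans (le_of_eq ?_)
        rw [← Real.exp_nat_mul]
        congr 1
        push_cast
        ring
      calc _ ≤ Real.exp (24 * s) * Real.exp (18 / β * s) * Real.exp (26 * s) := by gcongr
        _ = _ := by
          rw [← Real.exp_add, ← Real.exp_add]
          ring_nf

theorem two_le_of_isTrigChebQuad {α : ℝ} {n N : ℕ} (hn : 1 ≤ n) {θs : Fin N → ℝ}
    (h : IsTrigChebQuad (stretchedExp α) n N θs) : 2 ≤ N := by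
  by_contra! hlt
  obtain ⟨c, hc⟩ : ∃ c, ∀ i, θs i = c := by
    have : Subsingleton (Fin N) := Fin.subsingleton_iff_le_one.2 (by omega)
    rcases isEmpty_or_nonempty (Fin N) with hE | ⟨⟨i⟩⟩
    · exact ⟨0, fun i => (hE.false i).elim⟩
    · exact ⟨θs i, fun j => congrArg θs (Subsingleton.elim j i)⟩
  have hp : IsTrigPoly n fun θ => 1 - Real.cos (θ - c) := by
    have h1 := ((isTrigPoly_const n 1).add ((isTrigPoly_cos hn).const_mul (-Real.cos c))).add
      ((isTrigPoly_sin hn).const_mul (-Real.sin c))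
    convert h1 using 2 with θ
    rw [Real.cos_sub]
    push_cast
    ring_nf
  have hsum := h.2 _ hp
  have hzero : ∀ i, 1 - Real.cos (θs i - c) = 0 := fun i => by simp [hc]
  simp only [hzero, Finset.sum_const_zero, mul_zero] at hsum
  refine (integral_mul_stretchedExp_pos (α := α) (f := fun θ => 1 - Real.cos (θ - c))
    (by fun_prop) (fun θ => sub_nonneg.2 (Real.cos_le_one _)) ?_).ne' hsum
  have hcount : (range fun k : ℤ => (k : ℝ) * (2 * π) + c).Countable := countable_range _
  filter_upwards [hcount.ae_notMem volume] with θ hθ h0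
  obtain ⟨k, hk⟩ := (Real.cos_eq_one_iff _).1 (sub_eq_zero.1 h0).symm
  exact hθ ⟨k, by linarith⟩

theorem exists_node_pos {w p : ℝ → ℝ} {n N : ℕ} {θs : Fin N → ℝ} (hw : ∀ t, 0 ≤ w t)
    (h : IsTrigChebQuad w n N θs) (hp : IsTrigPoly n p)
    (hpos : 0 < ∫ θ in (-π)..π, p θ * w θ) : ∃ i, 0 < p (θs i) := by
  by_contra! hle
  rw [h.2 p hp] at hpos
  refine hpos.not_ge (mul_nonpos_of_nonneg_of_nonpos (div_nonneg ?_ (Nat.cast_nonneg N))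
    (Finset.sum_nonpos fun i _ => hle i))
  exact intervalIntegral.integral_nonneg (by linarith [Real.pi_pos]) fun t _ => hw t

theorem integral_mul_node_le {w p : ℝ → ℝ} {n N : ℕ} {θs : Fin N → ℝ} (hw : ∀ t, 0 ≤ w t)
    (h : IsTrigChebQuad w n N θs) (hp : IsTrigPoly n p) (hp0 : ∀ t, 0 ≤ p t) (i : Fin N) :
    (∫ θ in (-π)..π, w θ) * p (θs i) ≤ N * ∫ θ in (-π)..π, p θ * w θ := by
  have hN : (N : ℝ) ≠ 0 := by exact_mod_cast (Fin.pos i).ne'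
  rw [h.2 p hp, ← mul_assoc, mul_div_cancel₀ _ hN]
  exact mul_le_mul_of_nonneg_left
    (Finset.single_le_sum (f := fun j => p (θs j)) (fun j _ => hp0 _) (Finset.mem_univ i))
    (intervalIntegral.integral_nonneg (by linarith [Real.pi_pos]) fun t _ => hw t)

theorem neg_one_le_windowPoly (n : ℕ) {η : ℝ} (h0 : 0 ≤ η) (h1 : η ≤ 1) (θ : ℝ) :
    -1 ≤ (windowPoly n η).eval (Real.cos θ) := by
  rw [← Real.cos_arccos (Real.neg_one_le_cos θ) (Real.cos_le_one θ)]
  have hpos := Real.arccos_nonneg (Real.cos θ)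
  have hle := Real.arccos_le_pi (Real.cos θ)
  rcases le_total (|Real.arccos (Real.cos θ)|) (2 * η) with h | h
  · linarith [one_le_windowPoly n h0 h1 h]
  · exact (abs_le.1 (abs_windowPoly_le_one n h0 h1 h (by rwa [abs_of_nonneg hpos]))).1

theorem le_integral_windowPoly_sub_one_mul {α : ℝ} (hα : 0 ≤ α) (n : ℕ) {η : ℝ} (h0 : 0 < η)
    (h1 : η ≤ 1) (h4 : 4 ≤ Real.exp (n * (η / 2))) :
    η / 2 * (Real.exp (n * (η / 2)) / 4 * Real.exp (-((η / 2) ^ (-α)))) - 4 * π ≤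
      ∫ θ in (-π)..π, ((windowPoly n η).eval (Real.cos θ) - 1) * stretchedExp α θ := by
  have hpi := Real.pi_gt_three
  set f : ℝ → ℝ := fun θ => ((windowPoly n η).eval (Real.cos θ) - 1) * stretchedExp α θ with hf
  have hfi : ∀ a b, IntervalIntegrable f volume a b := fun a b =>
    (intervalIntegrable_stretchedExp α a b).continuousOn_mul
      (((windowPoly n η).continuous.comp Real.continuous_cos).sub continuous_const).continuousOn
  have hf2 : ∀ θ, 0 ≤ f θ + 2 := by
    intro θ
    have h2 := neg_one_le_windowPoly n h0.le h1 θ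
    have h3 := stretchedExp_nonneg α θ
    have h5 := stretchedExp_le_one α θ
    simp only [hf]
    nlinarith
  have hmono := intervalIntegral.integral_mono_interval (f := fun θ => f θ + 2) (μ := volume)
    (c := -π) (a := η / 2) (b := η) (d := π) (by linarith) (by linarith) (by linarith)
    (ae_of_all _ hf2) ((hfi _ _).add intervalIntegrable_const)
  have hlow := intervalIntegral.integral_mono_on (a := η / 2) (b := η) (μ := volume) (by linarith)
    (intervalIntegrable_const (c := Real.exp (n * (η / 2)) / 4 * Real.exp (-((η / 2) ^ (-α)))))
    ((hfi (η / 2) η).add (intervalIntegrable_const (c := (2 : ℝ)))) (fun θ hθ => by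
      have hθ0 : |θ| = θ := abs_of_nonneg (by linarith [hθ.1])
      have h2 := exp_le_windowPoly n h0.le h1 (hθ0.trans_le hθ.2)
      have h3 : Real.exp (-((η / 2) ^ (-α))) ≤ stretchedExp α θ :=
        le_stretchedExp hα (by positivity) (hθ.1.trans_eq hθ0.symm)
      have h5 : Real.exp (n * (η / 2)) / 4 ≤ (windowPoly n η).eval (Real.cos θ) - 1 := by linarith
      have h6 : Real.exp (n * (η / 2)) / 4 * Real.exp (-((η / 2) ^ (-α))) ≤ f θ := by
        simp only [hf]
        gcongr
        linarith
      linarith)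
  rw [intervalIntegral.integral_const, smul_eq_mul] at hlow
  have hadd : ∫ θ in (-π)..π, (f θ + 2) = (∫ θ in (-π)..π, f θ) + 4 * π := by
    rw [intervalIntegral.integral_add (hfi _ _) intervalIntegrable_const,
      intervalIntegral.integral_const, smul_eq_mul]
    ring
  linarith

theorem integral_windowPoly_add_one_mul_le {α : ℝ} (hα : 0 ≤ α) (m : ℕ) {η : ℝ} (h0 : 0 ≤ η)
    (h1 : η ≤ 1) (hm : m * (4 * η) ≤ (2 * η) ^ (-α)) :
    ∫ θ in (-π)..π, ((windowPoly m η).eval (Real.cos θ) + 1) * stretchedExp α θ ≤ 4 * π := by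
  have hpi := Real.pi_gt_three
  have hbound : ∀ θ ∈ Icc (-π) π,
      ((windowPoly m η).eval (Real.cos θ) + 1) * stretchedExp α θ ≤ 2 := by
    intro θ hθ
    have h3 := stretchedExp_nonneg α θ
    rcases le_total (|θ|) (2 * η) with h | h
    · have h4 := windowPoly_le_exp m h0 h1 h
      have h5 : 1 ≤ Real.exp (m * (4 * η)) := Real.one_le_exp (by positivity)
      have h6 := stretchedExp_le hα h
      calc _ ≤ (2 * Real.exp (m * (4 * η))) * Real.exp (-((2 * η) ^ (-α))) :=
            mul_le_mul (by linarith) h6 h3 (by positivity)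
        _ = 2 * Real.exp (m * (4 * η) - (2 * η) ^ (-α)) := by
            rw [mul_assoc, ← Real.exp_add, sub_eq_add_neg]
        _ ≤ 2 := by linarith [Real.exp_le_one_iff.2 (sub_nonpos.2 hm)]
    · have h4 := (abs_le.1 (abs_windowPoly_le_one m h0 h1 h (abs_le.2 hθ))).2
      have h5 := neg_one_le_windowPoly m h0 h1 θ
      nlinarith [stretchedExp_le_one α θ]
  have := intervalIntegral.integral_mono_on (by linarith)
    ((intervalIntegrable_stretchedExp α (-π) π).continuousOn_mul
      (((windowPoly m η).continuous.comp Real.continuous_cos).add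
        (continuous_const (y := (1 : ℝ)))).continuousOn)
    (intervalIntegrable_const (c := (2 : ℝ))) hbound
  rw [intervalIntegral.integral_const, smul_eq_mul] at this
  exact this.trans (le_of_eq (by ring))

/-- A quadrature of degree `n` must resolve the scale `D` at which `exp (-θ ^ (-α))` balances
`exp (-n * θ)`: some node lies within `O(D)` of the origin, and this forces many nodes. -/
theorem le_card_of_isTrigChebQuad {α β s D K κ : ℝ} (hα : 0 < α) (hβ : 0 < β) (hs : 1 ≤ s)
    (hD : 0 < D) {n N : ℕ} (hnD : n * D = s) (hDα : D ^ (-α) = s) (hn : (n : ℝ) ≤ Real.exp (s / β))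
    (hK : K = 12 + 2 / β) (hKD : 2 * (K * D) ≤ 1) (hκ0 : 0 < κ) (hκ1 : κ ≤ 1)
    (hκ : 8 * K * κ ≤ (4 * K) ^ (-α)) {θs : Fin N → ℝ}
    (h : IsTrigChebQuad (stretchedExp α) n N θs) :
    (∫ θ in (-π)..π, stretchedExp α θ) / (8 * π) * Real.exp (κ * K * s - 1) ≤ N := by
  have hpi := Real.pi_gt_three
  have hK12 : 12 ≤ K := by
    have : 0 < 2 / β := by positivity
    linarith
  have hK0 : 0 < K := by linarith
  have hη0 : 0 < K * D := by positivity
  have hI := integral_stretchedExp_pos α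
  have hexp5 : 16 * π < Real.exp (5 * s) := by
    have h1 : (2.7 : ℝ) ^ 5 ≤ Real.exp 1 ^ 5 :=
      pow_le_pow_left₀ (by norm_num) (by linarith [Real.exp_one_gt_d9]) 5
    rw [← Real.exp_nat_mul] at h1
    have h2 : Real.exp 5 ≤ Real.exp (5 * s) := Real.exp_le_exp.2 (by linarith)
    norm_num at h1
    linarith [Real.pi_le_four]
  have hnKD : n * (K * D / 2) = s / β + 6 * s := by
    have : n * (K * D / 2) = K / 2 * (n * D) := by ring
    rw [this, hnD, hK]
    ring
  obtain ⟨i, hi⟩ : ∃ i, 0 < (windowPoly n (K * D)).eval (Real.cos (θs i)) - 1 := by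
    have hp : IsTrigPoly n fun θ => (windowPoly n (K * D)).eval (Real.cos θ) - 1 := by
      simpa only [sub_eq_add_neg] using
        (isTrigPoly_eval_cos (windowPoly_natDegree_le n (K * D))).add (isTrigPoly_const n (-1))
    refine exists_node_pos (stretchedExp_nonneg α) h hp (lt_of_lt_of_le ?_
      (le_integral_windowPoly_sub_one_mul hα.le n hη0 (by linarith) ?_))
    · have h1 : Real.exp (-s) ≤ Real.exp (-((K * D / 2) ^ (-α))) := by
        rw [Real.exp_le_exp, neg_le_neg_iff, ← hDα]
        exact Real.rpow_le_rpow_of_nonpos hD (by nlinarith) (by linarith)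
      have h2 : Real.exp (-(s / β)) ≤ K * D / 2 := by
        have hn0 : 0 < (n : ℝ) := by
          by_contra! hle
          nlinarith
        have h3 : 1 ≤ Real.exp (s / β) * D := by nlinarith
        rw [Real.exp_neg, inv_le_iff_one_le_mul₀' (Real.exp_pos _)]
        nlinarith
      have h3 : Real.exp (-(s / β)) * (Real.exp (s / β + 6 * s) / 4 * Real.exp (-s)) =
          Real.exp (5 * s) / 4 := by
        rw [div_mul_eq_mul_div, ← mul_div_assoc, ← Real.exp_add, ← Real.exp_add]
        ring_nf
      have h4 : Real.exp (-(s / β)) * (Real.exp (s / β + 6 * s) / 4 * Real.exp (-s)) ≤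
          K * D / 2 * (Real.exp (n * (K * D / 2)) / 4 *
            Real.exp (-((K * D / 2) ^ (-α)))) := by
        rw [hnKD]
        gcongr
      linarith
    · rw [hnKD]
      have : 0 < s / β := by positivity
      linarith [Real.add_one_le_exp (s / β + 6 * s)]
  have hcos := Real.cos_arccos (Real.neg_one_le_cos (θs i)) (Real.cos_le_one (θs i))
  set φ := Real.arccos (Real.cos (θs i))
  have hφ0 : |φ| = φ := abs_of_nonneg (Real.arccos_nonneg _)
  have hφ : |φ| ≤ 2 * (K * D) := by
    by_contra! hlt
    have := abs_windowPoly_le_one n hη0.le (by linarith) hlt.le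
      (hφ0.trans_le (Real.arccos_le_pi _))
    rw [hcos] at this
    linarith [(abs_le.1 this).2]
  set m := ⌊κ * n⌋₊
  have hm1 : (m : ℝ) ≤ κ * n := Nat.floor_le (by positivity)
  have hm2 : κ * n < m + 1 := Nat.lt_floor_add_one _
  have hmn : m ≤ n := by
    have : (m : ℝ) ≤ n := hm1.trans (mul_le_of_le_one_left (Nat.cast_nonneg n) hκ1)
    exact_mod_cast this
  have hp : IsTrigPoly n fun θ => (windowPoly m (2 * (K * D))).eval (Real.cos θ) + 1 :=
    (isTrigPoly_eval_cos ((windowPoly_natDegree_le m _).trans hmn)).add (isTrigPoly_const n 1)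
  have hnode := integral_mul_node_le (stretchedExp_nonneg α) h hp (fun t => by
    linarith [neg_one_le_windowPoly m (by positivity : 0 ≤ 2 * (K * D)) hKD t]) i
  have hint := integral_windowPoly_add_one_mul_le hα.le m (by positivity) hKD (by
    have h1 : (2 * (2 * (K * D))) ^ (-α) = (4 * K) ^ (-α) * s := by
      rw [← hDα, ← Real.mul_rpow (by positivity) hD.le]
      ring_nf
    rw [h1]
    calc m * (4 * (2 * (K * D))) ≤ κ * n * (4 * (2 * (K * D))) := by gcongr
      _ = 8 * K * κ * s := by rw [← hnD]; ring
      _ ≤ _ := by gcongr)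
  have hval := exp_le_windowPoly m (by positivity : 0 ≤ 2 * (K * D)) hKD hφ
  rw [hcos] at hval
  have hexp : Real.exp (κ * K * s - 1) ≤ Real.exp (m * (2 * (K * D) / 2)) := by
    rw [Real.exp_le_exp]
    have h1 : κ * K * s = κ * n * (K * D) := by rw [← hnD]; ring
    nlinarith
  have h1 : (∫ θ in (-π)..π, stretchedExp α θ) * (Real.exp (κ * K * s - 1) / 2) ≤
      N * (4 * π) :=
    calc _ ≤ (∫ θ in (-π)..π, stretchedExp α θ) *
          ((windowPoly m (2 * (K * D))).eval (Real.cos (θs i)) + 1) := by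
          gcongr
          linarith
      _ ≤ _ := hnode
      _ ≤ _ := by gcongr
  rw [div_mul_eq_mul_div, div_le_iff₀ (by positivity)]
  linarith

theorem exists_exp_le_card_of_isTrigChebQuad {α : ℝ} (hα : 0 < α) :
    ∃ c > (0 : ℝ), ∀ n : ℕ, 1 ≤ n → ∀ N : ℕ, ∀ θs : Fin N → ℝ,
      IsTrigChebQuad (stretchedExp α) n N θs →
        Real.exp (c * (n : ℝ) ^ (α / (α + 1))) ≤ N := by
  have hβ : 0 < α / (α + 1) := by positivity
  have hpi := Real.pi_pos
  obtain ⟨K, hK⟩ : ∃ K, K = 12 + 2 / (α / (α + 1)) := ⟨_, rfl⟩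
  have hK0 : 0 < K := by rw [hK]; positivity
  obtain ⟨κ, hκ⟩ : ∃ κ, κ = min 1 ((4 * K) ^ (-α) / (8 * K)) := ⟨_, rfl⟩
  have hκ0 : 0 < κ := by rw [hκ]; positivity
  have hκ1 : κ ≤ 1 := hκ.trans_le (min_le_left _ _)
  have hκ2 : 8 * K * κ ≤ (4 * K) ^ (-α) := by
    have := hκ.trans_le (min_le_right _ _)
    rwa [le_div_iff₀' (by positivity)] at this
  have hI := integral_stretchedExp_pos α
  set I := ∫ θ in (-π)..π, stretchedExp α θ
  obtain ⟨S, hS⟩ : ∃ S, S = max ((2 * K) ^ α) (8 * π * Real.exp 1 / I / (κ * K / 2)) := ⟨_, rfl⟩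
  have hS0 : 0 < S := hS ▸ lt_max_of_lt_left (by positivity)
  have hlog2 : 0 < Real.log 2 := Real.log_pos one_lt_two
  refine ⟨min (κ * K / 2) (Real.log 2 / S), by positivity, fun n hn N θs h => ?_⟩
  obtain ⟨D, hD0, -, hnD, hDα⟩ := exists_critical_scale hα hn
  have hn' : (1 : ℝ) ≤ n := by exact_mod_cast hn
  have hlog := natCast_le_exp_rpow hβ hn
  have hs1 : 1 ≤ (n : ℝ) ^ (α / (α + 1)) := Real.one_le_rpow hn' hβ.le
  set s := (n : ℝ) ^ (α / (α + 1))
  have hs0 : 0 < s := by linarith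
  rcases lt_or_ge s S with hsS | hsS
  · have h2 : (2 : ℝ) ≤ N := by exact_mod_cast two_le_of_isTrigChebQuad hn h
    refine le_trans ?_ h2
    rw [← Real.le_log_iff_exp_le two_pos]
    calc _ ≤ Real.log 2 / S * S := by
          gcongr
          exact min_le_right _ _
      _ = Real.log 2 := div_mul_cancel₀ _ hS0.ne'
  · have hKD : 2 * (K * D) ≤ 1 := by
      by_contra! hlt
      have h1 : (2 * K) ^ α ≤ D ^ (-α) := hDα ▸ (le_max_left _ _).trans (hS ▸ hsS)
      have h2 : D ^ (-α) < ((2 * K)⁻¹) ^ (-α) := by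
        refine Real.rpow_lt_rpow_of_neg (by positivity) ?_ (by linarith)
        rw [inv_lt_iff_one_lt_mul₀ (by positivity)]
        linarith
      rw [Real.inv_rpow (by positivity), Real.rpow_neg (x := 2 * K) (by positivity), inv_inv] at h2
      exact h2.not_ge h1
    have hcard := le_card_of_isTrigChebQuad hα hβ hs1 hD0 hnD hDα hlog hK hKD hκ0 hκ1 hκ2 h
    have hx : 8 * π * Real.exp 1 / I ≤ Real.exp (κ * K / 2 * s) := by
      have h1 : 8 * π * Real.exp 1 / I / (κ * K / 2) ≤ s := (le_max_right _ _).trans (hS ▸ hsS)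
      rw [div_le_iff₀ (by positivity)] at h1
      linarith [Real.add_one_le_exp (κ * K / 2 * s)]
    refine le_trans ?_ hcard
    calc _ ≤ Real.exp (κ * K / 2 * s) := by
          gcongr
          exact min_le_left _ _
      _ ≤ I / (8 * π) * (Real.exp (κ * K / 2 * s) / Real.exp 1) * Real.exp (κ * K / 2 * s) := by
          refine le_mul_of_one_le_left (Real.exp_pos _).le ?_
          rw [div_le_iff₀ hI] at hx
          rw [div_mul_div_comm, one_le_div (by positivity)]
          linarith
      _ = I / (8 * π) * Real.exp (κ * K * s - 1) := by
          rw [mul_assoc, ← Real.exp_sub, ← Real.exp_add]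
          ring_nf

theorem stretched_exponential_weight (α : ℝ) (hα : 0 < α) :
    ∃ c > (0:ℝ), ∃ C > (0:ℝ),
      ∀ W : ℝ → ℝ, Function.Periodic W (2 * π) →
        (∀ θ ∈ Ico (-π) π, W θ = if θ = 0 then 0 else Real.exp (-(|θ| ^ (-α)))) →
        ∀ n : ℕ, 1 ≤ n →
          (∀ N : ℕ, ∀ θs : Fin N → ℝ, IsTrigChebQuad W n N θs →
            Real.exp (c * (n : ℝ) ^ (α / (α + 1))) ≤ N) ∧
          (∀ N : ℕ, Real.exp (C * (n : ℝ) ^ (α / (α + 1))) ≤ N →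
            ∃ θs : Fin N → ℝ, IsTrigChebQuad W n N θs) := by
  obtain ⟨c, hc, hlower⟩ := exists_exp_le_card_of_isTrigChebQuad hα
  refine ⟨c, hc, 50 + 18 / (α / (α + 1)), by positivity, fun W hper hW n hn => ⟨?_, ?_⟩⟩
  · intro N θs h
    exact hlower n hn N θs
      ((isTrigChebQuad_congr (eq_stretchedExp_of_periodic hper hW) n N θs).1 h)
  · intro N hN
    obtain ⟨θs, h⟩ := exists_isTrigChebQuad_stretchedExp hα hn hN
    exact ⟨θs, (isTrigChebQuad_congr (eq_stretchedExp_of_periodic hper hW) n N θs).2 h⟩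
end
end
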